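/- For a planar bipartite graph G and any perfect matching M of G, the forcing number f(G,M) equals C(G,M), the maximum number of pairwise vertex-disjoint M-alternating cycles of G. -/

import Mathlib

open SimpleGraph

/-- `M` is a perfect matching of the graph `G` restricted to the vertex set `A`:
a set of pairwise disjoint edges of `G`, with all endpoints in `A`, covering every
vertex of `A`. -/
def IsPMOn {V : Type*} (G : SimpleGraph V) (A : Set V) (M : Set (Sym2 V)) : Prop :=
  M ⊆ G.edgeSet ∧ (∀ e ∈ M, ∀ v ∈ e, v ∈ A) ∧
    (M.Pairwise fun e f => ∀ v, v ∈ e → v ∉ f) ∧ (∀ v ∈ A, ∃ e ∈ M, v ∈ e)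

/-- `S` is a forcing set of the perfect matching `M` of `G` (restricted to `A`):
`S ⊆ M` and `M` is the unique perfect matching containing `S`. -/
def IsForcingOn {V : Type*} (G : SimpleGraph V) (A : Set V) (M S : Set (Sym2 V)) : Prop :=
  S ⊆ M ∧ ∀ M', IsPMOn G A M' → S ⊆ M' → M' = M

/-- The forcing number of a perfect matching: minimum size of a forcing set. -/
noncomputable def forcingNumOn {V : Type*} (G : SimpleGraph V) (A : Set V)
    (M : Set (Sym2 V)) : ℕ :=
  sInf {n | ∃ S, IsForcingOn G A M S ∧ S.ncard = n}

/-- Vertices remaining after deleting the endpoints of edges in `S`. -/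
def delVerts {V : Type*} (S : Set (Sym2 V)) : Set V := {v | ∀ e ∈ S, v ∉ e}

/-- A closed walk `c` is an `M`-alternating cycle: it is a cycle and its edges
alternate between `M` and its complement (including around the wrap). -/
def IsAltCycle {V : Type*} (G : SimpleGraph V) (M : Set (Sym2 V)) {v : V}
    (c : G.Walk v v) : Prop :=
  c.IsCycle ∧ c.edges.Chain' (fun e f => e ∈ M ↔ f ∉ M) ∧
    ∀ e f, c.edges.head? = some e → c.edges.getLast? = some f → (f ∈ M ↔ e ∉ M)

/-- `G` has `H` as a minor: there are nonempty, connected, pairwise disjoint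
branch sets realizing the adjacency of `H`. -/
def HasMinor {V : Type*} {W : Type*} (G : SimpleGraph V) (H : SimpleGraph W) : Prop :=
  ∃ B : W → Set V, (∀ w, (B w).Nonempty) ∧ (∀ w, (G.induce (B w)).Connected) ∧
    (Pairwise fun w w' => Disjoint (B w) (B w')) ∧
    ∀ w w', H.Adj w w' → ∃ u ∈ B w, ∃ x ∈ B w', G.Adj u x

/-- Planarity via Wagner's characterization: no `K₅` and no `K₃,₃` minor. -/
def IsPlanarGraph {V : Type*} (G : SimpleGraph V) : Prop :=
  ¬HasMinor G (completeGraph (Fin 5)) ∧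
    ¬HasMinor G (completeBipartiteGraph (Fin 3) (Fin 3))


namespace FN
open Classical
set_option linter.unusedSectionVars false
set_option linter.unusedSimpArgs false
set_option linter.unusedVariables false

universe u
section algebra
variable {V : Type u} [Fintype V]

/-- integer circulations supported on a graph -/
structure IsCirc (G : SimpleGraph V) (f : V → V → ℤ) : Prop where
  anti : ∀ u v, f u v = - f v u
  supp : ∀ u v, f u v ≠ 0 → G.Adj u v
  bal : ∀ v, ∑ u, f v u = 0

/-- algebraic plane structure: `L u v` is the face to the left of the dart `(u,v)` -/
structure Emb (G : SimpleGraph V) {X : Type} (L : V → V → X) : Prop where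
  na : ∀ u v, ¬ G.Adj u v → L u v = L v u
  bal : ∀ (p : X → ℤ) v, ∑ u, (p (L v u) - p (L u v)) = 0
  rep : ∀ f, IsCirc G f → ∃ p : X → ℤ, ∀ u v, f u v = p (L u v) - p (L v u)

def Good (G : SimpleGraph V) : Prop :=
  ∃ (X : Type) (_ : Finite X) (L : V → V → X), Emb G L

def Conn {X : Type} (L : V → V → X) : Prop :=
  ∀ p : X → ℤ, (∀ u v, p (L u v) = p (L v u)) → ∀ x y, p x = p y

theorem IsCirc.mono {G H : SimpleGraph V} (h : G ≤ H) {f : V → V → ℤ} (hf : IsCirc G f) :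
    IsCirc H f := ⟨hf.anti, fun u v huv => h (hf.supp u v huv), hf.bal⟩

theorem IsCirc.zero_of_not_adj {G : SimpleGraph V} {f : V → V → ℤ} (hf : IsCirc G f) {u v : V}
    (h : ¬ G.Adj u v) : f u v = 0 := by
  by_contra h'; exact h (hf.supp u v h')

/-- coboundaries are circulations -/
theorem Emb.circ {G : SimpleGraph V} {X : Type} {L : V → V → X} (h : Emb G L) (p : X → ℤ) :
    IsCirc G (fun u v => p (L u v) - p (L v u)) :=
  ⟨fun u v => by ring, fun u v huv => by
    by_contra hn; exact huv (by simp [h.na u v hn]), fun v => h.bal p v⟩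

theorem Good.mono {G H : SimpleGraph V} (hle : H ≤ G) (hG : Good G) : Good H := by
  obtain ⟨X, hX, L, hL⟩ := hG
  let r : X → X → Prop := fun x y => ∃ u v, ¬ H.Adj u v ∧ x = L u v ∧ y = L v u
  refine ⟨Quot r, inferInstance, fun u v => Quot.mk r (L u v), ?_, ?_, ?_⟩
  · intro u v huv
    exact Quot.sound ⟨u, v, huv, rfl, rfl⟩
  · intro p v
    exact hL.bal (fun x => p (Quot.mk r x)) v
  · intro f hf
    obtain ⟨p, hp⟩ := hL.rep f (hf.mono hle)
    refine ⟨Quot.lift p ?_, fun u v => hp u v⟩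
    rintro x y ⟨u, v, huv, rfl, rfl⟩
    have := hp u v
    rw [hf.zero_of_not_adj huv] at this
    linarith

theorem Good.conn {G : SimpleGraph V} (hG : Good G) :
    ∃ (X : Type) (_ : Finite X) (L : V → V → X), Emb G L ∧ Conn L := by
  obtain ⟨X, hX, L, hL⟩ := hG
  let r : X → X → Prop := fun x y => ∃ u v, x = L u v ∧ y = L v u
  let Y := Quot r
  let σ : Y → X := fun y => (Quot.exists_rep y).choose
  have hσ : ∀ y, Quot.mk r (σ y) = y := fun y => (Quot.exists_rep y).choose_spec
  let s : X → X → Prop := fun x x' => ∃ y y', x = σ y ∧ x' = σ y'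
  refine ⟨Quot s, inferInstance, fun u v => Quot.mk s (L u v), ⟨?_, ?_, ?_⟩, ?_⟩
  · intro u v huv
    simp only [hL.na u v huv]
  · intro p v
    exact hL.bal (fun x => p (Quot.mk s x)) v
  · intro f hf
    obtain ⟨p, hp⟩ := hL.rep f hf
    refine ⟨Quot.lift (fun x => p x - p (σ (Quot.mk r x))) ?_, fun u v => ?_⟩
    · rintro x x' ⟨y, y', rfl, rfl⟩
      simp [hσ]
    · have : Quot.mk r (L u v) = Quot.mk r (L v u) := Quot.sound ⟨u, v, rfl, rfl⟩
      simp only [this, hp u v]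
      ring
  · intro p hp
    have h1 : ∀ x, p (Quot.mk s x) = p (Quot.mk s (σ (Quot.mk r x))) := by
      let q : Y → ℤ := Quot.lift (fun x => p (Quot.mk s x)) (by
        rintro x y ⟨u, v, rfl, rfl⟩; exact hp u v)
      intro x
      have h2 : q (Quot.mk r (σ (Quot.mk r x))) = q (Quot.mk r x) := by rw [hσ]
      exact h2.symm
    intro x y
    induction x using Quot.ind with | _ x => ?_
    induction y using Quot.ind with | _ y => ?_
    rw [h1 x, h1 y]
    congr 1
    exact Quot.sound ⟨_, _, rfl, rfl⟩

theorem good_of_circ_zero {G : SimpleGraph V} (h : ∀ f, IsCirc G f → ∀ u v, f u v = 0) : Good G :=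
  ⟨Unit, inferInstance, fun _ _ => (), fun _ _ _ => rfl, fun p v => by simp,
    fun f hf => ⟨fun _ => 0, fun u v => by simp [h f hf u v]⟩⟩

/-- direct sums -/
theorem good_sum {G H K : SimpleGraph V} (hH : Good H) (hK : Good K)
    (hG : ∀ u v, G.Adj u v → H.Adj u v ∨ K.Adj u v) (hdis : ∀ u v, H.Adj u v → ¬ K.Adj u v)
    (hHG : H ≤ G) (hKG : K ≤ G)
    (hspl : ∀ f, IsCirc G f → IsCirc H (fun u v => if H.Adj u v then f u v else 0)) : Good G := by
  obtain ⟨X, hX, L, hL⟩ := hH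
  obtain ⟨Y, hY, M, hM⟩ := hK
  refine ⟨X ⊕ Y, inferInstance,
    fun u v => if H.Adj u v then Sum.inl (L u v) else Sum.inr (M u v), ?_, ?_, ?_⟩
  · intro u v huv
    have h1 : ¬ H.Adj u v := fun h => huv (hHG h)
    have h2 : ¬ K.Adj u v := fun h => huv (hKG h)
    simp [h1, mt Adj.symm h1, hM.na u v h2]
  · intro p v
    have e1 := hL.bal (fun x => p (Sum.inl x)) v
    have e2 := hM.bal (fun x => p (Sum.inr x)) v
    have e3 := congrArg₂ (· + ·) e1 e2
    simp only [← Finset.sum_add_distrib] at e3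
    rw [add_zero] at e3
    rw [← e3]
    refine Finset.sum_congr rfl fun u _ => ?_
    by_cases h : H.Adj v u
    · simp [h, h.symm, hM.na v u (hdis _ _ h)]
    · simp [h, mt Adj.symm h, hL.na v u h]
  · intro f hf
    have h1 := hspl f hf
    have h2 : IsCirc K (fun u v => if H.Adj u v then 0 else f u v) := by
      refine ⟨fun u v => ?_, fun u v huv => ?_, fun v => ?_⟩
      · by_cases h : H.Adj u v
        · simp [h, h.symm]
        · simp [h, mt Adj.symm h, hf.anti u v]
      · by_cases h : H.Adj u v
        · simp [h] at huv
        · simp only [h, if_false] at huv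
          exact (hG u v (hf.supp u v huv)).resolve_left h
      · have := hf.bal v
        have h3 := h1.bal v
        have h4 : ∑ u, (if H.Adj v u then 0 else f v u)
            = ∑ u, f v u - ∑ u, (if H.Adj v u then f v u else 0) := by
          rw [← Finset.sum_sub_distrib]
          refine Finset.sum_congr rfl fun u _ => ?_
          by_cases h : H.Adj v u <;> simp [h]
        rw [h4, this, h3, sub_zero]
    obtain ⟨p, hp⟩ := hL.rep _ h1
    obtain ⟨q, hq⟩ := hM.rep _ h2
    refine ⟨Sum.elim p q, fun u v => ?_⟩
    have hp := hp u v
    have hq := hq u v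
    by_cases h : H.Adj u v
    · simpa [h, h.symm] using hp
    · simpa [h, mt Adj.symm h] using hq

/-- existence of a unit flow from `u` to `v` inside the relation `E` -/
def Link (E : V → V → Prop) (u v : V) : Prop :=
  ∃ h : V → V → ℤ, (∀ a b, h a b = - h b a) ∧ (∀ a b, h a b ≠ 0 → E a b) ∧
    ∀ w, ∑ x, h w x = (if w = u then 1 else 0) - (if w = v then 1 else 0)

theorem Link.refl (E : V → V → Prop) (u : V) : Link E u u :=
  ⟨fun _ _ => 0, by simp, by simp, by simp⟩

theorem Link.mono {E F : V → V → Prop} (h : ∀ a b, E a b → F a b) {u v : V} (hl : Link E u v) :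
    Link F u v := by
  obtain ⟨f, h1, h2, h3⟩ := hl
  exact ⟨f, h1, fun a b hab => h a b (h2 a b hab), h3⟩

theorem Link.symm {E : V → V → Prop} {u v : V} (hl : Link E u v) : Link E v u := by
  obtain ⟨f, h1, h2, h3⟩ := hl
  refine ⟨fun a b => - f a b, fun a b => by show -f a b = -(-f b a); rw [h1 a b], fun a b hab => h2 a b (by simpa using hab),
    fun w => ?_⟩
  rw [Finset.sum_neg_distrib, h3]; ring

theorem Link.trans {E : V → V → Prop} {u v w : V} (h : Link E u v) (h' : Link E v w) :
    Link E u w := by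
  obtain ⟨f, h1, h2, h3⟩ := h
  obtain ⟨g, g1, g2, g3⟩ := h'
  refine ⟨fun a b => f a b + g a b, fun a b => by show f a b + g a b = _; rw [h1 a b, g1 a b]; ring, fun a b hab => ?_,
    fun x => ?_⟩
  · by_cases hf : f a b = 0
    · exact g2 a b (by intro hg; exact hab (by simp [hf, hg]))
    · exact h2 a b hf
  · rw [Finset.sum_add_distrib, h3, g3]; ring

/-- unit flow on a single dart -/
noncomputable def sgl (u v : V) : V → V → ℤ := fun a b =>
  (if a = u ∧ b = v then 1 else 0) - (if a = v ∧ b = u then 1 else 0)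

theorem sgl_anti (u v a b : V) : sgl u v a b = - sgl u v b a := by
  simp only [sgl, and_comm]; ring

theorem sgl_div (u v w : V) :
    ∑ x, sgl u v w x = (if w = u then 1 else 0) - (if w = v then 1 else 0) := by
  simp only [sgl, Finset.sum_sub_distrib]
  congr 1
  · by_cases h : w = u <;> simp [h]
  · by_cases h : w = v <;> simp [h]

theorem sgl_ne {u v a b : V} (h : sgl u v a b ≠ 0) : (a = u ∧ b = v) ∨ (a = v ∧ b = u) := by
  by_contra hn
  push Not at hn
  apply h
  have h1 : ¬ (a = u ∧ b = v) := fun h' => hn.1 h'.1 h'.2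
  have h2 : ¬ (a = v ∧ b = u) := fun h' => hn.2 h'.1 h'.2
  simp [sgl, h1, h2]

theorem Link.edge {E : V → V → Prop} {u v : V} (h : E u v) (h' : E v u) : Link E u v :=
  ⟨sgl u v, sgl_anti u v, fun a b hab => by
    rcases sgl_ne hab with ⟨rfl, rfl⟩ | ⟨rfl, rfl⟩ <;> assumption, sgl_div u v⟩

theorem Link.of_rtg {E : V → V → Prop} (hs : ∀ a b, E a b → E b a) {u v : V}
    (h : Relation.ReflTransGen E u v) : Link E u v := by
  induction h with
  | refl => exact Link.refl _ _
  | tail _ h ih => exact ih.trans (Link.edge h (hs _ _ h))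

theorem sum_anti_eq_zero {f : V → V → ℤ} (h : ∀ a b, f a b = - f b a) :
    ∑ a, ∑ b, f a b = 0 := by
  have h1 : ∑ a, ∑ b, f a b = ∑ a, ∑ b, - f a b := by
    rw [Finset.sum_comm]
    refine Finset.sum_congr rfl fun a _ => Finset.sum_congr rfl fun b _ => h _ _
  simp only [Finset.sum_neg_distrib] at h1
  linarith

/-- every demand with total zero on a linked set is the divergence of a flow -/
theorem exists_flow {E : V → V → Prop} {S : Set V} (hS : ∀ s ∈ S, ∀ t ∈ S, Link E s t)
    (d : V → ℤ) (hd : ∀ v, d v ≠ 0 → v ∈ S) (h0 : ∑ v, d v = 0) :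
    ∃ h : V → V → ℤ, (∀ a b, h a b = - h b a) ∧ (∀ a b, h a b ≠ 0 → E a b) ∧
      ∀ w, ∑ x, h w x = d w := by
  by_cases hne : ∃ s, s ∈ S
  swap
  · refine ⟨fun _ _ => 0, by simp, by simp, fun w => ?_⟩
    by_contra hw
    exact hne ⟨w, hd w (by intro h; exact hw (by simp [h]))⟩
  obtain ⟨s, hs⟩ := hne
  have hfl : ∀ v, ∃ h : V → V → ℤ, (∀ a b, h a b = - h b a) ∧ (∀ a b, h a b ≠ 0 → E a b) ∧
    (v ∈ S → ∀ w, ∑ x, h w x = (if w = v then 1 else 0) - (if w = s then 1 else 0)) := by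
    intro v
    by_cases hv : v ∈ S
    · obtain ⟨h, h1, h2, h3⟩ := hS v hv s hs
      exact ⟨h, h1, h2, fun _ => h3⟩
    · exact ⟨fun _ _ => 0, by simp, by simp, fun h => absurd h hv⟩
  choose h h1 h2 h3 using hfl
  refine ⟨fun a b => ∑ v, d v * h v a b, fun a b => ?_, fun a b hab => ?_, fun w => ?_⟩
  · rw [← Finset.sum_neg_distrib]
    refine Finset.sum_congr rfl fun v _ => ?_
    rw [h1 v a b]; ring
  · obtain ⟨v, -, hv⟩ := Finset.exists_ne_zero_of_sum_ne_zero hab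
    exact h2 v a b (right_ne_zero_of_mul hv)
  · rw [Finset.sum_comm]
    have : ∀ v, ∑ x, d v * h v w x = d v * ((if w = v then 1 else 0) - (if w = s then 1 else 0)) := by
      intro v
      by_cases hv : v ∈ S
      · rw [← Finset.mul_sum, h3 v hv w]
      · have : d v = 0 := by by_contra h'; exact hv (hd v h')
        simp [this]
    simp only [this, mul_sub, Finset.sum_sub_distrib]
    by_cases hw : w = s
    · simp [hw, h0]
    · simp [hw]

noncomputable def ind {X : Type} (U : Set X) (x : X) : ℤ := if x ∈ U then 1 else 0

/-- Basic lemma: edges joining a linked set `S` to one component of the complement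
lie on the same side of `U`. -/
theorem side_eq {G : SimpleGraph V} {X : Type} {L : V → V → X} (hE : Emb G L) (U : Set X)
    (S : Set V) (hj : ∀ u v, u ∉ S → (L u v ∈ U ↔ L v u ∈ U))
    (hS : ∀ s ∈ S, ∀ t ∈ S, Link (fun a b => G.Adj a b ∧ a ∈ S ∧ b ∈ S) s t)
    {s w w' t : V} (hs : s ∈ S) (ht : t ∈ S) (hw : w ∉ S) (hw' : w' ∉ S) (hsw : G.Adj s w)
    (htw : G.Adj t w') (hl : Link (fun a b => G.Adj a b ∧ a ∉ S ∧ b ∉ S) w w') :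
    L s w ∈ U ↔ L t w' ∈ U := by
  obtain ⟨h, h1, h2, h3⟩ := hS t ht s hs
  obtain ⟨k, k1, k2, k3⟩ := hl
  let g : V → V → ℤ := fun a b => sgl s w a b + k a b + sgl w' t a b + h a b
  have hg : IsCirc G g := by
    refine ⟨fun a b => ?_, fun a b hab => ?_, fun v => ?_⟩
    · simp only [g]; rw [sgl_anti s w a b, sgl_anti w' t a b, h1 a b, k1 a b]; ring
    · by_contra hn
      apply hab
      have e1 : sgl s w a b = 0 := by
        by_contra hc
        rcases sgl_ne hc with ⟨rfl, rfl⟩ | ⟨rfl, rfl⟩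
        · exact hn hsw
        · exact hn hsw.symm
      have e2 : sgl w' t a b = 0 := by
        by_contra hc
        rcases sgl_ne hc with ⟨rfl, rfl⟩ | ⟨rfl, rfl⟩
        · exact hn htw.symm
        · exact hn htw
      have e3 : h a b = 0 := by by_contra hc; exact hn (h2 a b hc).1
      have e4 : k a b = 0 := by by_contra hc; exact hn (k2 a b hc).1
      simp [g, e1, e2, e3, e4]
    · simp only [g, Finset.sum_add_distrib, sgl_div, h3, k3]; ring
  obtain ⟨q, hq⟩ := hE.rep g hg
  have hb := fun v => hE.bal (fun x => q x * ind U x) v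
  -- total flow out of `S`
  let r : V → V → ℤ := fun a b => q (L a b) * ind U (L a b) - q (L b a) * ind U (L b a)
  have hr : ∀ a b, b ∉ S → r a b = g a b * ind U (L a b) := by
    intro a b hb
    have : ind U (L b a) = ind U (L a b) := by simp only [ind, hj b a hb]
    simp only [r, hq a b, this]; ring
  have hz : ∑ a, ∑ b, (if a ∈ S ∧ b ∈ S then r a b else 0) = 0 := by
    refine sum_anti_eq_zero fun a b => ?_
    simp only [and_comm (a := b ∈ S), r]
    split_ifs <;> ring
  have hz2 : ∑ a, ∑ b, (if a ∈ S then r a b else 0) = 0 := by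
    refine Finset.sum_eq_zero fun a _ => ?_
    by_cases ha : a ∈ S
    · simp only [ha, if_true]; exact hb a
    · simp [ha]
  have hz3 : ∑ a, ∑ b, (if a ∈ S ∧ b ∉ S then g a b * ind U (L a b) else 0) = 0 := by
    have h4 : ∑ a, ∑ b, (if a ∈ S ∧ b ∉ S then g a b * ind U (L a b) else 0) =
        ∑ a, ∑ b, (if a ∈ S then r a b else 0) - ∑ a, ∑ b, (if a ∈ S ∧ b ∈ S then r a b else 0) := by
      rw [← Finset.sum_sub_distrib]
      refine Finset.sum_congr rfl fun a _ => ?_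
      rw [← Finset.sum_sub_distrib]
      refine Finset.sum_congr rfl fun b _ => ?_
      by_cases ha : a ∈ S <;> by_cases hb : b ∈ S <;> simp [ha, hb, hr]
    rw [h4, hz2, hz, sub_zero]
  have hval : ∀ a b, (if a ∈ S ∧ b ∉ S then g a b * ind U (L a b) else 0) =
      (if a = s ∧ b = w then ind U (L s w) else 0) - (if a = t ∧ b = w' then ind U (L t w') else 0) := by
    intro a b
    by_cases hab : a ∈ S ∧ b ∉ S
    · have e3 : h a b = 0 := by by_contra hc; exact hab.2 (h2 a b hc).2.2
      have e4 : k a b = 0 := by by_contra hc; exact (k2 a b hc).2.1 hab.1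
      have n1 : ¬ (a = w ∧ b = s) := fun h => hw (h.1 ▸ hab.1)
      have n2 : ¬ (a = w' ∧ b = t) := fun h => hw' (h.1 ▸ hab.1)
      simp only [hab, g, e3, e4, sgl, n1, n2]
      simp only [not_false_eq_true, and_self, if_true, if_false]
      by_cases c1 : a = s ∧ b = w <;> by_cases c2 : a = t ∧ b = w'
      · obtain ⟨rfl, rfl⟩ := c1
        obtain ⟨rfl, rfl⟩ := c2
        simp
      · obtain ⟨rfl, rfl⟩ := c1
        simp [c2]
      · obtain ⟨rfl, rfl⟩ := c2
        simp [c1]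
      · simp [c1, c2]
    · have n1 : ¬ (a = s ∧ b = w) := by rintro ⟨rfl, rfl⟩; exact hab ⟨hs, hw⟩
      have n2 : ¬ (a = t ∧ b = w') := by rintro ⟨rfl, rfl⟩; exact hab ⟨ht, hw'⟩
      simp [hab, n1, n2]
  simp only [hval, Finset.sum_sub_distrib, ite_and, Finset.sum_ite_eq', Finset.mem_univ, if_true] at hz3
  have hs1 : ∀ (x y : V) (c : ℤ), ∑ a : V, ∑ b : V, (if a = x then if b = y then c else 0 else 0) = c := by
    intro x y c
    rw [Finset.sum_eq_single x]
    · simp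
    · intro b _ hb; simp [hb]
    · simp
  rw [hs1, hs1] at hz3
  simp only [ind] at hz3
  by_cases c1 : L s w ∈ U <;> by_cases c2 : L t w' ∈ U <;> simp [c1, c2] at hz3 ⊢

end algebra
end FN


namespace FN
open Classical
set_option linter.unusedSectionVars false
set_option linter.unusedSimpArgs false
set_option linter.unusedVariables false

universe u
section cyc
variable {V : Type u} [Fintype V]

def Sv (f : V → V → ℤ) : Set V := {v | ∃ u, f v u ≠ 0}

/-- elementary cycle flows -/
structure CycF (f : V → V → ℤ) : Prop where
  anti : ∀ u v, f u v = - f v u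
  val : ∀ u v, f u v = 0 ∨ f u v = 1 ∨ f u v = -1
  bal : ∀ v, ∑ u, f v u = 0
  ne : ∃ u v, f u v = 1
  elem : ∀ g : V → V → ℤ, (∀ u v, g u v = - g v u) → (∀ v, ∑ u, g v u = 0) →
    (∀ u v, g u v ≠ 0 → f u v ≠ 0) → ∃ k, ∀ u v, g u v = k * f u v
  link : ∀ u v, u ∈ Sv f → v ∈ Sv f → Link (fun a b => f a b ≠ 0) u v

theorem Sv_neg (f : V → V → ℤ) : Sv (fun a b => - f a b) = Sv f := by
  ext v; simp [Sv]

theorem CycF.neg {f : V → V → ℤ} (h : CycF f) : CycF (fun a b => - f a b) := by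
  refine ⟨fun u v => ?_, fun u v => ?_, fun v => ?_, ?_, fun g g1 g2 g3 => ?_, fun u v hu hv => ?_⟩
  · show - f u v = -(-f v u)
    rw [h.anti u v]
  · rcases h.val u v with h | h | h <;> simp [h]
  · show ∑ u, - f v u = 0
    rw [Finset.sum_neg_distrib, h.bal]; rfl
  · obtain ⟨u, v, h1⟩ := h.ne
    exact ⟨v, u, by show - f v u = 1; rw [← h.anti u v, h1]⟩
  · obtain ⟨k, hk⟩ := h.elem g g1 g2 (fun u v huv => by simpa using g3 u v huv)
    exact ⟨-k, fun u v => by show g u v = -k * -f u v; rw [hk u v]; ring⟩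
  · rw [Sv_neg] at hu hv
    refine (h.link u v hu hv).mono fun a b hab => by simpa using hab

theorem CycF.symm_mem {f : V → V → ℤ} (h : CycF f) {u v : V} (huv : f u v ≠ 0) : v ∈ Sv f :=
  ⟨u, by rw [h.anti]; simpa using huv⟩

theorem CycF.ne_comm {f : V → V → ℤ} (h : CycF f) {u v : V} : f u v ≠ 0 ↔ f v u ≠ 0 := by
  rw [h.anti u v]; simp

theorem CycF.circ {f : V → V → ℤ} (h : CycF f) {G : SimpleGraph V}
    (hs : ∀ u v, f u v ≠ 0 → G.Adj u v) : IsCirc G f := ⟨h.anti, hs, h.bal⟩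

theorem Emb.flip {G : SimpleGraph V} {X : Type} {L : V → V → X} (h : Emb G L) :
    Emb G (fun u v => L v u) := by
  refine ⟨fun u v huv => (h.na u v huv).symm, fun p v => ?_, fun f hf => ?_⟩
  · have := h.bal (fun x => - p x) v
    rw [← this]
    refine Finset.sum_congr rfl fun u _ => ?_
    ring
  · obtain ⟨p, hp⟩ := h.rep f hf
    exact ⟨fun x => - p x, fun u v => by rw [hp u v]; ring⟩

theorem ind_sub_eq_one {X : Type} {U : Set X} {x y : X} : ind U x - ind U y = 1 ↔ x ∈ U ∧ y ∉ U := by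
  unfold ind; by_cases h1 : x ∈ U <;> by_cases h2 : y ∈ U <;> simp [h1, h2]

theorem ind_sub_eq_zero {X : Type} {U : Set X} {x y : X} : ind U x - ind U y = 0 ↔ (x ∈ U ↔ y ∈ U) := by
  unfold ind; by_cases h1 : x ∈ U <;> by_cases h2 : y ∈ U <;> simp [h1, h2]

theorem cyc_rep {G : SimpleGraph V} {X : Type} {L : V → V → X} (hL : Emb G L) {f : V → V → ℤ}
    (hf : CycF f) (hs : ∀ u v, f u v ≠ 0 → G.Adj u v) :
    ∃ U : Set X, ∀ u v, f u v = ind U (L u v) - ind U (L v u) := by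
  obtain ⟨p, hp⟩ := hL.rep f (hf.circ hs)
  obtain ⟨a, b, hab⟩ := hf.ne
  let U : Set X := {x | p (L a b) ≤ p x}
  obtain ⟨k, hk⟩ := hf.elem (fun u v => ind U (L u v) - ind U (L v u)) (fun u v => by ring)
    (hL.bal (ind U)) (by
      intro u v huv h0
      have := hp u v
      rw [h0] at this
      apply huv
      have e : p (L u v) = p (L v u) := by linarith
      exact ind_sub_eq_zero.2 (by show p (L a b) ≤ p (L u v) ↔ p (L a b) ≤ p (L v u); rw [e]))
  have hk1 := hk a b
  have hp1 := hp a b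
  rw [hab] at hk1 hp1
  have h1 : L a b ∈ U := by show p (L a b) ≤ p (L a b); exact le_refl _
  have h2 : L b a ∉ U := by simp only [U, Set.mem_ofPred_eq]; omega
  simp only [ind, h1, h2, if_true, if_false] at hk1
  refine ⟨U, fun u v => ?_⟩
  have hk2 : ind U (L u v) - ind U (L v u) = k * f u v := hk u v
  rw [hk2]
  have : k = 1 := by omega
  rw [this, one_mul]

theorem ind_compl {X : Type} (U : Set X) (x : X) : ind Uᶜ x = 1 - ind U x := by
  unfold ind; by_cases h1 : x ∈ U <;> simp [h1]

/-- Make the side `U` of the cycle a face, if nothing is attached on that side. -/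
theorem facial {H : SimpleGraph V} {X : Type} [Finite X] {L : V → V → X} (hL : Emb H L)
    {f : V → V → ℤ} (hf : CycF f) (U : Set X)
    (hU : ∀ u v, f u v = ind U (L u v) - ind U (L v u))
    (hs : ∀ s v, s ∈ Sv f → H.Adj s v → f s v = 0 → L s v ∉ U) :
    ∃ (X' : Type) (_ : Finite X') (L' : V → V → X') (x0 : X'), Emb H L' ∧
      ∀ u v, f u v = 1 → L' u v = x0 := by
  have hz : ∀ u v, f u v = 0 → (L u v ∈ U ↔ L v u ∈ U) := fun u v h => by
    rw [hU] at h; exact ind_sub_eq_zero.1 h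
  have hone : ∀ u v, f u v = 1 → (L u v ∈ U ∧ L v u ∉ U) := fun u v h => by
    rw [hU] at h; exact ind_sub_eq_one.1 h
  have hmone : ∀ u v, f u v = -1 → (L u v ∉ U ∧ L v u ∈ U) := fun u v h => by
    have := hone v u (by rw [hf.anti, h]; rfl)
    exact this.symm
  let L' : V → V → Option (X ⊕ X) := fun u v =>
    if L u v ∉ U then some (Sum.inl (L u v)) else if L v u ∈ U then some (Sum.inr (L u v)) else none
  refine ⟨Option (X ⊕ X), inferInstance, L', none, ⟨?_, ?_, ?_⟩, ?_⟩
  · intro u v huv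
    simp only [L', hL.na u v huv]
  · intro p v
    by_cases hv : v ∈ Sv f
    · let p1 : X → ℤ := fun x => if x ∈ U then p none else p (some (Sum.inl x))
      rw [← hL.bal p1 v]
      refine Finset.sum_congr rfl fun u _ => ?_
      rcases hf.val v u with h | h | h
      · by_cases hvu : H.Adj v u
        · have h1 := hs v u hv hvu h
          have h2 := (hz v u h).not.1 h1
          simp [L', p1, h1, h2]
        · simp [L', p1, hL.na v u hvu]
      · obtain ⟨h1, h2⟩ := hone v u h
        simp [L', p1, h1, h2]
      · obtain ⟨h1, h2⟩ := hmone v u h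
        simp [L', p1, h1, h2]
    · let p1 : X → ℤ := fun x => if x ∈ U then p (some (Sum.inr x)) else p (some (Sum.inl x))
      rw [← hL.bal p1 v]
      refine Finset.sum_congr rfl fun u _ => ?_
      have h : f v u = 0 := by by_contra h; exact hv ⟨u, h⟩
      have h1 := hz v u h
      by_cases h2 : L u v ∈ U
      · simp [L', p1, h2, h1.2 h2]
      · simp [L', p1, h2, h1.not.2 h2]
  · intro g hg
    obtain ⟨q, hq⟩ := hL.rep g hg
    let h : V → V → ℤ := fun u v => q (L u v) * ind U (L u v) - q (L v u) * ind U (L v u)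
    have hb : ∀ v, ∑ u, h v u = 0 := fun v => hL.bal (fun x => q x * ind U x) v
    obtain ⟨k, hk⟩ := hf.elem (fun u v => if f u v ≠ 0 then h u v else 0) (fun u v => by
        by_cases hh : f u v ≠ 0
        · have := hf.ne_comm.1 hh
          simp only [hh, this, if_true, ne_eq, not_false_eq_true]; simp only [h]; ring
        · have := hf.ne_comm.not.1 hh
          simp only [hh, this, if_false]; rfl) (fun v => by
        by_cases hv : v ∈ Sv f
        · refine Eq.trans ?_ (hb v)
          refine Finset.sum_congr rfl fun u _ => ?_
          by_cases hh : f v u ≠ 0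
          · simp [hh]
          · rw [if_neg hh]
            rw [not_not] at hh
            by_cases hvu : H.Adj v u
            · have h1 := hs v u hv hvu hh
              have h2 := (hz v u hh).not.1 h1
              simp [h, ind, h1, h2]
            · simp [h, hL.na v u hvu]
        · refine Finset.sum_eq_zero fun u _ => ?_
          have h : f v u = 0 := by by_contra h; exact hv ⟨u, h⟩
          simp [h]) (fun u v huv hh => huv (by simp [hh]))
    have hqk : ∀ u v, f u v = 1 → q (L u v) = k := by
      intro u v huv
      have := hk u v
      obtain ⟨h1, h2⟩ := hone u v huv
      simpa [huv, h, ind, h1, h2] using this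
    refine ⟨fun x => x.elim k (Sum.elim q q), fun u v => ?_⟩
    rw [hq u v]
    rcases hf.val u v with h | h | h
    · have h1 := hz u v h
      by_cases h2 : L v u ∈ U
      · simp [L', h2, h1.2 h2]
      · simp [L', h2, h1.not.2 h2]
    · obtain ⟨h1, h2⟩ := hone u v h
      simp [L', h1, h2, hqk u v h]
    · obtain ⟨h1, h2⟩ := hmone u v h
      have := hqk v u (by rw [hf.anti, h]; rfl)
      simp [L', h1, h2, this]
  · intro u v huv
    obtain ⟨h1, h2⟩ := hone u v huv
    simp [L', h1, h2]

theorem glue {H H1 H2 : SimpleGraph V} {f : V → V → ℤ} (hf : CycF f)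
    (hH : ∀ u v, H.Adj u v ↔ H1.Adj u v ∨ H2.Adj u v)
    (hs1 : ∀ u v, f u v ≠ 0 → H1.Adj u v) (hs2 : ∀ u v, f u v ≠ 0 → H2.Adj u v)
    (hcom : ∀ u v, H1.Adj u v → H2.Adj u v → f u v ≠ 0)
    (hsep : ∀ v a b, v ∉ Sv f → H1.Adj v a → ¬ H2.Adj v b)
    {X1 X2 : Type} [Finite X1] [Finite X2] {L1 : V → V → X1} {L2 : V → V → X2}
    (hL1 : Emb H1 L1) (hL2 : Emb H2 L2) (x1 : X1) (x2 : X2)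
    (hx1 : ∀ u v, f u v = 1 → L1 u v = x1) (hx2 : ∀ u v, f u v = -1 → L2 u v = x2) : Good H := by
  let L : V → V → X1 ⊕ X2 := fun u v => if f u v = 1 then Sum.inr (L2 u v) else
    if f u v = -1 then Sum.inl (L1 u v) else if H1.Adj u v then Sum.inl (L1 u v) else Sum.inr (L2 u v)
  have key : ∀ (p : X1 ⊕ X2 → ℤ) u v, p (L u v) - p (L v u) =
      (p (Sum.inl (L1 u v)) - p (Sum.inl (L1 v u))) + (p (Sum.inr (L2 u v)) - p (Sum.inr (L2 v u)))
      - (p (Sum.inl x1) - p (Sum.inr x2)) * f u v := by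
    intro p u v
    have hvu : f v u = - f u v := hf.anti v u
    rcases hf.val u v with h | h | h
    · by_cases h1 : H1.Adj u v
      · have h2 : ¬ H2.Adj u v := fun h2 => hcom u v h1 h2 h
        simp [L, hvu, h, h1, h1.symm, hL2.na u v h2]
      · simp [L, hvu, h, h1, mt Adj.symm h1, hL1.na u v h1]
    · have e1 := hx1 u v h
      have e2 := hx2 v u (by rw [hvu, h])
      simp [L, hvu, h, e1, e2]; ring
    · have e1 := hx1 v u (by rw [hvu, h]; rfl)
      have e2 := hx2 u v h
      simp [L, hvu, h, e1, e2]; ring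
  refine ⟨X1 ⊕ X2, inferInstance, L, ?_, ?_, ?_⟩
  · intro u v huv
    rw [hH, not_or] at huv
    have h0 : f u v = 0 := by by_contra h; exact huv.1 (hs1 u v h)
    have h0' : f v u = 0 := by rw [hf.anti, h0]; rfl
    simp [L, h0, h0', huv.1, mt Adj.symm huv.1, hL2.na u v huv.2]
  · intro p v
    simp only [key, Finset.sum_sub_distrib, Finset.sum_add_distrib, ← Finset.mul_sum, hf.bal]
    have e1 := hL1.bal (fun x => p (Sum.inl x)) v
    have e2 := hL2.bal (fun x => p (Sum.inr x)) v
    simp only [Finset.sum_sub_distrib] at e1 e2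
    linarith
  · intro g hg
    let g1 : V → V → ℤ := fun u v => if H1.Adj u v ∧ f u v = 0 then g u v else 0
    have hf0 : ∀ u v, f u v = 0 ↔ f v u = 0 := fun u v => by rw [hf.anti u v]; simp
    have g1a : ∀ u v, g1 u v = - g1 v u := by
      intro u v
      simp only [g1, H1.adj_comm u v, hf0 u v, hg.anti u v]
      split_ifs <;> simp
    obtain ⟨h, h1, h2, h3⟩ := exists_flow (E := fun a b => f a b ≠ 0) (S := Sv f)
      (fun s hs t ht => hf.link s t hs ht) (fun v => ∑ u, g1 v u) (fun v hv => by
        by_contra hvS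
        apply hv
        have hfv : ∀ u, f v u = 0 := fun u => by by_contra h; exact hvS ⟨u, h⟩
        by_cases hex : ∃ a, H1.Adj v a
        · obtain ⟨a, ha⟩ := hex
          show ∑ u, g1 v u = 0
          rw [← hg.bal v]
          refine Finset.sum_congr rfl fun u _ => ?_
          by_cases hvu : H1.Adj v u
          · simp [g1, hvu, hfv]
          · have : ¬ H.Adj v u := by
              rw [hH]; exact fun h => h.elim hvu (hsep v a u hvS ha)
            simp [g1, hvu, hg.zero_of_not_adj this]
        · push Not at hex
          exact Finset.sum_eq_zero fun u _ => by simp [g1, hex u]) (sum_anti_eq_zero g1a)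
    have c1 : IsCirc H1 (fun u v => g1 u v - h u v) := by
      refine ⟨fun u v => ?_, fun u v huv => ?_, fun v => ?_⟩
      · show g1 u v - h u v = -(g1 v u - h v u)
        rw [g1a u v, h1 u v]; ring
      · by_contra hn
        apply huv
        have e1 : g1 u v = 0 := by simp [g1, hn]
        have e2 : h u v = 0 := by by_contra hc; exact hn (hs1 u v (h2 u v hc))
        simp [e1, e2]
      · simp only [Finset.sum_sub_distrib]
        rw [h3 v, sub_self]
    have c2 : IsCirc H2 (fun u v => g u v - (g1 u v - h u v)) := by
      refine ⟨fun u v => ?_, fun u v huv => ?_, fun v => ?_⟩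
      · show g u v - (g1 u v - h u v) = -(g v u - (g1 v u - h v u))
        rw [g1a u v, h1 u v, hg.anti u v]; ring
      · by_contra hn
        apply huv
        have e0 : f u v = 0 := by by_contra hc; exact hn (hs2 u v hc)
        have e2 : h u v = 0 := by by_contra hc; exact hn (hs2 u v (h2 u v hc))
        by_cases hh : H1.Adj u v
        · simp [g1, hh, e0, e2]
        · have : ¬ H.Adj u v := by rw [hH]; exact fun h => h.elim hh hn
          simp [g1, hh, e2, hg.zero_of_not_adj this]
      · have := c1.bal v
        rw [Finset.sum_sub_distrib, this, hg.bal v, sub_zero]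
    obtain ⟨p1, hp1⟩ := hL1.rep _ c1
    obtain ⟨p2, hp2⟩ := hL2.rep _ c2
    refine ⟨Sum.elim p1 (fun x => p2 x + (p1 x1 - p2 x2)), fun u v => ?_⟩
    rw [key]
    have e1 := hp1 u v
    have e2 := hp2 u v
    simp only [Sum.elim_inl, Sum.elim_inr] at *
    rw [← e1]
    linarith

/-- one bridge -/
def OneBr (H : SimpleGraph V) (f : V → V → ℤ) : Prop :=
  ∀ s v s' v', s ∈ Sv f → s' ∈ Sv f → H.Adj s v → H.Adj s' v' → f s v = 0 → f s' v' = 0 →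
    (s' = s ∧ v' = v) ∨ (s' = v ∧ v' = s) ∨
    (v ∉ Sv f ∧ v' ∉ Sv f ∧ Link (fun a b => H.Adj a b ∧ a ∉ Sv f ∧ b ∉ Sv f) v v')

theorem CycF.linkS {f : V → V → ℤ} (hf : CycF f) {H : SimpleGraph V}
    (hs : ∀ u v, f u v ≠ 0 → H.Adj u v) : ∀ s ∈ Sv f, ∀ t ∈ Sv f,
    Link (fun a b => H.Adj a b ∧ a ∈ Sv f ∧ b ∈ Sv f) s t := fun s hs' t ht =>
  (hf.link s t hs' ht).mono fun a b hab => ⟨hs a b hab, ⟨b, hab⟩, hf.symm_mem hab⟩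

theorem OneBr.facial {H : SimpleGraph V} (hG : Good H) {f : V → V → ℤ} (hf : CycF f)
    (hs : ∀ u v, f u v ≠ 0 → H.Adj u v) (hb : OneBr H f) :
    ∃ (X' : Type) (_ : Finite X') (L' : V → V → X') (x0 : X'), Emb H L' ∧
      ∀ u v, f u v = 1 → L' u v = x0 := by
  obtain ⟨X, hX, L, hL⟩ := hG
  obtain ⟨U, hU⟩ := cyc_rep hL hf hs
  have hz : ∀ u v, f u v = 0 → (L u v ∈ U ↔ L v u ∈ U) := fun u v h => by
    rw [hU] at h; exact ind_sub_eq_zero.1 h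
  have hj : ∀ u v, u ∉ Sv f → (L u v ∈ U ↔ L v u ∈ U) := fun u v h =>
    hz u v (by by_contra hc; exact h ⟨v, hc⟩)
  by_cases hall : ∀ s v, s ∈ Sv f → H.Adj s v → f s v = 0 → L s v ∉ U
  · exact FN.facial hL hf U hU hall
  · push Not at hall
    obtain ⟨s, v, hsS, hsv, hf0, hin⟩ := hall
    have hall' : ∀ s v, s ∈ Sv (fun a b => - f a b) → H.Adj s v → - f s v = 0 → L s v ∉ Uᶜ := by
      intro s' v' hs' hsv' hf0'
      rw [Sv_neg] at hs'
      rw [neg_eq_zero] at hf0'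
      rw [Set.notMem_compl_iff]
      rcases hb s v s' v' hsS hs' hsv hsv' hf0 hf0' with ⟨rfl, rfl⟩ | ⟨rfl, rfl⟩ | ⟨h1, h2, h3⟩
      · exact hin
      · exact (hz _ _ hf0).1 hin
      · exact (side_eq hL U (Sv f) hj (hf.linkS hs) hsS hs' h1 h2 hsv hsv' h3).1 hin
    obtain ⟨X', hX', L', x0, hE, hx⟩ := FN.facial hL hf.neg Uᶜ (fun u v => by
      show - f u v = _
      rw [hU, ind_compl, ind_compl]; ring) hall'
    refine ⟨X', hX', fun u v => L' v u, x0, hE.flip, fun u v huv => ?_⟩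
    exact hx v u (by show - f v u = 1; rw [← hf.anti, huv])

theorem glueB {H H1 H2 : SimpleGraph V} {f : V → V → ℤ} (hf : CycF f)
    (hH : ∀ u v, H.Adj u v ↔ H1.Adj u v ∨ H2.Adj u v)
    (hs1 : ∀ u v, f u v ≠ 0 → H1.Adj u v) (hs2 : ∀ u v, f u v ≠ 0 → H2.Adj u v)
    (hcom : ∀ u v, H1.Adj u v → H2.Adj u v → f u v ≠ 0)
    (hsep : ∀ v a b, v ∉ Sv f → H1.Adj v a → ¬ H2.Adj v b)
    (g1 : Good H1) (g2 : Good H2) (b1 : OneBr H1 f) (b2 : OneBr H2 f) : Good H := by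
  obtain ⟨X1, hX1, L1, x1, hE1, hx1⟩ := b1.facial g1 hf hs1
  obtain ⟨X2, hX2, L2, x2, hE2, hx2⟩ := b2.facial g2 hf hs2
  refine glue hf hH hs1 hs2 hcom hsep hE1 hE2.flip x1 x2 hx1 (fun u v huv => ?_)
  exact hx2 v u (by rw [hf.anti, huv]; rfl)

theorem Emb.restrict {G H : SimpleGraph V} {X : Type} [Finite X] {L : V → V → X} (hL : Emb G L)
    (hle : H ≤ G) (U : Set X) (hU : ∀ u v, ¬ H.Adj u v → (L u v ∈ U ↔ L v u ∈ U)) :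
    ∃ (X' : Type) (_ : Finite X') (L' : V → V → X') (U' : Set X'), Emb H L' ∧
      ∀ u v, L' u v ∈ U' ↔ L u v ∈ U := by
  let r : X → X → Prop := fun x y => ∃ u v, ¬ H.Adj u v ∧ x = L u v ∧ y = L v u
  refine ⟨Quot r, inferInstance, fun u v => Quot.mk r (L u v),
    {y | Quot.lift (fun x => x ∈ U) (by
      rintro x y ⟨u, v, h, rfl, rfl⟩; exact propext (hU u v h)) y}, ⟨?_, ?_, ?_⟩, fun u v => Iff.rfl⟩
  · intro u v huv
    exact Quot.sound ⟨u, v, huv, rfl, rfl⟩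
  · intro p v
    exact hL.bal (fun x => p (Quot.mk r x)) v
  · intro f hf
    obtain ⟨p, hp⟩ := hL.rep f (hf.mono hle)
    refine ⟨Quot.lift p ?_, fun u v => hp u v⟩
    rintro x y ⟨u, v, huv, rfl, rfl⟩
    have := hp u v
    rw [hf.zero_of_not_adj huv] at this
    linarith

set_option maxHeartbeats 1000000 in
/-- adding a path of length two parallel to an edge -/
theorem good_par {G0 G : SimpleGraph V} (hG : Good G0) {a v b : V} (hab : G0.Adj a b)
    (hav : v ≠ a) (hbv : v ≠ b) (hv : ∀ u, ¬ G0.Adj v u)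
    (hle : ∀ u w, G.Adj u w → G0.Adj u w ∨ (u = a ∧ w = v) ∨ (u = v ∧ w = a) ∨ (u = b ∧ w = v) ∨
      (u = v ∧ w = b)) : Good G := by
  obtain ⟨X, hX, L, hL⟩ := hG
  have hne : a ≠ b := hab.ne
  let tri : V → V → ℤ := fun u w => sgl a v u w + sgl v b u w + sgl b a u w
  have tria : ∀ u w, tri u w = - tri w u := fun u w => by
    simp only [tri]; rw [sgl_anti a v u w, sgl_anti v b u w, sgl_anti b a u w]; ring
  have trib : ∀ u, ∑ w, tri u w = 0 := fun u => by
    simp only [tri, Finset.sum_add_distrib, sgl_div]; ring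
  let L' : V → V → Option X := fun u w =>
    if u = a ∧ w = v ∨ u = v ∧ w = b then some (L a b) else
    if u = v ∧ w = a ∨ u = b ∧ w = v ∨ u = a ∧ w = b then none else some (L u w)
  have key : ∀ (p : Option X → ℤ) u w, p (L' u w) - p (L' w u) =
      (p (some (L u w)) - p (some (L w u))) + (p (some (L a b)) - p none) * tri u w := by
    intro p u w
    have n1 : L a v = L v a := (hL.na v a (hv a)).symm
    have n2 : L b v = L v b := (hL.na v b (hv b)).symm
    have n3 := hav.symm
    have n4 := hbv.symm
    have n5 := hne.symm
    by_cases e1 : u = a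
    · subst e1
      by_cases e2 : w = v
      · subst e2; simp [L', tri, sgl, *]
      · by_cases e3 : w = b
        · subst e3; simp [L', tri, sgl, *]
        · simp [L', tri, sgl, *]
    · by_cases e4 : u = v
      · subst e4
        by_cases e2 : w = a
        · subst e2; simp [L', tri, sgl, *]
        · by_cases e3 : w = b
          · subst e3; simp [L', tri, sgl, *]
          · simp [L', tri, sgl, *]
      · by_cases e5 : u = b
        · subst e5
          by_cases e2 : w = a
          · subst e2; simp [L', tri, sgl, *]
          · by_cases e3 : w = v
            · subst e3; simp [L', tri, sgl, *]
            · simp [L', tri, sgl, *]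
        · simp [L', tri, sgl, *]
  let G1 : SimpleGraph V := G0 ⊔ SimpleGraph.edge a v ⊔ SimpleGraph.edge v b
  have hG1 : ∀ u w, G1.Adj u w ↔ G0.Adj u w ∨ (u = a ∧ w = v) ∨ (u = v ∧ w = a) ∨ (u = b ∧ w = v) ∨
      (u = v ∧ w = b) := by
    intro u w
    simp only [G1, sup_adj, edge_adj]
    constructor
    · rintro ((h | ⟨(h | h), -⟩) | ⟨(h | h), -⟩) <;> tauto
    · rintro (h | h | h | h | h)
      · tauto
      · have : u ≠ w := by rw [h.1, h.2]; exact hav.symm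
        tauto
      · have : u ≠ w := by rw [h.1, h.2]; exact hav
        tauto
      · have : u ≠ w := by rw [h.1, h.2]; exact hbv.symm
        tauto
      · have : u ≠ w := by rw [h.1, h.2]; exact hbv
        tauto
  refine Good.mono (G := G1) (fun u w h => (hG1 u w).2 (hle u w h)) ⟨Option X, inferInstance, L', ?_, ?_, ?_⟩
  · intro u w huw
    rw [hG1] at huw
    simp only [not_or] at huw
    obtain ⟨q0, q1, q2, q3, q4⟩ := huw
    have := hL.na u w q0
    have c1 : ¬ (u = a ∧ w = b) := by rintro ⟨rfl, rfl⟩; exact q0 hab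
    have c2 : ¬ (w = a ∧ u = b) := by rintro ⟨rfl, rfl⟩; exact q0 hab.symm
    simp only [L']
    rw [if_neg (fun h => h.elim q1 q4), if_neg (fun h => h.elim q2 fun h => h.elim q3 c1),
      if_neg (fun h => h.elim (fun h => q2 h.symm) (fun h => q3 h.symm)),
      if_neg (fun h => h.elim (fun h => q1 h.symm) fun h => h.elim (fun h => q4 h.symm) c2), this]
  · intro p u
    simp only [key, Finset.sum_add_distrib, ← Finset.mul_sum, trib]
    have e1 := hL.bal (fun x => p (some x)) u
    linarith
  · intro g hg
    have hgv : ∀ w, w ≠ a → w ≠ b → g v w = 0 := fun w h1 h2 => hg.zero_of_not_adj (by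
      rw [hG1]
      rintro (h | h | h | h | h)
      · exact hv w h
      · exact hav h.1
      · exact h1 h.2
      · exact hbv h.1
      · exact h2 h.2)
    have hgab : g v a + g v b = 0 := by
      rw [← hg.bal v, ← Finset.sum_pair hne]
      refine Finset.sum_subset (Finset.subset_univ _) fun w _ hw => ?_
      simp only [Finset.mem_insert, Finset.mem_singleton, not_or] at hw
      exact hgv w hw.1 hw.2
    obtain ⟨k, hk⟩ : ∃ k, k = g a v := ⟨_, rfl⟩
    have t1 : tri a v = 1 := by simp [tri, sgl, hav.symm, hbv, hne, hav]
    have t2 : tri v a = -1 := by rw [tria, t1]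
    have t3 : tri v b = 1 := by simp [tri, sgl, hav, hbv, hne.symm, hbv.symm]
    have t4 : tri b v = -1 := by rw [tria, t3]
    have hk1 : g v a = -k := by rw [hk]; exact hg.anti v a
    have hk2 : g v b = k := by omega
    have hk3 : g b v = -k := by rw [hg.anti, hk2]
    have cc : IsCirc G0 (fun u w => g u w - k * tri u w) := by
      refine ⟨fun u w => ?_, fun u w huw => ?_, fun u => ?_⟩
      · show g u w - k * tri u w = _
        rw [hg.anti u w, tria u w]; ring
      · by_contra hn
        apply huw
        have n3 := hav.symm
        have n4 := hbv.symm
        have n5 := hne.symm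
        by_cases h1 : G1.Adj u w
        · rw [hG1] at h1
          rcases h1 with h | h | h | h | h
          · exact absurd h hn
          · rw [h.1, h.2, t1, hk]; ring
          · rw [h.1, h.2, t2, hk1]; ring
          · rw [h.1, h.2, t4, hk3]; ring
          · rw [h.1, h.2, t3, hk2]; ring
        · have z1 := hg.zero_of_not_adj h1
          have z2 : tri u w = 0 := by
            by_contra hc
            apply h1
            rw [hG1]
            by_cases s1 : sgl a v u w = 0
            · by_cases s2 : sgl v b u w = 0
              · have s3 : sgl b a u w ≠ 0 := fun s3 => hc (by simp [tri, s1, s2, s3])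
                rcases sgl_ne s3 with ⟨rfl, rfl⟩ | ⟨rfl, rfl⟩
                · exact Or.inl hab.symm
                · exact Or.inl hab
              · rcases sgl_ne s2 with h | h
                · exact Or.inr (Or.inr (Or.inr (Or.inr h)))
                · exact Or.inr (Or.inr (Or.inr (Or.inl h)))
            · rcases sgl_ne s1 with h | h
              · exact Or.inr (Or.inl h)
              · exact Or.inr (Or.inr (Or.inl h))
          simp [z1, z2]
      · simp only [Finset.sum_sub_distrib, ← Finset.mul_sum, trib, hg.bal]; simp
    obtain ⟨q, hq⟩ := hL.rep _ cc
    refine ⟨fun x => x.elim (q (L a b) - k) q, fun u w => ?_⟩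
    refine Eq.trans ?_ (key (fun x => x.elim (q (L a b) - k) q) u w).symm
    have := hq u w
    show g u w = q (L u w) - q (L w u) + (q (L a b) - (q (L a b) - k)) * tri u w
    rw [← this]; ring

end cyc
end FN


namespace FN
open Classical
set_option linter.unusedSectionVars false
set_option linter.unusedSimpArgs false
set_option linter.unusedVariables false

universe u
section walks
variable {V : Type u} [Fintype V] {G : SimpleGraph V}

/-- flow along a walk -/
noncomputable def fl : ∀ {u v : V}, G.Walk u v → V → V → ℤ
  | _, _, Walk.nil => fun _ _ => 0
  | _, _, Walk.cons (u := u) (v := v) _ p => fun a b => sgl u v a b + fl p a b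

@[simp] theorem fl_nil (u : V) (a b : V) : fl (Walk.nil : G.Walk u u) a b = 0 := rfl
@[simp] theorem fl_cons {u v w : V} (h : G.Adj u v) (p : G.Walk v w) (a b : V) :
    fl (Walk.cons h p) a b = sgl u v a b + fl p a b := rfl

theorem fl_anti {u v : V} (p : G.Walk u v) (a b : V) : fl p a b = - fl p b a := by
  induction p with
  | nil => simp
  | cons h p ih => rw [fl_cons, fl_cons, ih, sgl_anti]; ring

theorem fl_div {u v : V} (p : G.Walk u v) (w : V) :
    ∑ x, fl p w x = (if w = u then 1 else 0) - (if w = v then 1 else 0) := by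
  induction p with
  | nil => simp
  | cons h p ih => simp only [fl_cons, Finset.sum_add_distrib, ih, sgl_div]; ring

theorem fl_append {u v w : V} (p : G.Walk u v) (q : G.Walk v w) (a b : V) :
    fl (p.append q) a b = fl p a b + fl q a b := by
  induction p with
  | nil => simp
  | cons h p ih => rw [Walk.cons_append, fl_cons, fl_cons, ih, add_assoc]

theorem fl_reverse {u v : V} (p : G.Walk u v) (a b : V) : fl p.reverse a b = - fl p a b := by
  induction p with
  | nil => simp
  | cons h p ih =>
    rw [Walk.reverse_cons, fl_append, ih, fl_cons, fl_cons, fl_nil]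
    simp only [sgl]; ring

theorem fl_ne {u v : V} (p : G.Walk u v) {a b : V} (h : fl p a b ≠ 0) : s(a, b) ∈ p.edges := by
  induction p with
  | nil => simp at h
  | @cons x y z hxy p ih =>
    rw [Walk.edges_cons, List.mem_cons]
    by_cases h1 : fl p a b = 0
    · rw [fl_cons, h1, add_zero] at h
      rcases sgl_ne h with ⟨rfl, rfl⟩ | ⟨rfl, rfl⟩
      · exact Or.inl rfl
      · exact Or.inl Sym2.eq_swap
    · exact Or.inr (ih h1)

theorem fl_zero {u v : V} (p : G.Walk u v) {a b : V} (h : s(a, b) ∉ p.edges) : fl p a b = 0 := by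
  by_contra hc; exact h (fl_ne p hc)

theorem sgl_self {u v : V} (h : u ≠ v) : sgl u v u v = 1 := by
  simp [sgl, h]

theorem fl_trail {u v : V} (p : G.Walk u v) (hp : p.IsTrail) (a b : V) :
    (fl p a b = 0 ∨ fl p a b = 1 ∨ fl p a b = -1) ∧ (s(a, b) ∈ p.edges → fl p a b ≠ 0) := by
  induction p with
  | nil => simp
  | @cons x y z hxy p ih =>
    rw [Walk.isTrail_cons] at hp
    obtain ⟨h1, h2⟩ := hp
    by_cases he : s(a, b) = s(x, y)
    · have h3 : fl p a b = 0 := fl_zero p (he ▸ h2)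
      rw [fl_cons, h3, add_zero]
      rw [Sym2.eq_iff] at he
      rcases he with ⟨rfl, rfl⟩ | ⟨rfl, rfl⟩
      · rw [sgl_self hxy.ne]; simp
      · rw [sgl_anti, sgl_self hxy.ne]; simp
    · have h3 : sgl x y a b = 0 := by
        by_contra hc
        rcases sgl_ne hc with ⟨rfl, rfl⟩ | ⟨rfl, rfl⟩
        · exact he rfl
        · exact he Sym2.eq_swap
      rw [fl_cons, h3, zero_add, Walk.edges_cons, List.mem_cons]
      exact ⟨(ih h1).1, fun h => (ih h1).2 (h.resolve_left he)⟩

theorem fl_iff {u v : V} {p : G.Walk u v} (hp : p.IsTrail) {a b : V} :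
    fl p a b ≠ 0 ↔ s(a, b) ∈ p.edges := ⟨fl_ne p, (fl_trail p hp a b).2⟩

/-- a circulation on a path vanishes -/
theorem path_circ_zero {u v : V} (p : G.Walk u v) (hp : p.IsPath) (g : V → V → ℤ)
    (ga : ∀ a b, g a b = - g b a) (gb : ∀ a, ∑ b, g a b = 0)
    (gs : ∀ a b, g a b ≠ 0 → s(a, b) ∈ p.edges) (a b : V) : g a b = 0 := by
  induction p with
  | nil => by_contra h; simpa using gs a b h
  | @cons x y z hxy p ih =>
    rw [Walk.cons_isPath_iff] at hp
    have h1 : ∀ w, w ≠ y → g x w = 0 := by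
      intro w hw
      by_contra hc
      have := gs x w hc
      rw [Walk.edges_cons, List.mem_cons] at this
      rcases this with h | h
      · rw [Sym2.eq_iff] at h
        rcases h with ⟨_, h⟩ | ⟨h, h'⟩
        · exact hw h
        · exact hxy.ne h
      · exact hp.2 (p.fst_mem_support_of_mem_edges h)
    have h2 : g x y = 0 := by
      rw [← gb x]
      exact (Finset.sum_eq_single y (fun w _ hw => h1 w hw) (by simp)).symm
    have h2' : g y x = 0 := by rw [ga, h2]; rfl
    refine ih hp.1 fun a b hab => ?_
    have := gs a b hab
    rw [Walk.edges_cons, List.mem_cons] at this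
    refine this.resolve_left fun h => ?_
    rw [Sym2.eq_iff] at h
    rcases h with ⟨rfl, rfl⟩ | ⟨rfl, rfl⟩
    · exact hab h2
    · exact hab h2'

theorem Link.of_walk {E : V → V → Prop} {u v : V} (p : G.Walk u v)
    (hE : ∀ a b, s(a, b) ∈ p.edges → E a b) : Link E u v :=
  ⟨fl p, fl_anti p, fun a b hab => hE a b (fl_ne p hab), fl_div p⟩

theorem mem_Sv_fl {v : V} {c : G.Walk v v} (hc : c.IsCycle) {x : V} : x ∈ Sv (fl c) ↔ x ∈ c.support := by
  constructor
  · rintro ⟨u, hu⟩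
    exact c.fst_mem_support_of_mem_edges (fl_ne c hu)
  · intro hx
    rw [Walk.mem_support_iff_exists_mem_edges_of_not_nil hc.not_nil] at hx
    obtain ⟨e, he, hxe⟩ := hx
    obtain ⟨y, rfl⟩ := Sym2.mem_iff_exists.1 hxe
    exact ⟨y, (fl_iff hc.isTrail).2 he⟩

theorem cycF_fl {v : V} {c : G.Walk v v} (hc : c.IsCycle) : CycF (fl c) := by
  refine ⟨fl_anti c, fun a b => (fl_trail c hc.isTrail a b).1, fun w => by rw [fl_div, sub_self],
    ?_, ?_, ?_⟩
  · cases c with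
    | nil => simp at hc
    | @cons _ y _ h p =>
      refine ⟨v, y, ?_⟩
      rw [Walk.cons_isCycle_iff] at hc
      rw [fl_cons, fl_zero p hc.2, sgl_self h.ne, add_zero]
  · intro g ga gb gs
    cases c with
    | nil => simp at hc
    | @cons _ y _ h p =>
      rw [Walk.cons_isCycle_iff] at hc
      have h1 : fl (Walk.cons h p) v y = 1 := by
        rw [fl_cons, fl_zero p hc.2, sgl_self h.ne, add_zero]
      have hz := path_circ_zero p hc.1 (fun a b => g a b - g v y * fl (Walk.cons h p) a b)
        (fun a b => by
          show g a b - _ = _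
          rw [ga a b, fl_anti]; ring)
        (fun a => by
          rw [Finset.sum_sub_distrib, gb, ← Finset.mul_sum, fl_div]; simp)
        (fun a b hab => by
          have h2 : s(a, b) ∈ (Walk.cons h p).edges := by
            by_contra hn
            apply hab
            have e1 : fl (Walk.cons h p) a b = 0 := fl_zero _ hn
            have e2 : g a b = 0 := by by_contra hc'; exact gs a b hc' e1
            simp only [e1, e2]; simp
          rw [Walk.edges_cons, List.mem_cons] at h2
          refine h2.resolve_left fun h' => ?_
          rw [Sym2.eq_iff] at h'
          rcases h' with ⟨rfl, rfl⟩ | ⟨rfl, rfl⟩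
          · exact hab (by simp only [h1]; ring)
          · refine hab ?_
            show g a b - g b a * _ = 0
            rw [ga a b, fl_anti, h1]; ring)
      refine ⟨g v y, fun a b => ?_⟩
      have := hz a b
      linarith
  · have key : ∀ x, x ∈ Sv (fl c) → Link (fun a b => fl c a b ≠ 0) v x := by
      intro x hx
      rw [mem_Sv_fl hc] at hx
      exact Link.of_walk (c.takeUntil x hx) fun a b hab =>
        (fl_iff hc.isTrail).2 (c.edges_takeUntil_subset_edges hx hab)
    intro a b ha hb
    exact (key a ha).symm.trans (key b hb)

/-- two internally disjoint paths forming a cycle -/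
structure Duo {a b : V} (p q : G.Walk a b) : Prop where
  ne : a ≠ b
  pp : p.IsPath
  qp : q.IsPath
  dis : ∀ x ∈ p.support, x ∈ q.support → x = a ∨ x = b
  len : 1 < p.length ∨ 1 < q.length

theorem Duo.symm {a b : V} {p q : G.Walk a b} (h : Duo p q) : Duo q p :=
  ⟨h.ne, h.qp, h.pp, fun x hx hy => h.dis x hy hx, h.len.symm⟩

theorem Duo.reverse {a b : V} {p q : G.Walk a b} (h : Duo p q) : Duo p.reverse q.reverse :=
  ⟨h.ne.symm, h.pp.reverse, h.qp.reverse, fun x hx hy => by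
    rw [Walk.support_reverse, List.mem_reverse] at hx hy
    exact (h.dis x hx hy).symm, by simpa using h.len⟩

theorem path_tail_ne {a b : V} {p : G.Walk a b} (hp : p.IsPath) {x : V} (hx : x ∈ p.support.tail) :
    x ≠ a := by
  have := hp.support_nodup
  rw [← Walk.cons_tail_support, List.nodup_cons] at this
  rintro rfl
  exact this.1 hx

theorem Duo.cyc {a b : V} {p q : G.Walk a b} (h : Duo p q) : (p.append q.reverse).IsCycle := by
  refine h.pp.isCycle_append h.qp.reverse ?_ (by simpa using h.len)
  rw [List.disjoint_left]
  intro x hx hy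
  have h1 := path_tail_ne h.pp hx
  have h2 := path_tail_ne h.qp.reverse hy
  have h3 := List.mem_of_mem_tail hx
  have h4 := List.mem_of_mem_tail hy
  rw [Walk.support_reverse, List.mem_reverse] at h4
  rcases h.dis x h3 h4 with h | h
  · exact h1 h
  · exact h2 h

theorem Duo.fl_eq {a b : V} {p q : G.Walk a b} (h : Duo p q) (x y : V) :
    fl (p.append q.reverse) x y = fl p x y - fl q x y := by
  rw [fl_append, fl_reverse]; ring

theorem Duo.edges {a b : V} {p q : G.Walk a b} (h : Duo p q) {e : Sym2 V} (h1 : e ∈ p.edges) :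
    e ∉ q.edges := by
  intro h2
  have := h.cyc.isTrail
  rw [Walk.isTrail_append] at this
  exact List.disjoint_left.1 this.2.2 h1 (by simpa using h2)

theorem Duo.mem_support {a b : V} {p q : G.Walk a b} (x : V) :
    x ∈ (p.append q.reverse).support ↔ x ∈ p.support ∨ x ∈ q.support := by
  rw [Walk.mem_support_append_iff, Walk.support_reverse, List.mem_reverse]

theorem Duo.mem_edges {a b : V} {p q : G.Walk a b} (e : Sym2 V) :
    e ∈ (p.append q.reverse).edges ↔ e ∈ p.edges ∨ e ∈ q.edges := by
  simp

theorem cycle_split {v : V} {c : G.Walk v v} (hc : c.IsCycle) {s t : V} (hs : s ∈ c.support)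
    (ht : t ∈ c.support) (hst : s ≠ t) :
    ∃ p q : G.Walk s t, Duo p q ∧ (∀ x, x ∈ c.support ↔ x ∈ p.support ∨ x ∈ q.support) ∧
      (∀ e, e ∈ c.edges ↔ e ∈ p.edges ∨ e ∈ q.edges) ∧ (∀ a b, fl c a b = fl p a b - fl q a b) ∧
      c.length = p.length + q.length := by
  have hc1 : (c.rotate s hs).IsCycle := (Walk.isCycle_rotate hs).2 hc
  have hsup : ∀ x, x ∈ (c.rotate s hs).support ↔ x ∈ c.support := by
    intro x
    rw [← mem_Sv_fl hc1, ← mem_Sv_fl hc]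
    have : fl (c.rotate s hs) = fl c := by
      funext a b
      rw [Walk.rotate, fl_append, add_comm, ← fl_append, Walk.take_spec]
    rw [this]
  have hflr : ∀ a b, fl (c.rotate s hs) a b = fl c a b := by
    intro a b
    rw [Walk.rotate, fl_append, add_comm, ← fl_append, Walk.take_spec]
  have ht1 : t ∈ (c.rotate s hs).support := (hsup t).2 ht
  set d := c.rotate s hs with hd
  have hsp := d.take_spec ht1
  set p := d.takeUntil t ht1
  set q := d.dropUntil t ht1
  have hcy : (p.append q).IsCycle := by rw [hsp]; exact hc1
  have hpn : ¬ p.Nil := Walk.not_nil_of_ne hst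
  have hqn : ¬ q.Nil := Walk.not_nil_of_ne hst.symm
  have hpp := hcy.isPath_of_append_left hqn
  have hqp := hcy.isPath_of_append_right hpn
  refine ⟨p, q.reverse, ⟨hst, hpp, hqp.reverse, ?_, ?_⟩, fun x => ?_, fun e => ?_, fun a b => ?_, ?_⟩
  · intro x hx hy
    rw [Walk.support_reverse, List.mem_reverse] at hy
    by_contra hn
    push Not at hn
    have h1 := hcy.support_nodup
    rw [Walk.tail_support_append, List.nodup_append'] at h1
    exact List.disjoint_left.1 h1.2.2 ((Walk.mem_support_iff _).1 hx |>.resolve_left hn.1)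
      ((Walk.mem_support_iff _).1 hy |>.resolve_left hn.2)
  · have := hcy.three_le_length
    rw [Walk.length_append] at this
    rw [Walk.length_reverse]; omega
  · rw [← hsup, ← hsp, Walk.mem_support_append_iff, Walk.support_reverse, List.mem_reverse]
  · rw [← (c.rotate_edges s hs).mem_iff, ← hd, ← hsp, Walk.edges_append, List.mem_append,
      Walk.edges_reverse, List.mem_reverse]
  · rw [← hflr, ← hsp, fl_append, fl_reverse]; ring
  · have h1 : d.length = c.length := by simp [hd]
    rw [← h1, ← hsp, Walk.length_append, Walk.length_reverse]

theorem cycF_duo {a b : V} {p q : G.Walk a b} (h : Duo p q) : CycF (fun x y => fl p x y - fl q x y) := by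
  have := cycF_fl h.cyc
  have e : fl (p.append q.reverse) = (fun x y => fl p x y - fl q x y) := by
    funext x y; exact h.fl_eq x y
  rwa [e] at this

theorem Sv_duo {a b : V} {p q : G.Walk a b} (h : Duo p q) (x : V) :
    x ∈ Sv (fun x y => fl p x y - fl q x y) ↔ x ∈ p.support ∨ x ∈ q.support := by
  have e : fl (p.append q.reverse) = (fun x y => fl p x y - fl q x y) := by
    funext x y; exact h.fl_eq x y
  rw [← e, mem_Sv_fl h.cyc, Duo.mem_support]

end walks
end FN


namespace FN
open Classical
set_option linter.unusedSectionVars false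
set_option linter.unusedSimpArgs false
set_option linter.unusedVariables false

universe u
section minors
variable {V : Type u} [Fintype V] {G : SimpleGraph V}

/-- adjacency inside `B` -/
def RB (G : SimpleGraph V) (B : Set V) : V → V → Prop := fun a b => G.Adj a b ∧ a ∈ B ∧ b ∈ B

theorem RB.symm {B : Set V} {a b : V} (h : RB G B a b) : RB G B b a := ⟨h.1.symm, h.2.2, h.2.1⟩

def Rch (G : SimpleGraph V) (B : Set V) (a b : V) : Prop := Relation.ReflTransGen (RB G B) a b

theorem Rch.symm {B : Set V} {a b : V} (h : Rch G B a b) : Rch G B b a := by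
  induction h with
  | refl => exact .refl
  | tail _ h ih => exact Relation.ReflTransGen.head h.symm ih

theorem Rch.trans {B : Set V} {a b c : V} (h : Rch G B a b) (h' : Rch G B b c) : Rch G B a c :=
  Relation.ReflTransGen.trans h h'

theorem Rch.mono {H : SimpleGraph V} {B C : Set V} (hle : G ≤ H) (hBC : B ⊆ C) {a b : V}
    (h : Rch G B a b) : Rch H C a b := by
  induction h with
  | refl => exact .refl
  | tail _ h ih => exact Relation.ReflTransGen.tail ih ⟨hle h.1, hBC h.2.1, hBC h.2.2⟩

theorem Rch.mem {B : Set V} {a b : V} (h : Rch G B a b) (ha : a ∈ B) : b ∈ B := by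
  induction h with
  | refl => exact ha
  | tail _ h _ => exact h.2.2

theorem Rch.step {B : Set V} {a b c : V} (h : Rch G B a b) (ha : a ∈ B) (hbc : G.Adj b c) (hc : c ∈ B) :
    Rch G B a c := Relation.ReflTransGen.tail h ⟨hbc, h.mem ha, hc⟩

/-- a path realizing reachability -/
theorem Rch.path {B : Set V} {a b : V} (h : Rch G B a b) :
    ∃ p : G.Walk a b, p.IsPath ∧ ∀ x ∈ p.support, Rch G B a x := by
  have : ∃ p : G.Walk a b, ∀ x ∈ p.support, Rch G B a x := by
    induction h with
    | refl => exact ⟨Walk.nil, by simp; exact .refl⟩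
    | @tail b c hab hbc ih =>
      obtain ⟨p, hp⟩ := ih
      refine ⟨p.concat hbc.1, fun x hx => ?_⟩
      rw [Walk.support_concat, List.mem_append, List.mem_singleton] at hx
      rcases hx with hx | rfl
      · exact hp x hx
      · exact Relation.ReflTransGen.tail hab hbc
  obtain ⟨p, hp⟩ := this
  exact ⟨p.bypass, p.bypass_isPath, fun x hx => hp x (p.support_bypass_subset_support hx)⟩

theorem Rch.of_walk {B : Set V} {a b : V} (p : G.Walk a b) (h : ∀ x ∈ p.support, x ∈ B) : Rch G B a b := by
  induction p with
  | nil => exact .refl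
  | @cons u v w huv p ih =>
    have h1 : ∀ x ∈ p.support, x ∈ B := fun x hx => h x (by simp [hx])
    exact Relation.ReflTransGen.head ⟨huv, h u (by simp), h1 v (by simp)⟩ (ih h1)

theorem conn_iff {B : Set V} (hne : B.Nonempty) :
    (G.induce B).Connected ↔ ∀ a ∈ B, ∀ b ∈ B, Rch G B a b := by
  constructor
  · intro h a ha b hb
    obtain ⟨p⟩ := h.preconnected ⟨a, ha⟩ ⟨b, hb⟩
    have : ∀ (x y : B) (p : (G.induce B).Walk x y), Rch G B x.1 y.1 := by
      intro x y p
      induction p with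
      | nil => exact .refl
      | @cons u v w h p ih => exact Relation.ReflTransGen.head ⟨h, u.2, v.2⟩ ih
    exact this _ _ p
  · intro h
    haveI : Nonempty B := hne.to_subtype
    refine ⟨fun x y => ?_⟩
    have : ∀ (a b : V) (ha : a ∈ B) (hr : Rch G B a b), ∃ hb : b ∈ B, (G.induce B).Reachable ⟨a, ha⟩ ⟨b, hb⟩ := by
      intro a b ha hr
      induction hr with
      | refl => exact ⟨ha, Reachable.refl _⟩
      | @tail b c _ hbc ih =>
        obtain ⟨hb, hr⟩ := ih
        refine ⟨hbc.2.2, hr.trans (Adj.reachable ?_)⟩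
        exact hbc.1
    obtain ⟨_, hr⟩ := this x.1 y.1 x.2 (h _ x.2 _ y.2)
    exact hr

theorem HasMinor.mono {W : Type} {H : SimpleGraph V} {K : SimpleGraph W} (hle : H ≤ G)
    (h : HasMinor H K) : HasMinor G K := by
  obtain ⟨B, h1, h2, h3, h4⟩ := h
  refine ⟨B, h1, fun w => ?_, h3, fun w w' hw => ?_⟩
  · rw [conn_iff (h1 w)]
    intro a ha b hb
    exact ((conn_iff (h1 w)).1 (h2 w) a ha b hb).mono hle subset_rfl
  · obtain ⟨u, hu, x, hx, hux⟩ := h4 w w' hw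
    exact ⟨u, hu, x, hx, hle hux⟩

theorem IsPlanarGraph.mono {H : SimpleGraph V} (hle : H ≤ G) (h : IsPlanarGraph G) : IsPlanarGraph H :=
  ⟨fun h' => h.1 (HasMinor.mono hle h'), fun h' => h.2 (HasMinor.mono hle h')⟩

/-- contraction map -/
noncomputable def cm (x y : V) (v : V) : V := if v = y then x else v

theorem cm_of_ne {x y v : V} (h : v ≠ y) : cm x y v = v := by simp [cm, h]
theorem cm_y (x y : V) : cm x y y = x := by simp [cm]
theorem cm_ne_y {x y : V} (h : x ≠ y) (v : V) : cm x y v ≠ y := by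
  unfold cm; split_ifs with h1
  · exact h
  · exact h1

/-- contraction of `y` into `x` -/
def contr (G : SimpleGraph V) (x y : V) : SimpleGraph V where
  Adj u v := u ≠ v ∧ ∃ a b, cm x y a = u ∧ cm x y b = v ∧ G.Adj a b
  symm := ⟨fun u v h => ⟨h.1.symm, by
    obtain ⟨a, b, h1, h2, h3⟩ := h.2
    exact ⟨b, a, h2, h1, h3.symm⟩⟩⟩
  loopless := ⟨fun u h => h.1 rfl⟩

theorem contr_adj {x y u v : V} (h : G.Adj u v) (hne : cm x y u ≠ cm x y v) :
    (contr G x y).Adj (cm x y u) (cm x y v) := ⟨hne, u, v, rfl, rfl, h⟩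

theorem contr_adj' {x y u v : V} (h : G.Adj u v) (hu : u ≠ y) (hv : v ≠ y) :
    (contr G x y).Adj u v := by
  have := contr_adj (x := x) (y := y) h (by rw [cm_of_ne hu, cm_of_ne hv]; exact h.ne)
  rwa [cm_of_ne hu, cm_of_ne hv] at this

theorem cm_eq {x y a b : V} (h : cm x y a = cm x y b) : a = b ∨ (a = x ∧ b = y) ∨ (a = y ∧ b = x) := by
  unfold cm at h
  split_ifs at h with h1 h2 h2
  · left; rw [h1, h2]
  · right; right; exact ⟨h1, h.symm⟩
  · right; left; exact ⟨h, h2⟩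
  · left; exact h

theorem contr_not_y {x y : V} (hxy : x ≠ y) (u : V) : ¬ (contr G x y).Adj y u := by
  rintro ⟨_, a, b, h1, _⟩
  exact cm_ne_y hxy a h1

theorem HasMinor.contr {W : Type} {K : SimpleGraph W} {x y : V} (hxy : G.Adj x y)
    (hK : ∀ w, ∃ w', K.Adj w w') (h : HasMinor (contr G x y) K) : HasMinor G K := by
  obtain ⟨B, h1, h2, h3, h4⟩ := h
  have hne : ∀ w, (cm x y ⁻¹' B w).Nonempty := by
    intro w
    obtain ⟨w', hw'⟩ := hK w
    obtain ⟨u, hu, z, hz, huz⟩ := h4 w w' hw'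
    refine ⟨u, ?_⟩
    have : u ≠ y := by rintro rfl; exact contr_not_y hxy.ne z huz
    rw [Set.mem_preimage, cm_of_ne this]
    exact hu
  refine ⟨fun w => cm x y ⁻¹' B w, hne, fun w => ?_, fun w w' hw => ?_, fun w w' hw => ?_⟩
  · rw [conn_iff (hne w)]
    have fib : ∀ a b, cm x y a ∈ B w → cm x y a = cm x y b → Rch G (cm x y ⁻¹' B w) a b := by
      intro a b ha hab
      rcases cm_eq hab with h | ⟨h, h'⟩ | ⟨h, h'⟩
      · rw [h]; exact .refl
      · exact Relation.ReflTransGen.single ⟨by rw [h, h']; exact hxy, ha, by rw [Set.mem_preimage, ← hab]; exact ha⟩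
      · exact Relation.ReflTransGen.single ⟨by rw [h, h']; exact hxy.symm, ha, by rw [Set.mem_preimage, ← hab]; exact ha⟩
    have key : ∀ a, cm x y a ∈ B w → ∀ v, Rch (FN.contr G x y) (B w) (cm x y a) v →
        ∀ b, cm x y b = v → Rch G (cm x y ⁻¹' B w) a b := by
      intro a ha v hv
      induction hv with
      | refl => intro b hb; exact fib a b ha hb.symm
      | @tail v z hv hvz ih =>
        intro b hb
        obtain ⟨⟨_, c, d, hc, hd, hcd⟩, hv1, hz1⟩ := hvz
        have e1 := ih c hc
        have hdB : cm x y d ∈ B w := by rw [hd]; exact hz1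
        have e2 : Rch G (cm x y ⁻¹' B w) a d :=
          Relation.ReflTransGen.tail e1 ⟨hcd, by rw [Set.mem_preimage, hc]; exact hv1, hdB⟩
        exact e2.trans (fib d b hdB (by rw [hd, hb]))
    intro a ha b hb
    exact key a ha _ ((conn_iff (h1 w)).1 (h2 w) _ ha _ hb) b rfl
  · exact Disjoint.preimage _ (h3 hw)
  · obtain ⟨u, hu, z, hz, _, a, b, ha, hb, hab⟩ := h4 w w' hw
    exact ⟨a, by rw [Set.mem_preimage, ha]; exact hu, b, by rw [Set.mem_preimage, hb]; exact hz, hab⟩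

theorem IsPlanarGraph.contr {x y : V} (hxy : G.Adj x y) (h : IsPlanarGraph G) :
    IsPlanarGraph (contr G x y) := by
  refine ⟨fun h' => h.1 (HasMinor.contr hxy (fun w => ?_) h'),
    fun h' => h.2 (HasMinor.contr hxy (fun w => ?_) h')⟩
  · exact ⟨w + 1, by revert w; simp only [completeGraph, top_adj]; decide⟩
  · rcases w with w | w
    · exact ⟨Sum.inr 0, by simp⟩
    · exact ⟨Sum.inl 0, by simp⟩

noncomputable def ec (G : SimpleGraph V) : ℕ := {p : V × V | G.Adj p.1 p.2}.ncard

theorem ec_lt {H : SimpleGraph V} (hle : H ≤ G) {u v : V} (h1 : G.Adj u v) (h2 : ¬ H.Adj u v) :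
    ec H < ec G := by
  refine Set.ncard_lt_ncard ⟨fun p hp => hle hp, fun h => h2 ?_⟩ (Set.toFinite _)
  exact h (show (u, v) ∈ {p : V × V | G.Adj p.1 p.2} from h1)

theorem ec_contr {x y : V} (hxy : G.Adj x y) : ec (contr G x y) < ec G := by
  have h1 : {p : V × V | (contr G x y).Adj p.1 p.2} ⊆
      (fun p : V × V => (cm x y p.1, cm x y p.2)) '' ({p : V × V | G.Adj p.1 p.2} \ {(x, y)}) := by
    rintro ⟨u, v⟩ ⟨hne, a, b, ha, hb, hab⟩
    refine ⟨(a, b), ⟨hab, ?_⟩, by simp [ha, hb]⟩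
    rintro h
    rw [Set.mem_singleton_iff, Prod.mk.injEq] at h
    apply hne
    show u = v
    have ha : cm x y a = u := ha
    have hb : cm x y b = v := hb
    rw [← ha, ← hb, h.1, h.2, cm_y, cm_of_ne hxy.ne]
  calc ec (contr G x y) ≤ _ := Set.ncard_le_ncard h1 (Set.toFinite _)
    _ ≤ _ := Set.ncard_image_le (Set.toFinite _)
    _ < ec G := Set.ncard_sdiff_singleton_lt_of_mem hxy (Set.toFinite _)

/-- minimal counterexample -/
structure Ce (G : SimpleGraph V) : Prop where
  pl : IsPlanarGraph G
  bad : ¬ Good G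
  min : ∀ H : SimpleGraph V, IsPlanarGraph H → ec H < ec G → Good H

theorem Ce.sub (hG : Ce G) {H : SimpleGraph V} (hle : H ≤ G) {u v : V} (h1 : G.Adj u v)
    (h2 : ¬ H.Adj u v) : Good H := hG.min H (IsPlanarGraph.mono hle hG.pl) (ec_lt hle h1 h2)

theorem Ce.contr (hG : Ce G) {x y : V} (hxy : G.Adj x y) : Good (contr G x y) :=
  hG.min _ (IsPlanarGraph.contr hxy hG.pl) (ec_contr hxy)

/-- two attachments -/
theorem Ce.two_att (hG : Ce G) (S : Set V) {w z : V} (hw : w ∉ S) (hwz : G.Adj w z)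
    {c d : V} (hcd : G.Adj c d) (hc : ¬ Rch G Sᶜ w c) (hd : ¬ Rch G Sᶜ w d) :
    ∃ s k s' k', s ≠ s' ∧ s ∈ S ∧ s' ∈ S ∧ Rch G Sᶜ w k ∧ Rch G Sᶜ w k' ∧ G.Adj s k ∧ G.Adj s' k' := by
  by_contra hcon
  push Not at hcon
  let K : Set V := {v | Rch G Sᶜ w v}
  have hatt : ∀ v u, v ∉ K → u ∈ K → G.Adj v u → v ∈ S := by
    intro v u hv hu hvu
    by_contra hvS
    exact hv (Rch.step hu hw hvu.symm hvS)
  have huniq : ∀ v u v' u', v ∉ K → u ∈ K → G.Adj v u → v' ∉ K → u' ∈ K → G.Adj v' u' → v = v' := by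
    intro v u v' u' h1 h2 h3 h4 h5 h6
    by_contra hne
    exact hcon v u v' u' hne (hatt v u h1 h2 h3) (hatt v' u' h4 h5 h6) h2 h5 h3 h6
  obtain ⟨H, hHd⟩ : ∃ H : SimpleGraph V, ∀ u v, H.Adj u v ↔ G.Adj u v ∧ (u ∈ K ∨ v ∈ K) :=
    ⟨{ Adj := fun u v => G.Adj u v ∧ (u ∈ K ∨ v ∈ K)
       symm := ⟨fun u v h => ⟨h.1.symm, h.2.symm⟩⟩
       loopless := ⟨fun u h => h.1.ne rfl⟩ }, fun _ _ => Iff.rfl⟩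
  obtain ⟨H', hHd'⟩ : ∃ H : SimpleGraph V, ∀ u v, H.Adj u v ↔ G.Adj u v ∧ ¬ (u ∈ K ∨ v ∈ K) :=
    ⟨{ Adj := fun u v => G.Adj u v ∧ ¬ (u ∈ K ∨ v ∈ K)
       symm := ⟨fun u v h => ⟨h.1.symm, fun h' => h.2 h'.symm⟩⟩
       loopless := ⟨fun u h => h.1.ne rfl⟩ }, fun _ _ => Iff.rfl⟩
  have hH : H ≤ G := fun u v h => ((hHd u v).1 h).1
  have hH' : H' ≤ G := fun u v h => ((hHd' u v).1 h).1
  have g1 : Good H := hG.sub hH hcd (fun h => ((hHd _ _).1 h).2.elim hc hd)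
  have g2 : Good H' := hG.sub hH' hwz (fun h => ((hHd' _ _).1 h).2 (Or.inl Relation.ReflTransGen.refl))
  refine hG.bad (good_sum g1 g2 (fun u v h => ?_) (fun u v h h' => ((hHd' _ _).1 h').2 ((hHd _ _).1 h).2) hH hH' fun f hf => ?_)
  · by_cases hk : u ∈ K ∨ v ∈ K
    · exact Or.inl ((hHd _ _).2 ⟨h, hk⟩)
    · exact Or.inr ((hHd' _ _).2 ⟨h, hk⟩)
  · have anti : ∀ u v, (if H.Adj u v then f u v else 0) = - (if H.Adj v u then f v u else 0) := by
      intro u v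
      rw [H.adj_comm v u, hf.anti u v]
      split_ifs <;> simp
    have hz : ∀ v, (∀ u, v ∈ K ∨ u ∉ K ∨ ¬ G.Adj v u) → ∑ u, (if H.Adj v u then f v u else 0) = 0 := by
      intro v hv
      by_cases hvK : v ∈ K
      · refine Eq.trans ?_ (hf.bal v)
        refine Finset.sum_congr rfl fun u _ => ?_
        by_cases huv : G.Adj v u
        · rw [if_pos ((hHd _ _).2 ⟨huv, Or.inl hvK⟩)]
        · rw [if_neg (fun h => huv (hH h)), hf.zero_of_not_adj huv]
      · refine Finset.sum_eq_zero fun u _ => ?_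
        rw [if_neg]
        rw [hHd]
        rintro ⟨h1, h2 | h2⟩
        · exact hvK h2
        · rcases hv u with h | h | h
          · exact hvK h
          · exact h h2
          · exact h h1
    refine ⟨anti, fun u v huv => ?_, fun v => ?_⟩
    · by_contra h
      exact huv (by simp only [if_neg h])
    · by_cases hv : ∀ u, v ∈ K ∨ u ∉ K ∨ ¬ G.Adj v u
      · exact hz v hv
      · push Not at hv
        obtain ⟨u, h1, h2, h3⟩ := hv
        have tot := sum_anti_eq_zero anti
        rw [Finset.sum_eq_single v] at tot
        · exact tot
        · intro v' _ hv'
          apply hz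
          by_contra hn
          push Not at hn
          obtain ⟨u', h1', h2', h3'⟩ := hn
          exact hv' (huniq v' u' v u h1' h2' h3' h1 h2 h3)
        · simp

end minors
end FN


namespace FN
open Classical
set_option linter.unusedSectionVars false
set_option linter.unusedSimpArgs false
set_option linter.unusedVariables false

universe u
section theta
variable {V : Type u} [Fintype V] {G : SimpleGraph V}

structure Theta {a b : V} (p q r : G.Walk a b) : Prop where
  pq : Duo p q
  pr : Duo p r
  qr : Duo q r

def Ts {a b : V} (p q r : G.Walk a b) : Set V := {z | z ∈ p.support ∨ z ∈ q.support ∨ z ∈ r.support}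
def Te {a b : V} (p q r : G.Walk a b) (u v : V) : Prop :=
  s(u, v) ∈ p.edges ∨ s(u, v) ∈ q.edges ∨ s(u, v) ∈ r.edges

theorem Te.symm {a b : V} {p q r : G.Walk a b} {u v : V} (h : Te p q r u v) : Te p q r v u := by
  unfold Te at *; rwa [Sym2.eq_swap (a := v)]

theorem Te.adj {a b : V} {p q r : G.Walk a b} {u v : V} (h : Te p q r u v) : G.Adj u v := by
  rcases h with h | h | h
  · exact p.adj_of_mem_edges h
  · exact q.adj_of_mem_edges h
  · exact r.adj_of_mem_edges h

theorem Te.mem {a b : V} {p q r : G.Walk a b} {u v : V} (h : Te p q r u v) : u ∈ Ts p q r := by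
  rcases h with h | h | h
  · exact Or.inl (p.fst_mem_support_of_mem_edges h)
  · exact Or.inr (Or.inl (q.fst_mem_support_of_mem_edges h))
  · exact Or.inr (Or.inr (r.fst_mem_support_of_mem_edges h))

theorem Te.mem' {a b : V} {p q r : G.Walk a b} {u v : V} (h : Te p q r u v) : v ∈ Ts p q r := h.symm.mem

theorem Duo.link {a b : V} {p q : G.Walk a b} (h : Duo p q) {u v : V}
    (hu : u ∈ p.support ∨ u ∈ q.support) (hv : v ∈ p.support ∨ v ∈ q.support) :
    Link (fun x y => s(x, y) ∈ p.edges ∨ s(x, y) ∈ q.edges) u v := by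
  refine ((cycF_duo h).link u v ((Sv_duo h u).2 hu) ((Sv_duo h v).2 hv)).mono ?_
  intro x y hxy
  by_cases h1 : fl p x y = 0
  · right
    apply fl_ne
    intro h2; exact hxy (by simp [h1, h2])
  · left; exact fl_ne p h1

theorem Theta.link {a b : V} {p q r : G.Walk a b} (h : Theta p q r) {u v : V}
    (hu : u ∈ Ts p q r) (hv : v ∈ Ts p q r) : Link (Te p q r) u v := by
  have key : ∀ u ∈ Ts p q r, Link (Te p q r) u a := by
    intro u hu
    rcases hu with hu | hu | hu
    · exact (h.pq.link (Or.inl hu) (Or.inl p.start_mem_support)).mono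
        (fun x y hxy => hxy.elim Or.inl (fun h => Or.inr (Or.inl h)))
    · exact (h.pq.link (Or.inr hu) (Or.inl p.start_mem_support)).mono
        (fun x y hxy => hxy.elim Or.inl (fun h => Or.inr (Or.inl h)))
    · exact (h.pr.link (Or.inr hu) (Or.inl p.start_mem_support)).mono
        (fun x y hxy => hxy.elim Or.inl (fun h => Or.inr (Or.inr h)))
  exact (key u hu).trans (key v hv).symm

theorem mkTheta {v : V} {c : G.Walk v v} (hc : c.IsCycle) {s t : V} (hs : s ∈ c.support)
    (ht : t ∈ c.support) (hst : s ≠ t) (r : G.Walk s t) (hr : r.IsPath)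
    (hd : ∀ x ∈ r.support, x ∈ c.support → x = s ∨ x = t) (hl : 1 < r.length ∨ s(s, t) ∉ c.edges) :
    ∃ p q : G.Walk s t, Theta p q r ∧ (∀ x, x ∈ c.support ↔ x ∈ p.support ∨ x ∈ q.support) ∧
      (∀ e, e ∈ c.edges ↔ e ∈ p.edges ∨ e ∈ q.edges) ∧ (∀ a b, fl c a b = fl p a b - fl q a b) ∧
      c.length = p.length + q.length := by
  obtain ⟨p, q, h1, h2, h3, h4, h5⟩ := cycle_split hc hs ht hst
  have len : ∀ w : G.Walk s t, (∀ e ∈ w.edges, e ∈ c.edges) → 1 < w.length ∨ 1 < r.length := by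
    intro w hw
    by_contra hn
    push Not at hn
    rcases hl with hl | hl
    · omega
    · cases w with
      | nil => exact hst rfl
      | cons h w' =>
        cases w' with
        | nil => exact hl (hw _ (by simp))
        | cons h' w'' => simp at hn
  refine ⟨p, q, ⟨h1, ⟨hst, h1.pp, hr, fun x hx hx' => hd x hx' ((h2 x).2 (Or.inl hx)),
    len p fun e he => (h3 e).2 (Or.inl he)⟩, ⟨hst, h1.qp, hr, fun x hx hx' => hd x hx' ((h2 x).2 (Or.inr hx)),
    len q fun e he => (h3 e).2 (Or.inr he)⟩⟩, h2, h3, h4, h5⟩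

theorem fl_snd {a b : V} {p : G.Walk a b} (hp : p.IsPath) (hab : a ≠ b) : fl p a p.snd = 1 ∧
    s(a, p.snd) ∈ p.edges := by
  cases p with
  | nil => exact absurd rfl hab
  | @cons _ y _ h p =>
    have : (Walk.cons h p).snd = y := by simp
    rw [this]
    have ht := hp.isTrail
    rw [Walk.isTrail_cons] at ht
    refine ⟨?_, by simp⟩
    rw [fl_cons, fl_zero p ht.2, sgl_self h.ne, add_zero]

/-- local version at a vertex -/
theorem side_vertex {X : Type} {L : V → V → X} (hE : Emb G L) (U : Set X) (T : Set V) (E : V → V → Prop)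
    (hET : ∀ a b, E a b → G.Adj a b ∧ a ∈ T ∧ b ∈ T) {v v2 w1 w2 : V} (hv : v ∈ T) (hv2 : v2 ∈ T)
    (hne : v ≠ v2) (hj : ∀ u, (L v u ∈ U ↔ L u v ∈ U)) (hw1 : w1 ∉ T) (hw2 : w2 ∉ T)
    (h1 : G.Adj v w1) (h2 : G.Adj v2 w2) (hl : Link (fun a b => G.Adj a b ∧ a ∉ T ∧ b ∉ T) w1 w2)
    (hlE : Link E v2 v) (b : Prop) (hb : ∀ u, E v u → (L v u ∈ U ↔ b)) : L v w1 ∈ U ↔ b := by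
  obtain ⟨h, ha, hs, hd⟩ := hlE
  obtain ⟨k, ka, ks, kd⟩ := hl
  let g : V → V → ℤ := fun a b => sgl v w1 a b + k a b + sgl w2 v2 a b + h a b
  have hg : IsCirc G g := by
    refine ⟨fun a b => ?_, fun a b hab => ?_, fun z => ?_⟩
    · simp only [g]; rw [sgl_anti v w1 a b, sgl_anti w2 v2 a b, ha a b, ka a b]; ring
    · by_contra hn
      apply hab
      have e1 : sgl v w1 a b = 0 := by
        by_contra hc
        rcases sgl_ne hc with ⟨rfl, rfl⟩ | ⟨rfl, rfl⟩
        · exact hn h1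
        · exact hn h1.symm
      have e2 : sgl w2 v2 a b = 0 := by
        by_contra hc
        rcases sgl_ne hc with ⟨rfl, rfl⟩ | ⟨rfl, rfl⟩
        · exact hn h2.symm
        · exact hn h2
      have e3 : h a b = 0 := by by_contra hc; exact hn (hET a b (hs a b hc)).1
      have e4 : k a b = 0 := by by_contra hc; exact hn (ks a b hc).1
      simp [g, e1, e2, e3, e4]
    · simp only [g, Finset.sum_add_distrib, sgl_div, hd, kd]; ring
  obtain ⟨q, hq⟩ := hE.rep g hg
  have hbal := hE.bal (fun x => q x * ind U x) v
  have hterm : ∀ u, q (L v u) * ind U (L v u) - q (L u v) * ind U (L u v) =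
      sgl v w1 v u * ind U (L v w1) + h v u * (if b then 1 else 0) := by
    intro u
    have e0 : ind U (L u v) = ind U (L v u) := by simp only [ind, hj u]
    have e1 : k v u = 0 := by by_contra hc; exact (ks v u hc).2.1 hv
    have e2 : sgl w2 v2 v u = 0 := by
      by_contra hc
      rcases sgl_ne hc with ⟨h, _⟩ | ⟨h, _⟩
      · exact hw2 (h ▸ hv)
      · exact hne h
    have e3 : h v u * ind U (L v u) = h v u * (if b then 1 else 0) := by
      by_cases hz : h v u = 0
      · simp [hz]
      · simp only [ind, hb u (hs v u hz)]
    have e4 : sgl v w1 v u * ind U (L v u) = sgl v w1 v u * ind U (L v w1) := by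
      by_cases hz : sgl v w1 v u = 0
      · simp [hz]
      · rcases sgl_ne hz with ⟨_, rfl⟩ | ⟨h, _⟩
        · rfl
        · exact absurd (h ▸ hv) hw1
    rw [e0, ← sub_mul, ← hq]
    simp only [g, e1, e2]
    rw [← e3, ← e4]; ring
  have hvw : v ≠ w1 := fun h => hw1 (h ▸ hv)
  have hsum : ind U (L v w1) - (if b then 1 else 0) = 0 := by
    have : ∑ u, (sgl v w1 v u * ind U (L v w1) + h v u * (if b then 1 else 0)) = 0 := by
      refine Eq.trans (Finset.sum_congr rfl fun u _ => (hterm u).symm) hbal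
    rw [Finset.sum_add_distrib, ← Finset.sum_mul, ← Finset.sum_mul, sgl_div, hd] at this
    simp only [if_neg hvw, if_neg hne, if_true] at this
    linarith
  by_cases hbb : b <;> by_cases hu : L v w1 ∈ U <;> simp [hbb, hu, ind] at hsum ⊢

structure Ctx (G : SimpleGraph V) (x y : V) {X : Type} (L : V → V → X) : Prop where
  ce : Ce G
  xy : G.Adj x y
  fin : Finite X
  emb : Emb (contr G x y) L
  conn : Conn L

variable {x y : V} {X : Type} {L : V → V → X}

theorem cm_not_mem {S : Set V} (hx : x ∉ S) {w : V} (hw : w ∉ S) : cm x y w ∉ S := by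
  unfold cm; split_ifs <;> assumption

theorem contr_att {S : Set V} (hx : x ∉ S) (hy : y ∉ S) {s w : V} (hs : s ∈ S) (hw : w ∉ S)
    (h : G.Adj s w) : (contr G x y).Adj s (cm x y w) := by
  have e : cm x y s = s := cm_of_ne (fun h => hy (h ▸ hs))
  have := contr_adj (x := x) (y := y) h (by
    rw [e]; exact fun h => cm_not_mem hx hw (h ▸ hs))
  rwa [e] at this

theorem contr_link {S : Set V} (hx : x ∉ S) {w w' : V} (h : Rch G Sᶜ w w') :
    Link (fun a b => (contr G x y).Adj a b ∧ a ∉ S ∧ b ∉ S) (cm x y w) (cm x y w') := by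
  induction h with
  | refl => exact Link.refl _ _
  | @tail b c _ hbc ih =>
    refine ih.trans ?_
    by_cases he : cm x y b = cm x y c
    · rw [he]; exact Link.refl _ _
    · have h1 := cm_not_mem (y := y) hx hbc.2.1
      have h2 := cm_not_mem (y := y) hx hbc.2.2
      exact Link.edge ⟨contr_adj hbc.1 he, h1, h2⟩ ⟨(contr_adj hbc.1 he).symm, h2, h1⟩

theorem side_K (C : Ctx G x y L) (U : Set X) (S : Set V) (hx : x ∉ S) (hy : y ∉ S)
    (hj : ∀ u v, u ∉ S → (L u v ∈ U ↔ L v u ∈ U))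
    (hS : ∀ s ∈ S, ∀ t ∈ S, Link (fun a b => G.Adj a b ∧ a ∈ S ∧ b ∈ S) s t)
    {s w w' t : V} (hs : s ∈ S) (ht : t ∈ S) (hw : w ∉ S) (hsw : G.Adj s w)
    (htw : G.Adj t w') (hl : Rch G Sᶜ w w') : L s (cm x y w) ∈ U ↔ L t (cm x y w') ∈ U := by
  have hw' : w' ∉ S := hl.mem hw
  refine side_eq C.emb U S hj (fun s hs t ht => (hS s hs t ht).mono ?_) hs ht (cm_not_mem hx hw)
    (cm_not_mem hx hw') (contr_att hx hy hs hw hsw) (contr_att hx hy ht hw' htw) (contr_link hx hl)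
  rintro a b ⟨h1, h2, h3⟩
  exact ⟨contr_adj' h1 (fun h => hy (h ▸ h2)) (fun h => hy (h ▸ h3)), h2, h3⟩

structure Cand (L : V → V → X) (x y : V) {o : V} (c : G.Walk o o) (U : Set X) : Prop where
  cyc : c.IsCycle
  hx : x ∉ c.support
  hy : y ∉ c.support
  rep : ∀ u v, fl c u v = ind U (L u v) - ind U (L v u)
  k : ∃ s ∈ c.support, ∃ w, Rch G {z | z ∈ c.support}ᶜ x w ∧ G.Adj s w ∧ L s (cm x y w) ∈ U
  o : ∃ s ∈ c.support, ∃ v, G.Adj s v ∧ s(s, v) ∉ c.edges ∧ L s (cm x y v) ∉ U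

theorem Ts_swap {a b : V} (p q r : G.Walk a b) : Ts r p q = Ts p q r := by
  ext z; simp only [Ts]; constructor <;> (rintro (h | h | h) <;> simp [h])

/-- vertex attachments interior to one of the three paths -/
theorem side_int (C : Ctx G x y L) {a b : V} {p q r : G.Walk a b} (h : Theta p q r)
    (hx : x ∉ Ts p q r) (hy : y ∉ Ts p q r) (U : Set X)
    (hU : ∀ u v, u ∉ p.support → u ∉ r.support → (L u v ∈ U ↔ L v u ∈ U))
    {s s' k k' : V} (hs : s ∈ Ts p q r) (hs' : s' ∈ Ts p q r) (hne : s ≠ s')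
    (hk : Rch G (Ts p q r)ᶜ x k) (hk' : Rch G (Ts p q r)ᶜ x k') (hsk : G.Adj s k) (hsk' : G.Adj s' k')
    (hsp : s ∉ p.support) (hsr : s ∉ r.support) (B : Prop)
    (hb : ∀ u v, s(u, v) ∈ q.edges → (L u v ∈ U ↔ B)) : L s (cm x y k) ∈ U ↔ B := by
  have hkT : k ∉ Ts p q r := hk.mem hx
  have hkT' : k' ∉ Ts p q r := hk'.mem hx
  refine side_vertex C.emb U (Ts p q r) (Te p q r) ?_ hs hs' hne (fun u => hU s u hsp hsr)
    (cm_not_mem hx hkT) (cm_not_mem hx hkT') (contr_att hx hy hs hkT hsk) (contr_att hx hy hs' hkT' hsk')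
    (contr_link hx (hk.symm.trans hk')) (h.link hs' hs) B ?_
  · intro u v huv
    exact ⟨contr_adj' huv.adj (fun h => hy (h ▸ huv.mem)) (fun h => hy (h ▸ huv.mem')), huv.mem, huv.mem'⟩
  · intro u hu
    rcases hu with hu | hu | hu
    · exact absurd (p.fst_mem_support_of_mem_edges hu) hsp
    · exact hb s u hu
    · exact absurd (r.fst_mem_support_of_mem_edges hu) hsr

theorem theta1 (C : Ctx G x y L) {a b : V} {p q r : G.Walk a b} (h : Theta p q r)
    (hx : x ∉ Ts p q r) (hy : y ∉ Ts p q r) (U : Set X)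
    (hU : ∀ u v, fl p u v - fl r u v = ind U (L u v) - ind U (L v u))
    (hq : ∀ u v, s(u, v) ∈ q.edges → L u v ∉ U)
    {s s' k k' : V} (hs : s ∈ Ts p q r) (hs' : s' ∈ Ts p q r) (hne : s ≠ s')
    (hk : Rch G (Ts p q r)ᶜ x k) (hk' : Rch G (Ts p q r)ᶜ x k') (hsk : G.Adj s k) (hsk' : G.Adj s' k')
    (hsU : L s (cm x y k) ∈ U) (hsU' : L s' (cm x y k') ∈ U) :
    Cand L x y (p.append r.reverse) U := by
  have hj : ∀ u v, u ∉ p.support → u ∉ r.support → (L u v ∈ U ↔ L v u ∈ U) := by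
    intro u v h1 h2
    rw [← ind_sub_eq_zero, ← hU, fl_zero p (fun h => h1 (p.fst_mem_support_of_mem_edges h)),
      fl_zero r (fun h => h2 (r.fst_mem_support_of_mem_edges h)), sub_zero]
  have hsub : (Ts p q r)ᶜ ⊆ {z | z ∈ (p.append r.reverse).support}ᶜ := by
    intro z hz hz'
    rw [Set.mem_ofPred_eq, Duo.mem_support] at hz'
    exact hz (hz'.elim Or.inl (fun h => Or.inr (Or.inr h)))
  refine ⟨h.pr.cyc, fun h' => hsub hx h', fun h' => hsub hy h', fun u v => by rw [h.pr.fl_eq, hU], ?_, ?_⟩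
  · by_cases h1 : s ∈ p.support ∨ s ∈ r.support
    · exact ⟨s, (Duo.mem_support s).2 h1, k, hk.mono le_rfl hsub, hsk, hsU⟩
    · exfalso
      push Not at h1
      exact (side_int C h hx hy U hj hs hs' hne hk hk' hsk hsk' h1.1 h1.2 False
        (fun u v huv => iff_false_intro (hq u v huv))).1 hsU
  · have := fl_snd h.pq.qp h.pq.ne
    have hm : q.snd ∈ Ts p q r := Or.inr (Or.inl (q.snd_mem_support_of_mem_edges this.2))
    refine ⟨a, (Duo.mem_support a).2 (Or.inl p.start_mem_support), q.snd, q.adj_of_mem_edges this.2, ?_, ?_⟩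
    · rw [Duo.mem_edges]
      rintro (h1 | h1)
      · exact h.pq.edges h1 this.2
      · exact h.qr.edges this.2 h1
    · have hqy : q.snd ≠ y := fun h => hy (h ▸ hm)
      rw [cm_of_ne hqy]
      exact hq _ _ this.2


theorem Theta.linkT {a b : V} {p q r : G.Walk a b} (h : Theta p q r) : ∀ s ∈ Ts p q r, ∀ t ∈ Ts p q r,
    Link (fun u v => G.Adj u v ∧ u ∈ Ts p q r ∧ v ∈ Ts p q r) s t := fun s hs t ht =>
  (h.link hs ht).mono fun u v huv => ⟨huv.adj, huv.mem, huv.mem'⟩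

theorem cycle_linkS {o : V} {c : G.Walk o o} (hc : c.IsCycle) : ∀ s ∈ {z | z ∈ c.support}, ∀ t ∈ {z | z ∈ c.support},
    Link (fun u v => G.Adj u v ∧ u ∈ {z | z ∈ c.support} ∧ v ∈ {z | z ∈ c.support}) s t := fun s hs t ht =>
  ((cycF_fl hc).link s t ((mem_Sv_fl hc).2 hs) ((mem_Sv_fl hc).2 ht)).mono fun u v huv =>
    ⟨c.adj_of_mem_edges (fl_ne c huv), c.fst_mem_support_of_mem_edges (fl_ne c huv),
      c.snd_mem_support_of_mem_edges (fl_ne c huv)⟩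

theorem cycle_hj {o : V} {c : G.Walk o o} {U : Set X} (hU : ∀ u v, fl c u v = ind U (L u v) - ind U (L v u)) :
    ∀ u v, u ∉ {z | z ∈ c.support} → (L u v ∈ U ↔ L v u ∈ U) := by
  intro u v h
  rw [← ind_sub_eq_zero, ← hU]
  exact fl_zero c (fun h' => h (c.fst_mem_support_of_mem_edges h'))

theorem theta_step (C : Ctx G x y L) {a b : V} {p q r : G.Walk a b} (h : Theta p q r)
    (hx : x ∉ Ts p q r) (hy : y ∉ Ts p q r) (U : Set X)
    (hU : ∀ u v, fl p u v - fl q u v = ind U (L u v) - ind U (L v u))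
    (hK : ∃ s, (s ∈ p.support ∨ s ∈ q.support) ∧ ∃ w, Rch G {z | z ∈ (p.append q.reverse).support}ᶜ x w ∧
      G.Adj s w ∧ L s (cm x y w) ∈ U)
    (hr : L a r.snd ∈ U) :
    ∃ (o : V) (c : G.Walk o o) (U' : Set X), Cand L x y c U' ∧ U'.ncard < U.ncard := by
  have := C.fin
  have hsupp : ∀ w w' : G.Walk a b, (∀ z ∈ w.support, z ∈ Ts p q r) → (∀ z ∈ w'.support, z ∈ Ts p q r) →
      ∀ u v, fl w u v - fl w' u v ≠ 0 → (contr G x y).Adj u v := by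
    intro w w' h1 h2 u v huv
    have : (G.Adj u v) ∧ u ∈ Ts p q r ∧ v ∈ Ts p q r := by
      by_cases hz : fl w u v = 0
      · have hz' : fl w' u v ≠ 0 := fun h => huv (by simp [hz, h])
        have := fl_ne _ hz'
        exact ⟨w'.adj_of_mem_edges this, h2 _ (w'.fst_mem_support_of_mem_edges this),
          h2 _ (w'.snd_mem_support_of_mem_edges this)⟩
      · have := fl_ne _ hz
        exact ⟨w.adj_of_mem_edges this, h1 _ (w.fst_mem_support_of_mem_edges this),
          h1 _ (w.snd_mem_support_of_mem_edges this)⟩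
    exact contr_adj' this.1 (fun h => hy (h ▸ this.2.1)) (fun h => hy (h ▸ this.2.2))
  have sp : ∀ z ∈ p.support, z ∈ Ts p q r := fun z hz => Or.inl hz
  have sq : ∀ z ∈ q.support, z ∈ Ts p q r := fun z hz => Or.inr (Or.inl hz)
  have sr : ∀ z ∈ r.support, z ∈ Ts p q r := fun z hz => Or.inr (Or.inr hz)
  obtain ⟨U1, hU1⟩ := cyc_rep C.emb (cycF_duo h.pr) (hsupp p r sp sr)
  obtain ⟨U2, hU2⟩ := cyc_rep C.emb (cycF_duo h.qr.symm) (hsupp r q sr sq)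
  have hcn := C.conn (fun z => ind U z - ind U1 z - ind U2 z) (fun u v => by
    have h1 := hU u v; have h2 := hU1 u v; have h3 := hU2 u v
    linarith)
  obtain ⟨hf, hfe⟩ := fl_snd h.pr.qp h.pr.ne
  have e1 := hU1 a r.snd
  have e2 := hU2 a r.snd
  have hp0 : fl p a r.snd = 0 := fl_zero p (fun h' => h.pr.edges h' hfe)
  have hq0 : fl q a r.snd = 0 := fl_zero q (fun h' => h.qr.edges h' hfe)
  rw [hf, hp0] at e1
  rw [hf, hq0] at e2
  have e1' : L r.snd a ∈ U1 ∧ L a r.snd ∉ U1 := ind_sub_eq_one.1 (by linarith)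
  have e2' : L a r.snd ∈ U2 ∧ L r.snd a ∉ U2 := ind_sub_eq_one.1 (by linarith)
  have hsum : ∀ z, ind U z = ind U1 z + ind U2 z := by
    intro z
    have := hcn z (L a r.snd)
    simp only [ind, if_pos hr, if_neg e1'.2, if_pos e2'.1] at this ⊢
    linarith
  have hmem : ∀ z, (z ∈ U ↔ z ∈ U1 ∨ z ∈ U2) ∧ ¬ (z ∈ U1 ∧ z ∈ U2) := by
    intro z
    have := hsum z
    unfold ind at this
    by_cases h0 : z ∈ U <;> by_cases h1 : z ∈ U1 <;> by_cases h2 : z ∈ U2 <;> simp [h0, h1, h2] at this ⊢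
  have lt1 : U1.ncard < U.ncard := by
    refine Set.ncard_lt_ncard ⟨fun z hz => (hmem z).1.2 (Or.inl hz), fun hsub => e1'.2 (hsub hr)⟩ (Set.toFinite _)
  have lt2 : U2.ncard < U.ncard := by
    refine Set.ncard_lt_ncard ⟨fun z hz => (hmem z).1.2 (Or.inr hz), fun hsub => e2'.2 (hsub ?_)⟩ (Set.toFinite _)
    exact (hmem _).1.2 (Or.inl e1'.1)
  have edge : ∀ (w : G.Walk a b), w.IsPath → ∀ u v, s(u, v) ∈ w.edges → fl w u v = 1 ∨ fl w u v = -1 := by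
    intro w hw u v huv
    have := fl_trail w hw.isTrail u v
    rcases this.1 with h | h | h
    · exact absurd h (this.2 huv)
    · exact Or.inl h
    · exact Or.inr h
  have re : ∀ u v, s(u, v) ∈ r.edges → L u v ∈ U := by
    intro u v huv
    have h0 : fl p u v = 0 := fl_zero p (fun h' => h.pr.edges h' huv)
    have h0' : fl q u v = 0 := fl_zero q (fun h' => h.qr.edges h' huv)
    have h1 := hU1 u v
    have h2 := hU2 u v
    simp only [h0, h0'] at h1 h2
    rw [(hmem _).1]
    rcases edge r h.pr.qp u v huv with h3 | h3
    · right; exact (ind_sub_eq_one.1 (by rw [← h2, h3]; rfl)).1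
    · left; exact (ind_sub_eq_one.1 (by rw [← h1, h3]; rfl)).1
  have pe : ∀ u v, s(u, v) ∈ p.edges → L u v ∉ U2 := by
    intro u v huv
    have h0 : fl r u v = 0 := fl_zero r (h.pr.edges huv)
    have h0' : fl q u v = 0 := fl_zero q (h.pq.edges huv)
    have h1 := hU1 u v
    have h2 := hU2 u v
    simp only [h0, h0'] at h1 h2
    have h2' := ind_sub_eq_zero.1 (h2.symm.trans (sub_zero 0))
    intro hc
    rcases edge p h.pr.pp u v huv with h3 | h3
    · have := (ind_sub_eq_one.1 (by rw [← h1, h3]; rfl)).1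
      exact (hmem _).2 ⟨this, hc⟩
    · have := ((ind_sub_eq_one (U := U1) (x := L v u) (y := L u v)).1 (by linarith)).1
      exact (hmem _).2 ⟨this, h2'.1 hc⟩
  have qe : ∀ u v, s(u, v) ∈ q.edges → L u v ∉ U1 := by
    intro u v huv
    have h0 : fl r u v = 0 := fl_zero r (h.qr.edges huv)
    have h0' : fl p u v = 0 := fl_zero p (fun h' => h.pq.edges h' huv)
    have h1 := hU1 u v
    have h2 := hU2 u v
    simp only [h0, h0'] at h1 h2
    have h2' := ind_sub_eq_zero.1 (h1.symm.trans (sub_zero 0))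
    intro hc
    rcases edge q h.pq.qp u v huv with h3 | h3
    · have := ((ind_sub_eq_one (U := U2) (x := L v u) (y := L u v)).1 (by linarith)).1
      exact (hmem _).2 ⟨h2'.1 hc, this⟩
    · have := ((ind_sub_eq_one (U := U2) (x := L u v) (y := L v u)).1 (by linarith)).1
      exact (hmem _).2 ⟨hc, this⟩
  -- attachments of the component outside the theta graph
  have haT : a ∈ Ts p q r := Or.inl p.start_mem_support
  have hsT : r.snd ∈ Ts p q r := sr _ (r.snd_mem_support_of_mem_edges hfe)
  obtain ⟨s, k, s', k', hne, hs, hs', hk, hk', hsk, hsk'⟩ := C.ce.two_att (Ts p q r) hx C.xy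
    (r.adj_of_mem_edges hfe) (fun h' => h'.mem hx haT) (fun h' => h'.mem hx hsT)
  have hjT : ∀ (W : Set X) (w w' : G.Walk a b), (∀ z ∈ w.support, z ∈ Ts p q r) → (∀ z ∈ w'.support, z ∈ Ts p q r) →
      (∀ u v, fl w u v - fl w' u v = ind W (L u v) - ind W (L v u)) →
      ∀ u v, u ∉ Ts p q r → (L u v ∈ W ↔ L v u ∈ W) := by
    intro W w w' h1 h2 h3 u v hu
    rw [← ind_sub_eq_zero, ← h3, fl_zero w (fun h => hu (h1 _ (w.fst_mem_support_of_mem_edges h))),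
      fl_zero w' (fun h => hu (h2 _ (w'.fst_mem_support_of_mem_edges h))), sub_zero]
  have tr : ∀ (W : Set X) (w w' : G.Walk a b), (∀ z ∈ w.support, z ∈ Ts p q r) → (∀ z ∈ w'.support, z ∈ Ts p q r) →
      (∀ u v, fl w u v - fl w' u v = ind W (L u v) - ind W (L v u)) →
      (L s (cm x y k) ∈ W ↔ L s' (cm x y k') ∈ W) := fun W w w' h1 h2 h3 =>
    side_K C W (Ts p q r) hx hy (hjT W w w' h1 h2 h3) h.linkT hs hs' (hk.mem hx) hsk hsk' (hk.symm.trans hk')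
  have trU := tr U p q sp sq hU
  have hrepc : ∀ u v, fl (p.append q.reverse) u v = ind U (L u v) - ind U (L v u) := fun u v => by
    rw [h.pq.fl_eq, hU]
  have hsub : (Ts p q r)ᶜ ⊆ {z | z ∈ (p.append q.reverse).support}ᶜ := by
    intro z hz hz'
    rw [Set.mem_ofPred_eq, Duo.mem_support] at hz'
    exact hz (hz'.elim Or.inl (fun h => Or.inr (Or.inl h)))
  obtain ⟨t, ht, w, hw, htw, htU⟩ := hK
  have onC : ∀ s k, (s ∈ p.support ∨ s ∈ q.support) → Rch G (Ts p q r)ᶜ x k → G.Adj s k → L s (cm x y k) ∈ U := by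
    intro s k hs hk hsk
    refine (side_K C U {z | z ∈ (p.append q.reverse).support} (hsub hx) (hsub hy) (cycle_hj hrepc)
      (cycle_linkS h.pq.cyc) ((Duo.mem_support s).2 hs) ((Duo.mem_support t).2 ht)
      (hsub (hk.mem hx)) hsk htw ?_).2 htU
    exact (hk.mono le_rfl hsub).symm.trans hw
  have hsU : L s (cm x y k) ∈ U := by
    by_cases h1 : s ∈ p.support ∨ s ∈ q.support
    · exact onC s k h1 hk hsk
    · by_cases h2 : s' ∈ p.support ∨ s' ∈ q.support
      · exact trU.2 (onC s' k' h2 hk' hsk')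
      · push Not at h1
        have e : Ts p r q = Ts p q r := by
          ext z; simp only [Ts]; constructor <;> (rintro (h | h | h) <;> simp [h])
        rw [← e] at hx hy hs hs' hk hk'
        refine (side_int C (p := p) (q := r) (r := q) ⟨h.pr, h.pq, h.qr.symm⟩ hx hy U ?_ hs hs' hne hk hk' hsk hsk'
          h1.1 h1.2 True (fun u v huv => iff_true_intro (re u v huv))).2 trivial
        intro u v h1 h2
        rw [← ind_sub_eq_zero, ← hU, fl_zero p (fun h => h1 (p.fst_mem_support_of_mem_edges h)),
          fl_zero q (fun h => h2 (q.fst_mem_support_of_mem_edges h)), sub_zero]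
  rcases (hmem _).1.1 hsU with h1 | h2
  · exact ⟨_, _, U1, theta1 C h hx hy U1 hU1 qe hs hs' hne hk hk' hsk hsk' h1 ((tr U1 p r sp sr hU1).1 h1), lt1⟩
  · have e := Ts_swap p q r
    have h2' := (tr U2 r q sr sq hU2).1 h2
    rw [← e] at hx hy hs hs' hk hk'
    exact ⟨_, _, U2, theta1 C (p := r) (q := p) (r := q) ⟨h.pr.symm, h.qr.symm, h.pq⟩ hx hy U2 hU2 pe hs hs' hne
      hk hk' hsk hsk' h2 h2', lt2⟩

end theta
end FN


namespace FN
open Classical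
set_option linter.unusedSectionVars false
set_option linter.unusedSimpArgs false
set_option linter.unusedVariables false

universe u
section astar
variable {V : Type u} [Fintype V] {G : SimpleGraph V}
variable {x y : V} {X : Type} {L : V → V → X}

theorem cand_exists (C : Ctx G x y L) {a b : V} {p q r : G.Walk a b} (h : Theta p q r)
    (hx : x ∉ Ts p q r) (hy : y ∉ Ts p q r) :
    ∃ (o : V) (c : G.Walk o o) (U : Set X), Cand L x y c U := by
  -- main case
  have main : ∀ (p q : G.Walk a b), Theta p q r → x ∉ Ts p q r → y ∉ Ts p q r → ∀ (U : Set X),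
      (∀ u v, fl p u v - fl q u v = ind U (L u v) - ind U (L v u)) →
      (∃ s, (s ∈ p.support ∨ s ∈ q.support) ∧ ∃ w, Rch G {z | z ∈ (p.append q.reverse).support}ᶜ x w ∧
      G.Adj s w ∧ L s (cm x y w) ∈ U) → ∃ (o : V) (c : G.Walk o o) (U : Set X), Cand L x y c U := by
    intro p q h hx hy U hU hK
    by_cases hr : L a r.snd ∈ U
    · obtain ⟨o, c, U', hc, _⟩ := theta_step C h hx hy U hU hK hr
      exact ⟨o, c, U', hc⟩
    · have hsub : (Ts p q r)ᶜ ⊆ {z | z ∈ (p.append q.reverse).support}ᶜ := by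
        intro z hz hz'
        rw [Set.mem_ofPred_eq, Duo.mem_support] at hz'
        exact hz (hz'.elim Or.inl (fun h => Or.inr (Or.inl h)))
      obtain ⟨s, hs, w, h1, h2, h3⟩ := hK
      obtain ⟨hf, hfe⟩ := fl_snd h.pr.qp h.pr.ne
      have hsT : r.snd ∈ Ts p q r := Or.inr (Or.inr (r.snd_mem_support_of_mem_edges hfe))
      refine ⟨a, p.append q.reverse, U, h.pq.cyc, hsub hx, hsub hy, fun u v => by rw [h.pq.fl_eq, hU],
        ⟨s, (Duo.mem_support s).2 hs, w, h1, h2, h3⟩,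
        ⟨a, (Duo.mem_support a).2 (Or.inl p.start_mem_support), r.snd, r.adj_of_mem_edges hfe, ?_, ?_⟩⟩
      · rw [Duo.mem_edges]
        rintro (h1 | h1)
        · exact h.pr.edges h1 hfe
        · exact h.qr.edges h1 hfe
      · have hry : r.snd ≠ y := fun h => hy (h ▸ hsT)
        rwa [cm_of_ne hry]
  have e : Ts q p r = Ts p q r := by
    ext z; simp only [Ts]; constructor <;> (rintro (h | h | h) <;> simp [h])
  have hsupp : ∀ u v, fl p u v - fl q u v ≠ 0 → (contr G x y).Adj u v := by
    intro u v huv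
    have : Te p q r u v := by
      by_cases hz : fl p u v = 0
      · exact Or.inr (Or.inl (fl_ne q (fun h => huv (by simp [hz, h]))))
      · exact Or.inl (fl_ne p hz)
    exact contr_adj' this.adj (fun h => hy (h ▸ this.mem)) (fun h => hy (h ▸ this.mem'))
  obtain ⟨U, hU⟩ := cyc_rep C.emb (cycF_duo h.pq) hsupp
  obtain ⟨hf, hfe⟩ := fl_snd h.pq.pp h.pr.ne
  have hxC : x ∉ {z | z ∈ (p.append q.reverse).support} := fun h' =>
    hx (((Duo.mem_support x).1 h').elim Or.inl (fun h => Or.inr (Or.inl h)))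
  have hm1 : a ∈ {z | z ∈ (p.append q.reverse).support} := (Duo.mem_support a).2 (Or.inl p.start_mem_support)
  have hm2 : p.snd ∈ {z | z ∈ (p.append q.reverse).support} :=
    (Duo.mem_support _).2 (Or.inl (p.snd_mem_support_of_mem_edges hfe))
  obtain ⟨s, k, s', k', hne, hs, hs', hk, hk', hsk, hsk'⟩ :=
    C.ce.two_att {z | z ∈ (p.append q.reverse).support} hxC C.xy
    (p.adj_of_mem_edges hfe) (fun h' => h'.mem hxC hm1) (fun h' => h'.mem hxC hm2)
  have hs0 := (Duo.mem_support s).1 hs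
  by_cases hsU : L s (cm x y k) ∈ U
  · exact main p q h hx hy U hU ⟨s, hs0, k, hk, hsk, hsU⟩
  · have e2 : {z | z ∈ (q.append p.reverse).support} = {z | z ∈ (p.append q.reverse).support} := by
      ext z; rw [Set.mem_ofPred_eq, Set.mem_ofPred_eq, Duo.mem_support, Duo.mem_support, or_comm]
    refine main q p ⟨h.pq.symm, h.qr, h.pr⟩ (e ▸ hx) (e ▸ hy) Uᶜ (fun u v => ?_)
      ⟨s, hs0.symm, k, e2 ▸ hk, hsk, hsU⟩
    have := hU u v
    rw [ind_compl, ind_compl]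
    linarith

/-- The main structural lemma. -/
theorem Ce.astar (hG : Ce G) {a b : V} {p q r : G.Walk a b} (h : Theta p q r) (hxy : G.Adj x y) :
    x ∈ Ts p q r ∨ y ∈ Ts p q r := by
  by_contra hcon
  push Not at hcon
  obtain ⟨hx, hy⟩ := hcon
  obtain ⟨X, hX, L, hL, hcn⟩ := (hG.contr hxy).conn
  have C : Ctx G x y L := ⟨hG, hxy, hX, hL, hcn⟩
  have hex : ∃ n, ∃ (o : V) (c : G.Walk o o) (U : Set X), Cand L x y c U ∧ U.ncard = n := by
    obtain ⟨o, c, U, hc⟩ := cand_exists C h hx hy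
    exact ⟨_, o, c, U, hc, rfl⟩
  obtain ⟨o, c, U, hc, hcard⟩ := Nat.find_spec hex
  have hmin : ∀ (o : V) (c : G.Walk o o) (U' : Set X), Cand L x y c U' → ¬ U'.ncard < U.ncard := by
    intro o' c' U' hc' hlt
    exact Nat.find_min hex (hcard ▸ hlt) ⟨o', c', U', hc', rfl⟩
  have hx : x ∉ {z | z ∈ c.support} := hc.hx
  have hy : y ∉ {z | z ∈ c.support} := hc.hy
  let K : Set V := {v | Rch G {z | z ∈ c.support}ᶜ x v}
  have hxK : x ∈ K := Relation.ReflTransGen.refl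
  have hyK : y ∈ K := Relation.ReflTransGen.single ⟨hxy, hx, hy⟩
  have hKc : ∀ v ∈ K, v ∉ c.support := fun v hv => Rch.mem hv hx
  have hKs : ∀ u v, u ∈ K → G.Adj u v → v ∉ c.support → v ∈ K := fun u v hu huv hv => Rch.step hu hx huv hv
  -- everything else is outside
  have claim : ∀ s v, s ∈ c.support → G.Adj s v → s(s, v) ∉ c.edges → v ∉ K → L s v ∉ U := by
    intro s v hs hsv hse hvK hsU
    -- find a good chord path
    have : ∃ t, ∃ ht : t ∈ c.support, s ≠ t ∧ ∃ r : G.Walk s t, r.IsPath ∧ (∀ z ∈ r.support, z ∉ K) ∧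
        (∀ z ∈ r.support, z ∈ c.support → z = s ∨ z = t) ∧ (1 < r.length ∨ s(s, t) ∉ c.edges) ∧ r.snd = v := by
      by_cases hvc : v ∈ c.support
      · refine ⟨v, hvc, hsv.ne, Walk.cons hsv Walk.nil, by simp [hsv.ne], ?_, ?_, Or.inr hse, by simp⟩
        · intro z hz
          simp only [Walk.support_cons, Walk.support_nil, List.mem_cons, List.not_mem_nil, or_false] at hz
          rcases hz with rfl | rfl
          · exact fun h => hKc _ h hs
          · exact fun h => hKc _ h hvc
        · intro z hz _
          simpa using hz
      · have hnx : ∀ k, k ∈ K → ¬ Rch G {z | z ∈ c.support}ᶜ v k := fun k hk h' => hvK (Rch.trans hk h'.symm)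
        obtain ⟨t1, k1, t2, k2, hne, ht1, ht2, hk1, hk2, h1, h2⟩ :=
          hG.two_att {z | z ∈ c.support} hvc hsv.symm hxy (hnx x hxK) (hnx y hyK)
        obtain ⟨t, k, ht, hst, hk, htk⟩ : ∃ t k, t ∈ c.support ∧ s ≠ t ∧ Rch G {z | z ∈ c.support}ᶜ v k ∧ G.Adj t k := by
          by_cases hs1 : s = t1
          · exact ⟨t2, k2, ht2, hs1 ▸ hne, hk2, h2⟩
          · exact ⟨t1, k1, ht1, hs1, hk1, h1⟩
        obtain ⟨w, hw, hws⟩ := hk.path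
        have hwc : ∀ z ∈ w.support, z ∉ c.support := fun z hz => (hws z hz).mem hvc
        have hsup : ∀ z, z ∈ (Walk.cons hsv (w.concat htk.symm)).support ↔ z = s ∨ z ∈ w.support ∨ z = t := by
          intro z; simp [Walk.support_concat]
        refine ⟨t, ht, hst, Walk.cons hsv (w.concat htk.symm), ?_, ?_, ?_, Or.inl (by simp), by simp⟩
        · rw [Walk.cons_isPath_iff, Walk.concat_isPath_iff]
          refine ⟨⟨hw, fun h' => hwc _ h' ht⟩, fun h' => ?_⟩
          rw [Walk.support_concat, List.mem_append, List.mem_singleton] at h'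
          exact h'.elim (fun h' => hwc _ h' hs) hst
        · intro z hz
          rcases (hsup z).1 hz with rfl | hz | rfl
          · exact fun h => hKc _ h hs
          · exact fun h => hnx z h (hws z hz)
          · exact fun h => hKc _ h ht
        · intro z hz hzc
          rcases (hsup z).1 hz with rfl | hz | rfl
          · exact Or.inl rfl
          · exact absurd hzc (hwc z hz)
          · exact Or.inr rfl
    obtain ⟨t, ht, hst, r, hr, hrK, hrd, hrl, hrs⟩ := this
    obtain ⟨p, q, hth, hsup, hedg, hfl, -⟩ := mkTheta hc.cyc hs ht hst r hr hrd hrl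
    have hTs : ∀ z, z ∉ c.support → z ∈ K → z ∉ Ts p q r := by
      intro z hz hzK hzT
      rcases hzT with h | h | h
      · exact hz ((hsup z).2 (Or.inl h))
      · exact hz ((hsup z).2 (Or.inr h))
      · exact hrK z h hzK
    have e : {z | z ∈ (p.append q.reverse).support} = {z | z ∈ c.support} := by
      ext z; rw [Set.mem_ofPred_eq, Set.mem_ofPred_eq, Duo.mem_support, hsup]
    obtain ⟨s', hs', w, hw1, hw2, hw3⟩ := hc.k
    obtain ⟨o', c', U', hc', hlt⟩ := theta_step C hth (hTs x hx hxK) (hTs y hy hyK) U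
      (fun u v => by rw [← hfl, hc.rep]) ⟨s', (hsup s').1 hs', w, e ▸ hw1, hw2, hw3⟩ (by rw [hrs]; exact hsU)
    exact hmin o' c' U' hc' hlt
  -- the two parts
  obtain ⟨R, hR⟩ : ∃ H : SimpleGraph V, ∀ u v, H.Adj u v ↔ G.Adj u v ∧ u ∉ K ∧ v ∉ K :=
    ⟨{ Adj := fun u v => G.Adj u v ∧ u ∉ K ∧ v ∉ K
       symm := ⟨fun u v h => ⟨h.1.symm, h.2.2, h.2.1⟩⟩
       loopless := ⟨fun u h => h.1.ne rfl⟩ }, fun _ _ => Iff.rfl⟩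
  obtain ⟨A, hA⟩ : ∃ H : SimpleGraph V, ∀ u v, H.Adj u v ↔ G.Adj u v ∧ (s(u, v) ∈ c.edges ∨ u ∈ K ∨ v ∈ K) :=
    ⟨{ Adj := fun u v => G.Adj u v ∧ (s(u, v) ∈ c.edges ∨ u ∈ K ∨ v ∈ K)
       symm := ⟨fun u v h => ⟨h.1.symm, h.2.elim (fun h => Or.inl (by rwa [Sym2.eq_swap])) (fun h => Or.inr h.symm)⟩⟩
       loopless := ⟨fun u h => h.1.ne rfl⟩ }, fun _ _ => Iff.rfl⟩
  have hcR : ∀ u v, s(u, v) ∈ c.edges → R.Adj u v := fun u v h => (hR u v).2 ⟨c.adj_of_mem_edges h,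
    fun h' => hKc _ h' (c.fst_mem_support_of_mem_edges h), fun h' => hKc _ h' (c.snd_mem_support_of_mem_edges h)⟩
  have hcA : ∀ u v, s(u, v) ∈ c.edges → A.Adj u v := fun u v h => (hA u v).2 ⟨c.adj_of_mem_edges h, Or.inl h⟩
  have hRG : R ≤ FN.contr G x y := by
    intro u v h
    obtain ⟨h1, h2, h3⟩ := (hR u v).1 h
    exact contr_adj' h1 (fun h => h2 (h ▸ hyK)) (fun h => h3 (h ▸ hyK))
  have hAG : A ≤ G := fun u v h => ((hA u v).1 h).1
  have hcf := cycF_fl hc.cyc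
  obtain ⟨X1, hX1, L1, U1, hE1, hU1⟩ := hL.restrict hRG U (by
    intro u v h
    rw [← ind_sub_eq_zero, ← hc.rep]
    exact fl_zero c (fun h' => h (hcR u v h')))
  obtain ⟨X1', hX1', L1', x1, hE1', hx1⟩ := facial hE1 hcf U1 (by
    intro u v
    rw [hc.rep]
    simp only [ind, hU1]) (by
    intro s v hs hsv hf
    rw [hU1]
    exact claim s v ((mem_Sv_fl hc.cyc).1 hs) ((hR s v).1 hsv).1
      (fun h => (fl_iff hc.cyc.isTrail).2 h hf) ((hR s v).1 hsv).2.2)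
  have gA : Good A := by
    obtain ⟨s, hs, v, hsv, hse, hsU⟩ := hc.o
    obtain ⟨s', hs', w, hw1, hw2, hw3⟩ := hc.k
    refine hG.sub hAG hsv (fun h => ?_)
    rcases ((hA s v).1 h).2 with h | h | h
    · exact hse h
    · exact hKc s h hs
    · exact hsU ((side_K C U {z | z ∈ c.support} hx hy (cycle_hj hc.rep) (cycle_linkS hc.cyc) hs' hs
        (hw1.mem hx) hw2 hsv (hw1.symm.trans h)).1 hw3)
  have ob : OneBr A (fl c) := by
    intro s v s' v' hs hs' hsv hsv' hf hf'
    rw [mem_Sv_fl hc.cyc] at hs hs'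
    right; right
    have key : ∀ s v, s ∈ c.support → A.Adj s v → fl c s v = 0 → v ∈ K := by
      intro s v hs hsv hf
      rcases ((hA s v).1 hsv).2 with h | h | h
      · exact absurd hf ((fl_iff hc.cyc.isTrail).2 h)
      · exact absurd hs (hKc s h)
      · exact h
    have k1 := key s v hs hsv hf
    have k2 := key s' v' hs' hsv' hf'
    rw [mem_Sv_fl hc.cyc, mem_Sv_fl hc.cyc]
    refine ⟨hKc v k1, hKc v' k2, ?_⟩
    have l : ∀ v ∈ K, Link (fun a b => A.Adj a b ∧ a ∉ Sv (fl c) ∧ b ∉ Sv (fl c)) x v := by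
      intro v hv
      induction hv with
      | refl => exact Link.refl _ _
      | @tail b d hb hbd ih =>
        have ih := ih
        refine ih.trans (Link.edge ?_ ?_)
        · rw [mem_Sv_fl hc.cyc, mem_Sv_fl hc.cyc, hA]
          exact ⟨⟨hbd.1, Or.inr (Or.inl hb)⟩, hbd.2.1, hbd.2.2⟩
        · rw [mem_Sv_fl hc.cyc, mem_Sv_fl hc.cyc, hA]
          exact ⟨⟨hbd.1.symm, Or.inr (Or.inr hb)⟩, hbd.2.2, hbd.2.1⟩
    exact (l v k1).symm.trans (l v' k2)
  obtain ⟨X2, hX2, L2, x2, hE2, hx2⟩ := ob.facial gA hcf (fun u v h => hcA u v (fl_ne c h))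
  refine hG.bad (glue hcf (H1 := R) (H2 := A) ?_ (fun u v h => hcR u v (fl_ne c h))
    (fun u v h => hcA u v (fl_ne c h)) ?_ ?_ hE1' hE2.flip x1 x2 hx1 (fun u v h => hx2 v u ?_))
  · intro u v
    rw [hR, hA]
    constructor
    · intro h
      by_cases h1 : u ∈ K
      · exact Or.inr ⟨h, Or.inr (Or.inl h1)⟩
      · by_cases h2 : v ∈ K
        · exact Or.inr ⟨h, Or.inr (Or.inr h2)⟩
        · exact Or.inl ⟨h, h1, h2⟩
    · rintro (h | h) <;> exact h.1
  · intro u v h1 h2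
    rw [fl_iff hc.cyc.isTrail]
    rcases ((hA u v).1 h2).2 with h | h | h
    · exact h
    · exact absurd h ((hR u v).1 h1).2.1
    · exact absurd h ((hR u v).1 h1).2.2
  · intro v a b hv h1 h2
    rw [mem_Sv_fl hc.cyc] at hv
    have hvK := ((hR v a).1 h1).2.1
    rcases ((hA v b).1 h2).2 with h | h | h
    · exact hv (c.fst_mem_support_of_mem_edges h)
    · exact hvK h
    · exact hvK (hKs b v h (hAG h2).symm hv)
  · rw [hcf.anti, h]; rfl

end astar
end FN

namespace FN
open Classical
set_option linter.unusedSectionVars false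
set_option linter.unusedSimpArgs false
set_option linter.unusedVariables false
universe u
section
variable {V : Type u} [Fintype V] {G : SimpleGraph V}

theorem pos_cycle {R : V → V → Prop} (hR : ∀ u v, R u v → G.Adj u v) (has : ∀ u v, R u v → ¬ R v u)
    (hout : ∀ u v, R u v → ∃ w, R v w) (h0 : ∃ u v, R u v) :
    ∃ (o : V) (c : G.Walk o o), c.IsCycle ∧ ∀ d ∈ c.darts, R d.fst d.snd := by
  by_contra hno
  have key : ∀ n : ℕ, ∃ (a b : V) (p : G.Walk a b), p.IsPath ∧ p.length = n ∧
      (∀ d ∈ p.darts, R d.fst d.snd) ∧ ∃ z, R b z := by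
    intro n
    induction n with
    | zero =>
      obtain ⟨u, v, h⟩ := h0
      exact ⟨u, u, Walk.nil, by simp, by simp, by simp, v, h⟩
    | succ n ih =>
      obtain ⟨a, b, p, hp, hl, hd, z, hz⟩ := ih
      by_cases hzp : z ∈ p.support
      · exfalso
        apply hno
        refine ⟨b, Walk.cons (hR _ _ hz) (p.dropUntil z hzp), ?_, ?_⟩
        · rw [Walk.cons_isCycle_iff]
          refine ⟨hp.dropUntil hzp, ?_⟩
          intro he
          have hdr : ∀ d ∈ (p.dropUntil z hzp).darts, R d.fst d.snd := fun d hd' =>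
            hd d (p.darts_dropUntil_subset_darts hzp hd')
          rw [Walk.edges, List.mem_map] at he
          obtain ⟨d, hd1, hd2⟩ := he
          have hR' := hdr d hd1
          rcases Sym2.eq_iff.1 (show s(d.fst, d.snd) = s(b, z) from hd2) with ⟨h1, h2⟩ | ⟨h1, h2⟩
          · have : d.snd ∈ (p.dropUntil z hzp).support.tail := by
              rw [← Walk.map_snd_darts]
              exact List.mem_map_of_mem hd1
            exact path_tail_ne (hp.dropUntil hzp) this h2
          · rw [h1, h2] at hR'
            exact has _ _ hz hR'
        · intro d hd'
          rw [Walk.darts_cons, List.mem_cons] at hd'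
          rcases hd' with rfl | hd'
          · exact hz
          · exact hd d (p.darts_dropUntil_subset_darts hzp hd')
      · refine ⟨a, z, p.concat (hR _ _ hz), hp.concat hzp _, by simp [hl], ?_, hout _ _ hz⟩
        intro d hd'
        rw [Walk.darts_concat, List.concat_eq_append, List.mem_append] at hd'
        rcases hd' with hd' | hd'
        · exact hd d hd'
        · simp at hd'; subst hd'; exact hz
  obtain ⟨a, b, p, hp, hl, _⟩ := key (Fintype.card V)
  have := hp.length_lt
  omega

theorem pos_cycle_circ {f : V → V → ℤ} (hf : IsCirc G f) (h0 : ∃ u v, f u v ≠ 0) :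
    ∃ (o : V) (c : G.Walk o o), c.IsCycle ∧ ∀ d ∈ c.darts, 0 < f d.fst d.snd := by
  apply pos_cycle (R := fun u v => 0 < f u v)
  · intro u v h; exact hf.supp u v (by omega)
  · intro u v h h'; have h2 := hf.anti u v; have h3 : 0 < f u v := h; have h4 : 0 < f v u := h'; omega
  · intro u v h
    by_contra hn
    push Not at hn
    have hle : ∀ w ∈ Finset.univ, f v w ≤ 0 := fun w _ => hn w
    have := (Finset.sum_eq_zero_iff_of_nonpos hle).1 (hf.bal v) u (Finset.mem_univ _)
    have h2 := hf.anti u v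
    omega
  · obtain ⟨u, v, h⟩ := h0
    rcases lt_or_gt_of_ne h with h | h
    · exact ⟨v, u, by have h2 := hf.anti u v; show 0 < f v u; omega⟩
    · exact ⟨u, v, h⟩

theorem Ce.cycle (hG : Ce G) : ∃ (o : V) (c : G.Walk o o), c.IsCycle := by
  by_contra hno
  apply hG.bad
  apply good_of_circ_zero
  intro f hf u v
  by_contra h
  obtain ⟨o, c, hc, _⟩ := pos_cycle_circ hf ⟨u, v, h⟩
  exact hno ⟨o, c, hc⟩

theorem Ce.deg3 (hG : Ce G) {v z : V} (hvz : G.Adj v z) (a b : V) : ∃ w, G.Adj v w ∧ w ≠ a ∧ w ≠ b := by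
  by_contra hno
  push Not at hno
  have hno' : ∃ w, ∀ u, G.Adj v u → u = z ∨ u = w := by
    by_cases hz : z = a
    · exact ⟨b, fun u hu => by
        by_cases h : u = a
        · left; rw [h, hz]
        · right; exact hno u hu h⟩
    · have := hno z hvz hz
      exact ⟨a, fun u hu => by
        by_cases h : u = a
        · right; exact h
        · left; rw [hno u hu h, this]⟩
  obtain ⟨w, hw⟩ := hno'
  by_cases h1 : ∃ w', G.Adj v w' ∧ w' ≠ z
  · obtain ⟨w', hw1, hw2⟩ := h1
    have hww : w' = w := (hw w' hw1).resolve_left hw2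
    subst hww
    apply hG.bad
    have hvzne : z ≠ v := hvz.ne'
    refine good_par (hG.contr hvz.symm) (a := z) (v := v) (b := w') ?_ hvz.ne hw1.ne
      (contr_not_y hvzne) ?_
    · exact ⟨hw2.symm, v, w', cm_y _ _, cm_of_ne hw1.ne', hw1⟩
    · intro u t hut
      by_cases hu : u = v
      · subst hu
        rcases hw t hut with h | h
        · exact Or.inr (Or.inr (Or.inl ⟨rfl, h⟩))
        · exact Or.inr (Or.inr (Or.inr (Or.inr ⟨rfl, h⟩)))
      · by_cases ht : t = v
        · subst ht
          rcases hw u hut.symm with h | h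
          · exact Or.inr (Or.inl ⟨h, rfl⟩)
          · exact Or.inr (Or.inr (Or.inr (Or.inl ⟨h, rfl⟩)))
        · exact Or.inl (contr_adj' hut hu ht)
  · push Not at h1
    obtain ⟨H, hH⟩ : ∃ H : SimpleGraph V, ∀ u t, H.Adj u t ↔ G.Adj u t ∧ u ≠ v ∧ t ≠ v :=
      ⟨{ Adj := fun u t => G.Adj u t ∧ u ≠ v ∧ t ≠ v
         symm := ⟨fun u t h => ⟨h.1.symm, h.2.2, h.2.1⟩⟩
         loopless := ⟨fun u h => h.1.ne rfl⟩ }, fun _ _ => Iff.rfl⟩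
    have hle : H ≤ G := fun u t h => ((hH u t).1 h).1
    have hgd : Good H := hG.sub hle hvz (fun h => ((hH _ _).1 h).2.1 rfl)
    apply hG.bad
    obtain ⟨X, hX, L, hL⟩ := hgd
    refine ⟨X, hX, L, ?_⟩
    refine ⟨fun u t h => hL.na u t (fun h' => h (hle h')), hL.bal, fun f hf => hL.rep f ?_⟩
    have hz0 : ∀ t, f v t = 0 := by
      have hb := hf.bal v
      rw [Finset.sum_eq_single z] at hb
      · intro t
        by_cases ht : t = z
        · rw [ht]; exact hb
        · exact hf.zero_of_not_adj (fun h => ht (h1 t h))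
      · intro t _ ht
        exact hf.zero_of_not_adj (fun h => ht (h1 t h))
      · simp
    refine ⟨hf.anti, fun u t h => (hH u t).2 ⟨hf.supp u t h, ?_, ?_⟩, hf.bal⟩
    · rintro rfl; exact h (hz0 t)
    · rintro rfl; rw [hf.anti, hz0 u] at h; simp at h

end
end FN

namespace FN
open Classical
set_option linter.unusedSectionVars false
set_option linter.unusedSimpArgs false
set_option linter.unusedVariables false
universe u
section
variable {V : Type u} [Fintype V] {G : SimpleGraph V}

theorem Ce.ear (hG : Ce G) {o : V} {c : G.Walk o o} (hc : c.IsCycle) {s t : V} (hs : s ∈ c.support)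
    (ht : t ∈ c.support) (hst : s ≠ t) (r : G.Walk s t) (hr : r.IsPath)
    (hd : ∀ x ∈ r.support, x ∈ c.support → x = s ∨ x = t) (hl : 1 < r.length ∨ s(s, t) ∉ c.edges)
    {x y : V} (hxy : G.Adj x y) (hx : x ∉ c.support) (hy : y ∉ c.support) :
    x ∈ r.support ∨ y ∈ r.support := by
  obtain ⟨p, q, hT, hsup, _⟩ := mkTheta hc hs ht hst r hr hd hl
  have hx' := mt (hsup x).2 hx
  have hy' := mt (hsup y).2 hy
  push Not at hx' hy'
  rcases hG.astar hT hxy with h | h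
  · rcases h with h | h | h
    · exact absurd h hx'.1
    · exact absurd h hx'.2
    · exact Or.inl h
  · rcases h with h | h | h
    · exact absurd h hy'.1
    · exact absurd h hy'.2
    · exact Or.inr h

theorem Ce.earP (hG : Ce G) {o : V} {c : G.Walk o o} (hc : c.IsCycle) {s t k l : V} (hs : s ∈ c.support)
    (ht : t ∈ c.support) (hst : s ≠ t) (p : G.Walk k l) (hp : p.IsPath)
    (hd : ∀ x ∈ p.support, x ∉ c.support) (hsk : G.Adj s k) (htl : G.Adj t l)
    {x y : V} (hxy : G.Adj x y) (hx : x ∉ c.support) (hy : y ∉ c.support) :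
    x ∈ p.support ∨ y ∈ p.support := by
  have htp : t ∉ p.support := fun h => hd t h ht
  have hsp : s ∉ p.support := fun h => hd s h hs
  have hm : ∀ z, z ∈ (Walk.cons hsk (p.concat htl.symm)).support ↔ z = s ∨ z ∈ p.support ∨ z = t := by
    intro z
    simp [Walk.support_concat]
  have := hG.ear hc hs ht hst (Walk.cons hsk (p.concat htl.symm)) ?_ ?_ (Or.inl (by simp)) hxy hx hy
  · rw [hm, hm] at this
    rcases this with (h | h | h) | (h | h | h)
    · exact absurd (h ▸ hs) hx
    · exact Or.inl h
    · exact absurd (h ▸ ht) hx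
    · exact absurd (h ▸ hs) hy
    · exact Or.inr h
    · exact absurd (h ▸ ht) hy
  · rw [Walk.cons_isPath_iff]
    refine ⟨hp.concat htp _, ?_⟩
    simp [Walk.support_concat, hsp, hst]
  · intro z hz hzc
    rw [hm] at hz
    rcases hz with h | h | h
    · exact Or.inl h
    · exact absurd hzc (hd z h)
    · exact Or.inr h

theorem Ce.chordless (hG : Ce G) {o : V} {c : G.Walk o o} (hc : c.IsCycle) {x y : V} (hxy : G.Adj x y)
    (hx : x ∉ c.support) (hy : y ∉ c.support) {s t : V} (hs : s ∈ c.support)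
    (ht : t ∈ c.support) (hst : G.Adj s t) : s(s, t) ∈ c.edges := by
  by_contra hn
  have := hG.ear hc hs ht hst.ne (Walk.cons hst Walk.nil) (by simp [hst.ne]) (by simp) (Or.inr hn) hxy hx hy
  simp only [Walk.support_cons, Walk.support_nil, List.mem_cons, List.not_mem_nil, or_false] at this
  rcases this with (h | h) | (h | h)
  · exact hx (h ▸ hs)
  · exact hx (h ▸ ht)
  · exact hy (h ▸ hs)
  · exact hy (h ▸ ht)

theorem Ce.conn_out (hG : Ce G) {o : V} {c : G.Walk o o} (hc : c.IsCycle) {x y : V} (hxy : G.Adj x y)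
    (hx : x ∉ c.support) (hy : y ∉ c.support) {k z : V} (hk : k ∉ c.support) (hkz : G.Adj k z) :
    Rch G {z | z ∈ c.support}ᶜ x k := by
  by_contra hn
  have hn1 : ¬ Rch G {z | z ∈ c.support}ᶜ k x := fun h => hn h.symm
  have hn2 : ¬ Rch G {z | z ∈ c.support}ᶜ k y := fun h => hn1 (h.step hk hxy.symm hx)
  obtain ⟨s, k1, s', k2, hss, hs, hs', hk1, hk2, ha, ha'⟩ :=
    hG.two_att {z | z ∈ c.support} hk hkz hxy hn1 hn2
  obtain ⟨p, hp, hpr⟩ := (hk1.symm.trans hk2).path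
  have := hG.earP hc hs hs' hss p hp (fun z hz => (hpr z hz).mem (hk1.mem hk)) ha ha' hxy hx hy
  rcases this with h | h
  · exact hn1 (hk1.trans (hpr x h))
  · exact hn2 (hk1.trans (hpr y h))

theorem cyc_nbrs {o : V} {c : G.Walk o o} (hc : c.IsCycle) {s : V} (hs : s ∈ c.support) :
    ∃ a b, a ≠ b ∧ s(s, a) ∈ c.edges ∧ s(s, b) ∈ c.edges ∧ ∀ z, s(s, z) ∈ c.edges → z = a ∨ z = b := by
  have h := hc.ncard_neighborSet_toSubgraph_eq_two hs
  rw [Set.ncard_eq_two] at h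
  obtain ⟨a, b, hab, he⟩ := h
  have hm : ∀ z, s(s, z) ∈ c.edges ↔ z = a ∨ z = b := by
    intro z
    rw [← Walk.adj_toSubgraph_iff_mem_edges, ← Subgraph.mem_neighborSet, he]
    simp
  exact ⟨a, b, hab, (hm a).2 (Or.inl rfl), (hm b).2 (Or.inr rfl), fun z => (hm z).1⟩

theorem Ce.att (hG : Ce G) {o : V} {c : G.Walk o o} (hc : c.IsCycle) {x y : V} (hxy : G.Adj x y)
    (hx : x ∉ c.support) (hy : y ∉ c.support) {s : V} (hs : s ∈ c.support) :
    ∃ k, k ∉ c.support ∧ G.Adj s k := by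
  obtain ⟨a, b, hab, ha, hb, hz⟩ := cyc_nbrs hc hs
  obtain ⟨w, hw, hwa, hwb⟩ := hG.deg3 (c.adj_of_mem_edges ha) a b
  refine ⟨w, fun hwc => ?_, hw⟩
  rcases hz w (hG.chordless hc hxy hx hy hs hwc hw) with h | h
  · exact hwa h
  · exact hwb h

theorem Ce.two (hG : Ce G) {o : V} {c : G.Walk o o} (hc : c.IsCycle) {x y : V} (hxy : G.Adj x y)
    (hx : x ∉ c.support) (hy : y ∉ c.support) {k s t : V} (hk : k ∉ c.support) (hs : s ∈ c.support)
    (ht : t ∈ c.support) (hst : s ≠ t) (hks : G.Adj k s) (hkt : G.Adj k t) : k = x ∨ k = y := by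
  have := hG.earP hc hs ht hst (Walk.nil : G.Walk k k) (by simp) (by simpa using hk) hks.symm hkt.symm
    hxy hx hy
  simpa [eq_comm] using this

def OB (G : SimpleGraph V) {o : V} (c : G.Walk o o) (B : V → V → Prop) : Prop :=
  ∀ s v s' v', s ∈ c.support → s' ∈ c.support → G.Adj s v → G.Adj s' v' → B s v → B s' v' →
    s(s, v) ∉ c.edges → s(s', v') ∉ c.edges →
    (s' = s ∧ v' = v) ∨ (s' = v ∧ v' = s) ∨
    (v ∉ c.support ∧ v' ∉ c.support ∧
      Link (fun a b => (G.Adj a b ∧ B a b) ∧ a ∉ c.support ∧ b ∉ c.support) v v')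

theorem OB.one {o : V} {c : G.Walk o o} (hc : c.IsCycle) {B : V → V → Prop} (hB : OB G c B)
    {H : SimpleGraph V} (hH : ∀ u v, H.Adj u v ↔ G.Adj u v ∧ (s(u, v) ∈ c.edges ∨ B u v)) :
    OneBr H (fl c) := by
  intro s v s' v' hs hs' h1 h2 h3 h4
  have he : ∀ u v, fl c u v = 0 → s(u, v) ∉ c.edges := fun u v h h' => (fl_iff hc.isTrail).2 h' h
  rw [mem_Sv_fl hc] at hs hs'
  have h1' := (hH _ _).1 h1
  have h2' := (hH _ _).1 h2
  rcases hB s v s' v' hs hs' h1'.1 h2'.1 (h1'.2.resolve_left (he _ _ h3)) (h2'.2.resolve_left (he _ _ h4))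
    (he _ _ h3) (he _ _ h4) with h | h | ⟨h5, h6, h7⟩
  · exact Or.inl h
  · exact Or.inr (Or.inl h)
  · refine Or.inr (Or.inr ⟨mt (mem_Sv_fl hc).1 h5, mt (mem_Sv_fl hc).1 h6, h7.mono ?_⟩)
    rintro a b ⟨⟨h8, h9⟩, h10, h11⟩
    exact ⟨(hH _ _).2 ⟨h8, Or.inr h9⟩, mt (mem_Sv_fl hc).1 h10, mt (mem_Sv_fl hc).1 h11⟩

theorem Ce.two_br (hG : Ce G) {o : V} {c : G.Walk o o} (hc : c.IsCycle) {B : V → V → Prop}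
    (hBs : ∀ u v, B u v → B v u)
    {x y : V} (hxy : G.Adj x y) (hxyB : B x y) (hxyc : s(x, y) ∉ c.edges)
    {x' y' : V} (hxy' : G.Adj x' y') (hxyB' : ¬ B x' y') (hxyc' : s(x', y') ∉ c.edges)
    (hsep : ∀ v a b, v ∉ c.support → G.Adj v a → G.Adj v b → B v a → B v b)
    (h1 : OB G c B) (h2 : OB G c (fun u v => ¬ B u v)) : False := by
  obtain ⟨H1, hH1⟩ : ∃ H : SimpleGraph V, ∀ u v, H.Adj u v ↔ G.Adj u v ∧ (s(u, v) ∈ c.edges ∨ B u v) :=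
    ⟨{ Adj := fun u v => G.Adj u v ∧ (s(u, v) ∈ c.edges ∨ B u v)
       symm := ⟨fun u v h => ⟨h.1.symm, h.2.imp (fun h => Sym2.eq_swap ▸ h) (hBs u v)⟩⟩
       loopless := ⟨fun u h => h.1.ne rfl⟩ }, fun _ _ => Iff.rfl⟩
  obtain ⟨H2, hH2⟩ : ∃ H : SimpleGraph V, ∀ u v, H.Adj u v ↔ G.Adj u v ∧ (s(u, v) ∈ c.edges ∨ ¬ B u v) :=
    ⟨{ Adj := fun u v => G.Adj u v ∧ (s(u, v) ∈ c.edges ∨ ¬ B u v)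
       symm := ⟨fun u v h => ⟨h.1.symm, h.2.imp (fun h => Sym2.eq_swap ▸ h) (mt (hBs v u))⟩⟩
       loopless := ⟨fun u h => h.1.ne rfl⟩ }, fun _ _ => Iff.rfl⟩
  have e1 : ∀ u v, fl c u v ≠ 0 → s(u, v) ∈ c.edges := fun u v h => fl_ne c h
  have hmem : ∀ u v, s(u, v) ∈ c.edges → u ∈ c.support := fun u v h => c.fst_mem_support_of_mem_edges h
  apply hG.bad
  refine glueB (H1 := H1) (H2 := H2) (cycF_fl hc) ?_ ?_ ?_ ?_ ?_ ?_ ?_ (h1.one hc hH1) (h2.one hc hH2)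
  · intro u v
    rw [hH1, hH2]
    by_cases h : B u v <;> simp [h] <;> (intro h2 _; exact h2)
  · intro u v h
    exact (hH1 u v).2 ⟨c.adj_of_mem_edges (e1 u v h), Or.inl (e1 u v h)⟩
  · intro u v h
    exact (hH2 u v).2 ⟨c.adj_of_mem_edges (e1 u v h), Or.inl (e1 u v h)⟩
  · intro u v h h'
    rw [fl_iff hc.isTrail]
    rcases ((hH1 u v).1 h).2 with h3 | h3
    · exact h3
    · exact ((hH2 u v).1 h').2.resolve_right (fun h4 => h4 h3)
  · intro v a b hv h h'
    rw [mem_Sv_fl hc] at hv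
    obtain ⟨h3, h4⟩ := (hH1 _ _).1 h
    obtain ⟨h5, h6⟩ := (hH2 _ _).1 h'
    exact h6.resolve_left (fun h => hv (hmem _ _ h)) (hsep v a b hv h3 h5 (h4.resolve_left (fun h => hv (hmem _ _ h))))
  · exact hG.sub (fun u v h => ((hH1 u v).1 h).1) hxy' (fun h => ((hH1 _ _).1 h).2.elim hxyc' hxyB')
  · exact hG.sub (fun u v h => ((hH2 u v).1 h).1) hxy (fun h => ((hH2 _ _).1 h).2.elim hxyc (fun h => h hxyB))

end
end FN

namespace FN
open Classical
set_option linter.unusedSectionVars false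
set_option linter.unusedSimpArgs false
set_option linter.unusedVariables false
universe u
section
variable {V : Type u} [Fintype V] {G : SimpleGraph V}

theorem Duo.mk2 {a b i : V} {p : G.Walk a b} (hp : p.IsPath) (hab : a ≠ b) (hi : i ∉ p.support)
    (hai : G.Adj a i) (hib : G.Adj i b) : Duo p (Walk.cons hai (Walk.cons hib Walk.nil)) := by
  refine ⟨hab, hp, ?_, ?_, Or.inr (by simp)⟩
  · simp [Walk.cons_isPath_iff, hai.ne, hib.ne, hab]
  · intro x hx hx'
    simp only [Walk.support_cons, Walk.support_nil, List.mem_cons, List.not_mem_nil, or_false] at hx'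
    rcases hx' with h | h | h
    · exact Or.inl h
    · exact absurd (h ▸ hx) hi
    · exact Or.inr h

theorem Duo.mk1 {a b : V} {p : G.Walk a b} (hp : p.IsPath) (hab : G.Adj a b) (hl : 1 < p.length) :
    Duo p (Walk.cons hab Walk.nil) := by
  refine ⟨hab.ne, hp, by simp [Walk.cons_isPath_iff, hab.ne], ?_, Or.inl hl⟩
  intro x hx hx'
  simpa using hx'

/-- no cycle has an edge disjoint from it -/
def NoOut (G : SimpleGraph V) : Prop :=
  ∀ (o : V) (c : G.Walk o o), c.IsCycle → ∀ x y, G.Adj x y → x ∈ c.support ∨ y ∈ c.support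

theorem NoOut.duo (hN : NoOut G) {a b : V} {p q : G.Walk a b} (h : Duo p q) {x y : V} (hxy : G.Adj x y) :
    (x ∈ p.support ∨ x ∈ q.support) ∨ (y ∈ p.support ∨ y ∈ q.support) := by
  have := hN _ _ h.cyc x y hxy
  rwa [Duo.mem_support, Duo.mem_support] at this

theorem NoOut.tri (hN : NoOut G) {a b d : V} (hab : G.Adj a b) (hbd : G.Adj b d) (had : G.Adj a d)
    {x y : V} (hxy : G.Adj x y) : (x = a ∨ x = b ∨ x = d) ∨ (y = a ∨ y = b ∨ y = d) := by
  have h : Duo (Walk.cons had Walk.nil) (Walk.cons hab (Walk.cons hbd Walk.nil)) :=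
    Duo.mk2 (by simp [Walk.cons_isPath_iff, had.ne]) had.ne (by simp [hab.ne', hbd.ne]) hab hbd
  have := hN.duo h hxy
  simp only [Walk.support_cons, Walk.support_nil, List.mem_cons, List.not_mem_nil, or_false] at this
  rcases this with ((h | h) | h) | ((h | h) | h)
  · exact Or.inl (Or.inl h)
  · exact Or.inl (Or.inr (Or.inr h))
  · exact Or.inl h
  · exact Or.inr (Or.inl h)
  · exact Or.inr (Or.inr (Or.inr h))
  · exact Or.inr h

theorem mid1 {a b d : V} {q : G.Walk a b} (hq : q.IsPath)
    (hn : ∀ x y, G.Adj x y → x ∈ q.support → y ∈ q.support → x = a ∨ x = b ∨ y = a ∨ y = b)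
    (hd : d ∈ q.support) (hda : d ≠ a) (hdb : d ≠ b) : G.Adj a d := by
  have hnn : ¬ (q.takeUntil d hd).Nil := fun h => hda h.eq.symm
  have hadj := (q.takeUntil d hd).adj_penultimate hnn
  have hm : (q.takeUntil d hd).penultimate ∈ (q.takeUntil d hd).support := Walk.getVert_mem_support _ _
  have hm2 := q.support_takeUntil_subset_support hd hm
  rcases hn _ _ hadj hm2 hd with h | h | h | h
  · rwa [h] at hadj
  · rw [h] at hm
    exact absurd hm (Walk.endpoint_notMem_support_takeUntil hq hd hdb.symm)
  · exact absurd h hda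
  · exact absurd h hdb

theorem mid2 {a b d : V} {q : G.Walk a b} (hq : q.IsPath)
    (hn : ∀ x y, G.Adj x y → x ∈ q.support → y ∈ q.support → x = a ∨ x = b ∨ y = a ∨ y = b)
    (hd : d ∈ q.support) (hda : d ≠ a) (hdb : d ≠ b) : G.Adj a d ∧ G.Adj d b := by
  refine ⟨mid1 hq hn hd hda hdb, (mid1 (q := q.reverse) hq.reverse ?_ (by simpa using hd) hdb hda).symm⟩
  intro x y hxy hx hy
  simp only [Walk.support_reverse, List.mem_reverse] at hx hy
  rcases hn x y hxy hx hy with h | h | h | h <;> simp [h]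

theorem Ce.fin4 (hG : Ce G) (hN : NoOut G) {a b d i : V} (hdi : G.Adj d i) (had : G.Adj a d)
    (hai : G.Adj a i) (hbd : G.Adj b d) (hbi : G.Adj b i) (hab : a ≠ b) : False := by
  have hz : ∀ z w, G.Adj z w → z = a ∨ z = b ∨ z = d ∨ z = i := by
    intro z w hzw
    by_contra hn
    push Not at hn
    obtain ⟨h1, h2, h3, h4⟩ := hn
    obtain ⟨t, ht, htd, hti⟩ := hG.deg3 hzw d i
    have e1 := hN.tri had hdi hai ht
    have e2 := hN.tri hbd hdi hbi ht
    simp only [h1, h2, h3, h4, htd, hti, or_false, false_or] at e1 e2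
    exact hab (e1 ▸ e2)
  obtain ⟨w, haw, hwd, hwi⟩ := hG.deg3 had d i
  have hwb : w = b := by
    rcases hz w a haw.symm with h | h | h | h
    · exact absurd h haw.ne'
    · exact h
    · exact absurd h hwd
    · exact absurd h hwi
  subst hwb
  have hD : Duo (Walk.cons had (Walk.cons hbd.symm Walk.nil)) (Walk.cons hai (Walk.cons hbi.symm Walk.nil)) := by
    refine Duo.mk2 (by simp [Walk.cons_isPath_iff, had.ne, hab, hbd.ne']) hab ?_ hai hbi.symm
    simp [hai.ne', hdi.ne', hbi.ne']
  obtain ⟨c, hcc, hcs, hce⟩ : ∃ c : G.Walk a a, c.IsCycle ∧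
      (∀ z, z ∈ c.support ↔ z = a ∨ z = w ∨ z = d ∨ z = i) ∧
      (∀ u v, s(u, v) ∈ c.edges ↔ s(u, v) = s(a, d) ∨ s(u, v) = s(d, w) ∨ s(u, v) = s(a, i) ∨ s(u, v) = s(i, w)) := by
    refine ⟨_, hD.cyc, ?_, ?_⟩
    · intro z
      rw [Duo.mem_support]
      simp only [Walk.support_cons, Walk.support_nil, List.mem_cons, List.not_mem_nil, or_false]
      constructor
      · rintro ((h | h | h) | (h | h | h)) <;> simp [h]
      · rintro (h | h | h | h) <;> simp [h]
    · intro u v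
      rw [Duo.mem_edges]
      simp only [Walk.edges_cons, Walk.edges_nil, List.mem_cons, List.not_mem_nil, or_false, or_assoc]
  refine hG.two_br hcc (B := fun u v => (u = a ∧ v = w) ∨ (u = w ∧ v = a)) ?_ haw (Or.inl ⟨rfl, rfl⟩) ?_
    hdi ?_ ?_ ?_ ?_ ?_
  · rintro u v (⟨h, h'⟩ | ⟨h, h'⟩)
    · exact Or.inr ⟨h', h⟩
    · exact Or.inl ⟨h', h⟩
  · rw [hce]
    simp only [Sym2.eq_iff]
    have := haw.ne; have := had.ne; have := hai.ne
    grind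
  · have := hdi.ne; have := had.ne; have := hai.ne
    grind
  · rw [hce]
    simp only [Sym2.eq_iff]
    have := hdi.ne; have := had.ne; have := hai.ne; have := hbd.ne; have := hbi.ne
    grind
  · intro v s t hv hs
    exact absurd ((hcs v).2 (hz v _ hs)) hv
  · intro s v s' v' _ _ _ _ h1 h2 _ _
    rcases h1 with ⟨rfl, rfl⟩ | ⟨rfl, rfl⟩ <;> rcases h2 with ⟨rfl, rfl⟩ | ⟨rfl, rfl⟩ <;> simp
  · have key : ∀ s v, G.Adj s v → ¬ ((s = a ∧ v = w) ∨ (s = w ∧ v = a)) → s(s, v) ∉ c.edges →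
        (s = d ∧ v = i) ∨ (s = i ∧ v = d) := by
      intro s v h1 h2 h3
      rw [hce] at h3
      simp only [Sym2.eq_iff] at h3
      have e1 := hz s v h1
      have e2 := hz v s h1.symm
      have e3 := h1.ne
      grind
    intro s v s' v' _ _ h1 h2 h3 h4 h5 h6
    rcases key s v h1 h3 h5 with ⟨rfl, rfl⟩ | ⟨rfl, rfl⟩ <;>
      rcases key s' v' h2 h4 h6 with ⟨rfl, rfl⟩ | ⟨rfl, rfl⟩ <;> simp

theorem NoOut.mid (hN : NoOut G) {a b : V} {p q r : G.Walk a b} (h : Duo p q) (hpr : Duo p r)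
    (hr : ∀ z ∈ r.support, z ∈ q.support → z = a ∨ z = b) {d : V}
    (hd : d ∈ q.support) (hda : d ≠ a) (hdb : d ≠ b) : G.Adj a d ∧ G.Adj d b := by
  refine mid2 h.qp ?_ hd hda hdb
  intro x y hxy hx hy
  have hh : ∀ z, z ∈ q.support → (z ∈ p.support ∨ z ∈ r.support) → z = a ∨ z = b := by
    rintro z hz (h1 | h1)
    · exact h.dis z h1 hz
    · exact hr z h1 hz
  rcases hN.duo hpr hxy with h1 | h1
  · rcases hh x hx h1 with h2 | h2 <;> simp [h2]
  · rcases hh y hy h1 with h2 | h2 <;> simp [h2]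

theorem path_int {a b : V} {p : G.Walk a b} (hp : p.IsPath) (hab : a ≠ b) (h : s(a, b) ∉ p.edges) :
    ∃ d ∈ p.support, d ≠ a ∧ d ≠ b := by
  have hnn : ¬ p.Nil := fun h => hab h.eq
  have h1 := (fl_snd hp hab).2
  refine ⟨p.snd, p.snd_mem_support_of_mem_edges h1, ?_, ?_⟩
  · exact (p.adj_snd hnn).ne'
  · intro h2; rw [h2] at h1; exact h h1

theorem path_len {a b : V} {p : G.Walk a b} (hab : a ≠ b) (h : s(a, b) ∉ p.edges) : 1 < p.length := by
  cases p with
  | nil => exact absurd rfl hab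
  | cons h1 p' => cases p' with
    | nil => simp at h
    | cons h2 p'' => simp

theorem Ce.caseI (hG : Ce G) (hN : NoOut G) : False := by
  obtain ⟨o, c, hc⟩ := hG.cycle
  by_cases hi : ∃ i z, i ∉ c.support ∧ G.Adj i z
  · obtain ⟨i, a, hi, hia⟩ := hi
    have hnb : ∀ z, G.Adj i z → z ∈ c.support := fun z hz => (hN _ c hc i z hz).resolve_left hi
    obtain ⟨b, hib, hba, _⟩ := hG.deg3 hia a a
    obtain ⟨d, hid, hda, hdb⟩ := hG.deg3 hia a b
    have core : ∀ p q : G.Walk a b, Duo p q → i ∉ p.support → i ∉ q.support → d ∈ q.support → False := by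
      intro p q h hip hiq hdq
      obtain ⟨h1, h2⟩ := hN.mid h (Duo.mk2 h.pp hba.symm hip hia.symm hib) (by
        intro z hz hzq
        simp only [Walk.support_cons, Walk.support_nil, List.mem_cons, List.not_mem_nil, or_false] at hz
        rcases hz with h | h | h
        · exact Or.inl h
        · exact absurd (h ▸ hzq) hiq
        · exact Or.inr h) hdq hda hdb
      exact hG.fin4 hN hid.symm h1 hia.symm h2.symm hib.symm hba.symm
    obtain ⟨p, q, hD, hsup, _⟩ := cycle_split hc (hnb a hia) (hnb b hib) hba.symm
    have hi' := mt (hsup i).2 hi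
    push Not at hi'
    rcases (hsup d).1 (hnb d hid) with h | h
    · exact core q p hD.symm hi'.2 hi'.1 h
    · exact core p q hD hi'.1 hi'.2 h
  · push Not at hi
    have ho : o ∈ c.support := c.start_mem_support
    obtain ⟨a, b, hab, ha, hb, hz⟩ := cyc_nbrs hc ho
    obtain ⟨w, how, hwa, hwb⟩ := hG.deg3 (c.adj_of_mem_edges ha) a b
    have hwc : w ∈ c.support := by
      by_contra h
      exact hi w o h how.symm
    have hne : s(o, w) ∉ c.edges := fun h => (hz w h).elim hwa hwb
    obtain ⟨p, q, hD, hsup, hed, _⟩ := cycle_split hc ho hwc how.ne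
    have hne' := mt (hed _).2 hne
    push Not at hne'
    obtain ⟨u, hu, huo, huw⟩ := path_int hD.pp how.ne hne'.1
    obtain ⟨v, hv, hvo, hvw⟩ := path_int hD.qp how.ne hne'.2
    have hr : ∀ (q : G.Walk o w), ∀ z ∈ (Walk.cons how Walk.nil).support, z ∈ q.support → z = o ∨ z = w := by
      intro q z hz _
      simpa using hz
    obtain ⟨h1, h2⟩ := hN.mid hD (Duo.mk1 hD.pp how (path_len how.ne hne'.1)) (hr q) hv hvo hvw
    obtain ⟨h3, h4⟩ := hN.mid hD.symm (Duo.mk1 hD.qp how (path_len how.ne hne'.2)) (hr p) hu huo huw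
    refine hG.fin4 hN how h1.symm h2 h3.symm h4 ?_
    rintro rfl
    exact (hD.dis v hu hv).elim hvo hvw

end
end FN

namespace FN
open Classical
set_option linter.unusedSectionVars false
set_option linter.unusedSimpArgs false
set_option linter.unusedVariables false
universe u
section
variable {V : Type u} [Fintype V] {G : SimpleGraph V}

/-- no vertex off a cycle having an outside edge sees the cycle twice -/
def NoTwo (G : SimpleGraph V) : Prop :=
  ∀ (o : V) (c : G.Walk o o), c.IsCycle → ∀ x y, G.Adj x y → x ∉ c.support → y ∉ c.support →
    ∀ k s t, k ∉ c.support → s ∈ c.support → t ∈ c.support → s ≠ t → G.Adj k s → G.Adj k t → False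

theorem Ce.noedge (hG : Ce G) (hP : NoTwo G) {o : V} {c : G.Walk o o} (hc : c.IsCycle) {x y : V}
    (hxy : G.Adj x y) (hx : x ∉ c.support) (hy : y ∉ c.support) {c1 c2 k1 k2 : V}
    (he : s(c1, c2) ∈ c.edges) (hk : k1 ≠ k2) (h1 : G.Adj c1 k1) (h2 : G.Adj c2 k2)
    (P : G.Walk k1 k2) (hPp : P.IsPath) (hPc : ∀ z ∈ P.support, z ∉ c.support) {u v : V} (huv : G.Adj u v) :
    (u = c1 ∨ u = c2 ∨ u ∈ P.support) ∨ (v = c1 ∨ v = c2 ∨ v ∈ P.support) := by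
  by_contra hn
  have h12 : G.Adj c1 c2 := c.adj_of_mem_edges he
  have hc1 : c1 ∈ c.support := c.fst_mem_support_of_mem_edges he
  have hc2 : c2 ∈ c.support := c.snd_mem_support_of_mem_edges he
  have hc1P : c1 ∉ P.support := fun h => hPc _ h hc1
  have hc2P : c2 ∉ P.support := fun h => hPc _ h hc2
  have hk1P : k1 ∈ P.support := P.start_mem_support
  have hk2P : k2 ∈ P.support := P.end_mem_support
  have hk1c := hPc _ hk1P
  have hk2c := hPc _ hk2P
  have hD : Duo (Walk.cons h1 (P.concat h2.symm)) (Walk.cons h12 Walk.nil) := by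
    refine Duo.mk1 ?_ h12 (by simp)
    rw [Walk.cons_isPath_iff]
    refine ⟨hPp.concat hc2P _, ?_⟩
    simp [Walk.support_concat, hc1P, h12.ne]
  obtain ⟨C, hCc, hCs, hCe⟩ : ∃ C : G.Walk c1 c1, C.IsCycle ∧
      (∀ z, z ∈ C.support ↔ z = c1 ∨ z = c2 ∨ z ∈ P.support) ∧
      (∀ e, e ∈ C.edges ↔ e = s(c1, k1) ∨ e ∈ P.edges ∨ e = s(k2, c2) ∨ e = s(c1, c2)) := by
    refine ⟨_, hD.cyc, ?_, ?_⟩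
    · intro z
      rw [Duo.mem_support]
      simp only [Walk.support_cons, Walk.support_concat, Walk.support_nil, List.mem_cons, List.not_mem_nil,
        or_false, List.concat_eq_append, List.mem_append]
      constructor
      · rintro ((h | h | h) | (h | h)) <;> simp [h]
      · rintro (h | h | h) <;> simp [h]
    · intro e
      rw [Duo.mem_edges]
      simp only [Walk.edges_cons, Walk.edges_concat, Walk.edges_nil, List.mem_cons, List.not_mem_nil,
        or_false, List.concat_eq_append, List.mem_append, or_assoc]
  push Not at hn
  have hu : u ∉ C.support := by rw [hCs]; simp [hn.1]
  have hv : v ∉ C.support := by rw [hCs]; simp [hn.2]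
  obtain ⟨w, hw, hw1, hw2⟩ := hG.deg3 h1.symm c1 P.snd
  have hwc : w ∉ c.support := fun h =>
    hP o c hc x y hxy hx hy k1 c1 w hk1c hc1 h hw1.symm h1.symm hw
  by_cases hwP : w ∈ P.support
  · have := hG.chordless hCc huv hu hv ((hCs k1).2 (Or.inr (Or.inr hk1P))) ((hCs w).2 (Or.inr (Or.inr hwP))) hw
    rw [hCe] at this
    rcases this with h | h | h | h
    · rcases Sym2.eq_iff.1 h with ⟨h3, h4⟩ | ⟨h3, h4⟩
      · exact h1.ne h3.symm
      · exact hw1 h4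
    · exact hw2 (hPp.eq_snd_of_mem_edges h)
    · rcases Sym2.eq_iff.1 h with ⟨h3, h4⟩ | ⟨h3, h4⟩
      · exact hk h3
      · exact hk1c (h3 ▸ hc2)
    · rcases Sym2.eq_iff.1 h with ⟨h3, h4⟩ | ⟨h3, h4⟩
      · exact hk1c (h3 ▸ hc1)
      · exact hk1c (h3 ▸ hc2)
  · have hwC : w ∉ C.support := by
      rw [hCs]
      rintro (h | h | h)
      · exact hw1 h
      · exact hwc (h ▸ hc2)
      · exact hwP h
    have hnb : ∀ t, G.Adj w t → t ∉ c.support → t ∈ P.support := by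
      intro t ht htc
      exact (hG.earP hc hc1 hc2 h12.ne P hPp hPc h1 h2 ht hwc htc).resolve_left hwP
    have hone : ∀ t, G.Adj w t → t ≠ k1 → t ∈ c.support := by
      intro t ht htk
      by_contra htc
      have := hnb t ht htc
      exact hP _ C hCc u v huv hu hv w k1 t hwC ((hCs _).2 (Or.inr (Or.inr hk1P)))
        ((hCs _).2 (Or.inr (Or.inr this))) htk.symm hw.symm ht
    obtain ⟨t1, ht1, ht1k, _⟩ := hG.deg3 hw.symm k1 k1
    obtain ⟨t2, ht2, ht2k, ht12⟩ := hG.deg3 hw.symm k1 t1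
    exact hP o c hc x y hxy hx hy w t1 t2 hwc (hone t1 ht1 ht1k) (hone t2 ht2 ht2k) ht12.symm ht1 ht2

theorem Ce.caseII (hG : Ce G) (hP : NoTwo G) : False := by
  apply hG.caseI
  intro o c hc x y hxy
  by_contra hn
  push Not at hn
  obtain ⟨hx, hy⟩ := hn
  have ho : o ∈ c.support := c.start_mem_support
  obtain ⟨a, b, hab, ha, hb, _⟩ := cyc_nbrs hc ho
  have hoa := c.adj_of_mem_edges ha
  have hob := c.adj_of_mem_edges hb
  have hac := c.snd_mem_support_of_mem_edges ha
  have hbc := c.snd_mem_support_of_mem_edges hb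
  obtain ⟨ko, hko, hoko⟩ := hG.att hc hxy hx hy ho
  obtain ⟨ka, hka, haka⟩ := hG.att hc hxy hx hy hac
  obtain ⟨kb, hkb, hbkb⟩ := hG.att hc hxy hx hy hbc
  have d1 : ko ≠ ka := by
    rintro rfl
    exact hP o c hc x y hxy hx hy ko o a hko ho hac hoa.ne hoko.symm haka.symm
  have d2 : ko ≠ kb := by
    rintro rfl
    exact hP o c hc x y hxy hx hy ko o b hko ho hbc hob.ne hoko.symm hbkb.symm
  have d3 : ka ≠ kb := by
    rintro rfl
    exact hP o c hc x y hxy hx hy ka a b hka hac hbc hab haka.symm hbkb.symm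
  have r1 := hG.conn_out hc hxy hx hy hko hoko.symm
  have r2 := hG.conn_out hc hxy hx hy hkb hbkb.symm
  obtain ⟨P, hPp, hPr⟩ := (r1.symm.trans r2).path
  have hPc : ∀ z ∈ P.support, z ∉ c.support := fun z hz => (hPr z hz).mem hko
  have hkaP : ka ∈ P.support := by
    rcases hG.noedge hP hc hxy hx hy hb d2 hoko hbkb P hPp hPc haka with (h | h | h) | (h | h | h)
    · exact absurd h hoa.ne'
    · exact absurd h hab
    · exact absurd hac (hPc _ h)
    · exact absurd (h ▸ ho) hka
    · exact absurd (h ▸ hbc) hka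
    · exact h
  rcases hG.noedge hP hc hxy hx hy ha d1 hoko haka (P.takeUntil ka hkaP) (hPp.takeUntil _)
    (fun z hz => hPc z (P.support_takeUntil_subset_support hkaP hz)) hbkb with (h | h | h) | (h | h | h)
  · exact hob.ne' h
  · exact hab h.symm
  · exact hPc _ (P.support_takeUntil_subset_support hkaP h) hbc
  · exact hkb (h ▸ ho)
  · exact hkb (h ▸ hac)
  · exact Walk.endpoint_notMem_support_takeUntil hPp hkaP d3.symm h

end
end FN

namespace FN
open Classical
set_option linter.unusedSectionVars false
set_option linter.unusedSimpArgs false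
set_option linter.unusedVariables false
universe u
section
variable {V : Type u} [Fintype V] {G : SimpleGraph V}

theorem path_append {a b d : V} {p : G.Walk a b} {q : G.Walk b d} (hp : p.IsPath) (hq : q.IsPath)
    (hd : ∀ x ∈ p.support, x ∈ q.support → x = b) : (p.append q).IsPath := by
  rw [Walk.isPath_def, Walk.support_append]
  refine List.nodup_append.2 ⟨hp.support_nodup, hq.support_nodup.tail, ?_⟩
  rintro x hx y hy rfl
  exact path_tail_ne hq hy (hd x hx (List.mem_of_mem_tail hy))

theorem mem_take_drop {a b d : V} {p : G.Walk a b} (hd : d ∈ p.support) (x : V) :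
    x ∈ p.support ↔ x ∈ (p.takeUntil d hd).support ∨ x ∈ (p.dropUntil d hd).support := by
  conv_lhs => rw [← p.take_spec hd]
  rw [Walk.mem_support_append_iff]

theorem edge_take_drop {a b d : V} {p : G.Walk a b} (hd : d ∈ p.support) (e : Sym2 V) :
    e ∈ p.edges ↔ e ∈ (p.takeUntil d hd).edges ∨ e ∈ (p.dropUntil d hd).edges := by
  conv_lhs => rw [← p.take_spec hd]
  rw [Walk.edges_append, List.mem_append]

theorem take_drop_inter {a b d : V} {p : G.Walk a b} (hp : p.IsPath) (hd : d ∈ p.support) {x : V}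
    (h1 : x ∈ (p.takeUntil d hd).support) (h2 : x ∈ (p.dropUntil d hd).support) : x = d := by
  by_contra hne
  have hn := hp.support_nodup
  rw [← p.take_spec hd, Walk.support_append] at hn
  have h3 : x ∈ (p.dropUntil d hd).support.tail := by
    rw [Walk.mem_support_iff] at h2
    exact h2.resolve_left hne
  exact (List.nodup_append.1 hn).2.2 x h1 x h3 rfl

theorem start_not_drop {a b d : V} {p : G.Walk a b} (hp : p.IsPath) (hd : d ∈ p.support) (hda : d ≠ a) :
    a ∉ (p.dropUntil d hd).support := fun h =>
  hda (take_drop_inter hp hd (Walk.start_mem_support _) h).symm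

theorem end_not_take {a b d : V} {p : G.Walk a b} (hp : p.IsPath) (hd : d ∈ p.support) (hdb : d ≠ b) :
    b ∉ (p.takeUntil d hd).support := fun h =>
  hdb (take_drop_inter hp hd h (Walk.end_mem_support _)).symm

theorem len_take_drop {a b d : V} {p : G.Walk a b} (hd : d ∈ p.support) :
    p.length = (p.takeUntil d hd).length + (p.dropUntil d hd).length := by
  conv_lhs => rw [← p.take_spec hd]
  rw [Walk.length_append]

theorem len_pos {a b : V} (p : G.Walk a b) (h : a ≠ b) : 0 < p.length := by
  cases p with
  | nil => exact absurd rfl h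
  | cons _ _ => simp

theorem Duo.comp1 {a b d : V} {p q : G.Walk a b} (h : Duo p q) (hd : d ∈ p.support) (hda : d ≠ a)
    (hdb : d ≠ b) : Duo (p.takeUntil d hd) (q.append (p.dropUntil d hd).reverse) := by
  refine ⟨hda.symm, h.pp.takeUntil hd, ?_, ?_, Or.inr ?_⟩
  · refine path_append h.qp (h.pp.dropUntil hd).reverse ?_
    intro x hx hx'
    rw [Walk.support_reverse, List.mem_reverse] at hx'
    rcases h.dis x ((mem_take_drop hd x).2 (Or.inr hx')) hx with h1 | h1
    · exact absurd (h1 ▸ hx') (start_not_drop h.pp hd hda)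
    · exact h1
  · intro x hx hx'
    rw [Walk.mem_support_append_iff, Walk.support_reverse, List.mem_reverse] at hx'
    rcases hx' with h1 | h1
    · rcases h.dis x ((mem_take_drop hd x).2 (Or.inl hx)) h1 with h2 | h2
      · exact Or.inl h2
      · exact absurd (h2 ▸ hx) (end_not_take h.pp hd hdb)
    · exact Or.inr (take_drop_inter h.pp hd hx h1)
  · have := len_pos q h.ne
    have := len_pos (p.dropUntil d hd) hdb
    rw [Walk.length_append, Walk.length_reverse]
    omega

theorem Duo.comp2 {a b d : V} {p q : G.Walk a b} (h : Duo p q) (hd : d ∈ p.support) (hda : d ≠ a)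
    (hdb : d ≠ b) : Duo (p.dropUntil d hd) ((p.takeUntil d hd).reverse.append q) := by
  refine ⟨hdb, h.pp.dropUntil hd, ?_, ?_, Or.inr ?_⟩
  · refine path_append (h.pp.takeUntil hd).reverse h.qp ?_
    intro x hx hx'
    rw [Walk.support_reverse, List.mem_reverse] at hx
    rcases h.dis x ((mem_take_drop hd x).2 (Or.inl hx)) hx' with h1 | h1
    · exact h1
    · exact absurd (h1 ▸ hx) (end_not_take h.pp hd hdb)
  · intro x hx hx'
    rw [Walk.mem_support_append_iff, Walk.support_reverse, List.mem_reverse] at hx'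
    rcases hx' with h1 | h1
    · exact Or.inl (take_drop_inter h.pp hd h1 hx)
    · rcases h.dis x ((mem_take_drop hd x).2 (Or.inr hx)) h1 with h2 | h2
      · exact absurd (h2 ▸ hx) (start_not_drop h.pp hd hda)
      · exact Or.inr h2
  · have := len_pos q h.ne
    have := len_pos (p.takeUntil d hd) hda.symm
    rw [Walk.length_append, Walk.length_reverse]
    omega

structure Spl {o a b : V} (c : G.Walk o o) (p q : G.Walk a b) : Prop where
  duo : Duo p q
  sup : ∀ x, x ∈ c.support ↔ x ∈ p.support ∨ x ∈ q.support
  edg : ∀ e, e ∈ c.edges ↔ e ∈ p.edges ∨ e ∈ q.edges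

theorem Spl.symm {o a b : V} {c : G.Walk o o} {p q : G.Walk a b} (h : Spl c p q) : Spl c q p :=
  ⟨h.duo.symm, fun x => by rw [h.sup, or_comm], fun x => by rw [h.edg, or_comm]⟩

theorem Spl.comp1 {o a b d : V} {c : G.Walk o o} {p q : G.Walk a b} (h : Spl c p q) (hd : d ∈ p.support)
    (hda : d ≠ a) (hdb : d ≠ b) : Spl c (p.takeUntil d hd) (q.append (p.dropUntil d hd).reverse) := by
  refine ⟨h.duo.comp1 hd hda hdb, fun x => ?_, fun e => ?_⟩
  · rw [h.sup, mem_take_drop hd, Walk.mem_support_append_iff, Walk.support_reverse, List.mem_reverse,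
      or_assoc, or_comm (a := x ∈ (p.dropUntil d hd).support)]
  · rw [h.edg, edge_take_drop hd, Walk.edges_append, List.mem_append, Walk.edges_reverse, List.mem_reverse,
      or_assoc, or_comm (a := e ∈ (p.dropUntil d hd).edges)]

theorem Spl.comp2 {o a b d : V} {c : G.Walk o o} {p q : G.Walk a b} (h : Spl c p q) (hd : d ∈ p.support)
    (hda : d ≠ a) (hdb : d ≠ b) : Spl c (p.dropUntil d hd) ((p.takeUntil d hd).reverse.append q) := by
  refine ⟨h.duo.comp2 hd hda hdb, fun x => ?_, fun e => ?_⟩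
  · rw [h.sup, mem_take_drop hd, Walk.mem_support_append_iff, Walk.support_reverse, List.mem_reverse,
      or_comm (a := x ∈ (p.takeUntil d hd).support), or_assoc]
  · rw [h.edg, edge_take_drop hd, Walk.edges_append, List.mem_append, Walk.edges_reverse, List.mem_reverse,
      or_comm (a := e ∈ (p.takeUntil d hd).edges), or_assoc]

/-- interior of a path -/
def Int' {a b : V} (p : G.Walk a b) : Set V := {z | z ∈ p.support ∧ z ≠ a ∧ z ≠ b}

theorem int_conn {a b : V} {q : G.Walk a b} (hq : q.IsPath) : ∀ v ∈ Int' q, ∀ v' ∈ Int' q,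
    Rch G (Int' q) v v' := by
  rintro v ⟨hv, hva, hvb⟩ v' ⟨hv', hva', hvb'⟩
  rcases (mem_take_drop hv v').1 hv' with h | h
  · apply Rch.symm
    refine Rch.of_walk ((q.takeUntil v hv).dropUntil v' h) ?_
    intro x hx
    have h1 := (mem_take_drop h x).2 (Or.inr hx)
    refine ⟨(mem_take_drop hv x).2 (Or.inl h1), ?_, ?_⟩
    · rintro rfl; exact start_not_drop (hq.takeUntil hv) h hva' hx
    · rintro rfl; exact end_not_take hq hv hvb h1
  · refine Rch.of_walk ((q.dropUntil v hv).takeUntil v' h) ?_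
    intro x hx
    have h1 := (mem_take_drop h x).2 (Or.inl hx)
    refine ⟨(mem_take_drop hv x).2 (Or.inr h1), ?_, ?_⟩
    · rintro rfl; exact start_not_drop hq hv hva h1
    · rintro rfl; exact end_not_take (hq.dropUntil hv) h hvb' hx

theorem int_adj1 {a b z : V} {q : G.Walk a b} (hq : q.IsPath) (hz : z ∈ Int' q) :
    ∃ w ∈ Int' q, G.Adj a w := by
  obtain ⟨hz, hza, hzb⟩ := hz
  have hnn : ¬ (q.takeUntil z hz).Nil := fun h => hza h.eq.symm
  have hm : (q.takeUntil z hz).snd ∈ (q.takeUntil z hz).support := Walk.getVert_mem_support _ _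
  have hadj := (q.takeUntil z hz).adj_snd hnn
  refine ⟨_, ⟨(mem_take_drop hz _).2 (Or.inl hm), hadj.ne', ?_⟩, hadj⟩
  intro h
  rw [h] at hm
  exact end_not_take hq hz hzb hm

theorem int_rev {a b z : V} {q : G.Walk a b} : z ∈ Int' q.reverse ↔ z ∈ Int' q := by
  simp only [Int', Set.mem_ofPred_eq, Walk.support_reverse, List.mem_reverse]
  constructor <;> exact fun ⟨h1, h2, h3⟩ => ⟨h1, h3, h2⟩

theorem int_adj2 {a b z : V} {q : G.Walk a b} (hq : q.IsPath) (hz : z ∈ Int' q) :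
    ∃ w ∈ Int' q, G.Adj b w := by
  obtain ⟨w, hw, hb⟩ := int_adj1 hq.reverse (int_rev.2 hz)
  exact ⟨w, int_rev.1 hw, hb⟩

theorem minor_of {W : Type} (K : SimpleGraph W) (B : W → Set V) (lab : V → W)
    (hl : ∀ w, ∀ z ∈ B w, lab z = w) (hne : ∀ w, (B w).Nonempty)
    (hconn : ∀ w, ∀ a ∈ B w, ∀ b ∈ B w, Rch G (B w) a b)
    (hadj : ∀ w w', K.Adj w w' → ∃ u ∈ B w, ∃ x ∈ B w', G.Adj u x) : HasMinor G K := by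
  refine ⟨B, hne, fun w => (conn_iff (hne w)).2 (hconn w), ?_, hadj⟩
  intro w w' hw
  rw [Set.disjoint_left]
  intro z hz hz'
  exact hw ((hl w z hz).symm.trans (hl w' z hz'))

theorem rch_single (x : V) : ∀ a ∈ ({x} : Set V), ∀ b ∈ ({x} : Set V), Rch G {x} a b := by
  rintro a rfl b rfl
  exact Relation.ReflTransGen.refl

end
end FN

namespace FN
open Classical
set_option linter.unusedSectionVars false
set_option linter.unusedSimpArgs false
set_option linter.unusedVariables false
universe u
section
variable {V : Type u} [Fintype V] {G : SimpleGraph V}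

def CN (G : SimpleGraph V) (A : Set V) : Prop := A.Nonempty ∧ ∀ a ∈ A, ∀ b ∈ A, Rch G A a b

def AD (G : SimpleGraph V) (A B : Set V) : Prop := ∃ u ∈ A, ∃ x ∈ B, G.Adj u x

theorem AD.symm {A B : Set V} (h : AD G A B) : AD G B A := by
  obtain ⟨u, hu, x, hx, h⟩ := h
  exact ⟨x, hx, u, hu, h.symm⟩

theorem k33_of (hp : IsPlanarGraph G) (A0 A1 A2 B0 B1 B2 : Set V) (lab : V → Fin 3 ⊕ Fin 3)
    (l0 : ∀ z ∈ A0, lab z = .inl 0) (l1 : ∀ z ∈ A1, lab z = .inl 1) (l2 : ∀ z ∈ A2, lab z = .inl 2)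
    (m0 : ∀ z ∈ B0, lab z = .inr 0) (m1 : ∀ z ∈ B1, lab z = .inr 1) (m2 : ∀ z ∈ B2, lab z = .inr 2)
    (c0 : CN G A0) (c1 : CN G A1) (c2 : CN G A2) (d0 : CN G B0) (d1 : CN G B1) (d2 : CN G B2)
    (e00 : AD G A0 B0) (e01 : AD G A0 B1) (e02 : AD G A0 B2)
    (e10 : AD G A1 B0) (e11 : AD G A1 B1) (e12 : AD G A1 B2)
    (e20 : AD G A2 B0) (e21 : AD G A2 B1) (e22 : AD G A2 B2) : False := by
  apply hp.2
  have hC : ∀ w, CN G (Sum.elim ![A0, A1, A2] ![B0, B1, B2] w) := by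
    rintro (w | w) <;> fin_cases w <;> assumption
  have hA : ∀ i j, AD G (![A0, A1, A2] i) (![B0, B1, B2] j) := by
    intro i j
    fin_cases i <;> fin_cases j <;> assumption
  refine minor_of _ (Sum.elim ![A0, A1, A2] ![B0, B1, B2]) lab ?_ (fun w => (hC w).1) (fun w => (hC w).2) ?_
  · rintro (w | w) <;> fin_cases w <;> assumption
  · rintro (w | w) (w' | w') h
    · simp at h
    · exact hA w w'
    · exact (hA w' w).symm
    · simp at h

theorem k5_of (hp : IsPlanarGraph G) (A0 A1 A2 A3 A4 : Set V) (lab : V → Fin 5)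
    (l0 : ∀ z ∈ A0, lab z = 0) (l1 : ∀ z ∈ A1, lab z = 1) (l2 : ∀ z ∈ A2, lab z = 2)
    (l3 : ∀ z ∈ A3, lab z = 3) (l4 : ∀ z ∈ A4, lab z = 4)
    (c0 : CN G A0) (c1 : CN G A1) (c2 : CN G A2) (c3 : CN G A3) (c4 : CN G A4)
    (e01 : AD G A0 A1) (e02 : AD G A0 A2) (e03 : AD G A0 A3) (e04 : AD G A0 A4)
    (e12 : AD G A1 A2) (e13 : AD G A1 A3) (e14 : AD G A1 A4)
    (e23 : AD G A2 A3) (e24 : AD G A2 A4) (e34 : AD G A3 A4) : False := by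
  apply hp.1
  have hC : ∀ w, CN G (![A0, A1, A2, A3, A4] w) := by
    intro w; fin_cases w <;> assumption
  have hA : ∀ i j, i < j → AD G (![A0, A1, A2, A3, A4] i) (![A0, A1, A2, A3, A4] j) := by
    intro i j
    fin_cases i <;> fin_cases j <;> first | (intro h; exact absurd h (by decide)) | (intro _; assumption)
  refine minor_of _ (![A0, A1, A2, A3, A4]) lab ?_ (fun w => (hC w).1) (fun w => (hC w).2) ?_
  · intro w; fin_cases w <;> assumption
  · intro w w' h
    have hne : w ≠ w' := h.ne
    rcases lt_or_gt_of_ne hne with h | h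
    · exact hA w w' h
    · exact (hA w' w h).symm

theorem CN.single (x : V) : CN G {x} := ⟨⟨x, rfl⟩, rch_single x⟩

theorem k33' (hp : IsPlanarGraph G) {a b x y y0 y1 : V} {p q : G.Walk a b} (h : Duo p q)
    (hxp : x ∉ p.support) (hxq : x ∉ q.support) (hyp : y ∉ p.support) (hyq : y ∉ q.support)
    (hxy : G.Adj x y) (hxa : G.Adj x a) (hxb : G.Adj x b)
    (h0 : y0 ∈ Int' p) (h0y : G.Adj y y0) (h1 : y1 ∈ Int' q) (h1y : G.Adj y y1) : False := by
  have hya : y ≠ a := by rintro rfl; exact hyp p.start_mem_support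
  have hyb : y ≠ b := by rintro rfl; exact hyp p.end_mem_support
  refine k33_of hp {x} (Int' p) (Int' q) {y} {a} {b}
    (fun z => if z = x then .inl 0 else if z = y then .inr 0 else if z = a then .inr 1 else
      if z = b then .inr 2 else if z ∈ p.support then .inl 1 else .inl 2) ?_ ?_ ?_ ?_ ?_ ?_
    (.single x) ⟨⟨_, h0⟩, int_conn h.pp⟩ ⟨⟨_, h1⟩, int_conn h.qp⟩ (.single y) (.single a) (.single b)
    ⟨x, rfl, y, rfl, hxy⟩ ⟨x, rfl, a, rfl, hxa⟩ ⟨x, rfl, b, rfl, hxb⟩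
    ⟨y0, h0, y, rfl, h0y.symm⟩ (AD.symm ⟨a, rfl, int_adj1 h.pp h0⟩) (AD.symm ⟨b, rfl, int_adj2 h.pp h0⟩)
    ⟨y1, h1, y, rfl, h1y.symm⟩ (AD.symm ⟨a, rfl, int_adj1 h.qp h1⟩) (AD.symm ⟨b, rfl, int_adj2 h.qp h1⟩)
  · rintro z rfl; simp
  · rintro z ⟨hz, hza, hzb⟩
    have e1 : z ≠ x := by rintro rfl; exact hxp hz
    have e2 : z ≠ y := by rintro rfl; exact hyp hz
    simp [e1, e2, hza, hzb, hz]
  · rintro z ⟨hz, hza, hzb⟩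
    have e1 : z ≠ x := by rintro rfl; exact hxq hz
    have e2 : z ≠ y := by rintro rfl; exact hyq hz
    have e3 : z ∉ p.support := fun h' => (h.dis z h' hz).elim hza hzb
    simp [e1, e2, hza, hzb, e3]
  · rintro z rfl; simp [hxy.ne']
  · rintro z rfl; simp [hxa.ne', hya.symm]
  · rintro z rfl; simp [hxb.ne', hyb.symm, h.ne.symm]

theorem k5' (hp : IsPlanarGraph G) {a b x y d : V} {p q : G.Walk a b} (h : Duo p q)
    (hxp : x ∉ p.support) (hxq : x ∉ q.support) (hyp : y ∉ p.support) (hyq : y ∉ q.support)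
    (hxy : G.Adj x y) (hxa : G.Adj x a) (hxb : G.Adj x b) (hya : G.Adj y a) (hyb : G.Adj y b)
    (hd : d ∈ Int' q) (hdx : G.Adj x d) (hdy : G.Adj y d) : False := by
  have hnn : ¬ p.Nil := fun hn => h.ne hn.eq
  have hbm : b ∈ {z | z ∈ p.support ∧ z ≠ a} := ⟨p.end_mem_support, h.ne.symm⟩
  have hsm : p.snd ∈ {z | z ∈ p.support ∧ z ≠ a} := ⟨Walk.getVert_mem_support _ _, (p.adj_snd hnn).ne'⟩
  have hcn : CN G {z | z ∈ p.support ∧ z ≠ a} := by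
    have key : ∀ v ∈ {z | z ∈ p.support ∧ z ≠ a}, Rch G {z | z ∈ p.support ∧ z ≠ a} v b := by
      rintro v ⟨hv, hva⟩
      refine Rch.of_walk (p.dropUntil v hv) ?_
      intro z hz
      refine ⟨(mem_take_drop hv z).2 (Or.inr hz), ?_⟩
      rintro rfl
      exact start_not_drop h.pp hv hva hz
    exact ⟨⟨b, hbm⟩, fun v hv w hw => (key v hv).trans (key w hw).symm⟩
  refine k5_of hp {x} {y} {a} {z | z ∈ p.support ∧ z ≠ a} (Int' q)
    (fun z => if z = x then 0 else if z = y then 1 else if z = a then 2 else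
      if z ∈ p.support then 3 else 4) ?_ ?_ ?_ ?_ ?_
    (.single x) (.single y) (.single a) hcn ⟨⟨_, hd⟩, int_conn h.qp⟩
    ⟨x, rfl, y, rfl, hxy⟩ ⟨x, rfl, a, rfl, hxa⟩ ⟨x, rfl, b, hbm, hxb⟩ ⟨x, rfl, d, hd, hdx⟩
    ⟨y, rfl, a, rfl, hya⟩ ⟨y, rfl, b, hbm, hyb⟩ ⟨y, rfl, d, hd, hdy⟩
    ⟨a, rfl, _, hsm, p.adj_snd hnn⟩ ⟨a, rfl, int_adj1 h.qp hd⟩ ⟨b, hbm, int_adj2 h.qp hd⟩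
  · rintro z rfl; simp
  · rintro z rfl; simp [hxy.ne']
  · rintro z rfl; simp [hxa.ne', hya.ne']
  · rintro z ⟨hz, hza⟩
    have e1 : z ≠ x := by rintro rfl; exact hxp hz
    have e2 : z ≠ y := by rintro rfl; exact hyp hz
    simp [e1, e2, hza, hz]
  · rintro z ⟨hz, hza, hzb⟩
    have e1 : z ≠ x := by rintro rfl; exact hxq hz
    have e2 : z ≠ y := by rintro rfl; exact hyq hz
    have e3 : z ∉ p.support := fun h' => (h.dis z h' hz).elim hza hzb
    simp [e1, e2, hza, e3]

structure Wh {o : V} (c : G.Walk o o) (x y : V) : Prop where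
  cyc : c.IsCycle
  xy : G.Adj x y
  hx : x ∉ c.support
  hy : y ∉ c.support
  only : ∀ z w, G.Adj z w → z ∈ c.support ∨ z = x ∨ z = y
  x2 : ∃ s ∈ c.support, ∃ t ∈ c.support, s ≠ t ∧ G.Adj x s ∧ G.Adj x t
  y2 : ∃ s ∈ c.support, ∃ t ∈ c.support, s ≠ t ∧ G.Adj y s ∧ G.Adj y t

theorem Wh.symm {o : V} {c : G.Walk o o} {x y : V} (h : Wh c x y) : Wh c y x :=
  ⟨h.cyc, h.xy.symm, h.hy, h.hx, fun z w hzw => (h.only z w hzw).imp id Or.symm, h.y2, h.x2⟩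

theorem Ce.mkWh (hG : Ce G) {o : V} {c : G.Walk o o} (hc : c.IsCycle) {x y : V}
    (hxy : G.Adj x y) (hx : x ∉ c.support) (hy : y ∉ c.support) {s t : V} (hs : s ∈ c.support)
    (ht : t ∈ c.support) (hst : s ≠ t) (hxs : G.Adj x s) (hxt : G.Adj x t) : Wh c x y := by
  have hout : ∀ k z, G.Adj k z → k ∉ c.support → z ∉ c.support → k ≠ x → z = x := by
    intro k z hkz hk hz hkx
    rcases hG.two hc hkz hk hz hx hs ht hst hxs hxt with h | h
    · exact absurd h.symm hkx
    · exact h.symm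
  have htwo : ∀ k z, G.Adj k z → k ∉ c.support → k ≠ x →
      ∃ s ∈ c.support, ∃ t ∈ c.support, s ≠ t ∧ G.Adj k s ∧ G.Adj k t := by
    intro k z hkz hk hkx
    obtain ⟨t1, h1, h1x, _⟩ := hG.deg3 hkz x x
    obtain ⟨t2, h2, h2x, h21⟩ := hG.deg3 hkz x t1
    refine ⟨t1, ?_, t2, ?_, h21.symm, h1, h2⟩
    · by_contra h; exact h1x (hout k t1 h1 hk h hkx)
    · by_contra h; exact h2x (hout k t2 h2 hk h hkx)
  refine ⟨hc, hxy, hx, hy, ?_, ⟨s, hs, t, ht, hst, hxs, hxt⟩, htwo y x hxy.symm hy hxy.ne'⟩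
  intro z w hzw
  by_cases hz : z ∈ c.support
  · exact Or.inl hz
  · right
    by_cases hzx : z = x
    · exact Or.inl hzx
    · obtain ⟨s', hs', t', ht', hst', h1, h2⟩ := htwo z w hzw hz hzx
      exact hG.two hc hxy hx hy hz hs' ht' hst' h1 h2

theorem path_edge_int {a b : V} {q : G.Walk a b} (hq : q.IsPath) (hab : a ≠ b) (h : s(a, b) ∈ q.edges) :
    ∀ z ∈ q.support, z = a ∨ z = b := by
  cases q with
  | nil => exact absurd rfl hab
  | cons h1 q' =>
    rw [Walk.cons_isPath_iff] at hq
    rw [Walk.edges_cons, List.mem_cons] at h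
    rcases h with h | h
    · rcases Sym2.eq_iff.1 h with ⟨_, h3⟩ | ⟨h3, h4⟩
      · subst h3
        have hnil := Walk.isPath_iff_nil.1 hq.1
        have := Walk.eq_nil_iff_nil.2 hnil
        subst this
        simp
      · exact absurd h4.symm hab
    · exact absurd (q'.fst_mem_support_of_mem_edges h) hq.2

theorem Wh.fin {o : V} {c : G.Walk o o} {x y : V} (W : Wh c x y) (hG : Ce G) {a b : V} {p q : G.Walk a b}
    (h : Spl c p q) (hxa : G.Adj x a) (hxb : G.Adj x b)
    (h1 : ∀ z ∈ p.support, G.Adj x z → z = a ∨ z = b) (h2 : ∀ z ∈ c.support, G.Adj y z → z ∈ p.support) :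
    False := by
  have hxp : x ∉ p.support := fun h' => W.hx ((h.sup x).2 (Or.inl h'))
  have hxq : x ∉ q.support := fun h' => W.hx ((h.sup x).2 (Or.inr h'))
  have hyp : y ∉ p.support := fun h' => W.hy ((h.sup y).2 (Or.inl h'))
  have hyq : y ∉ q.support := fun h' => W.hy ((h.sup y).2 (Or.inr h'))
  have hD := Duo.mk2 h.duo.pp h.duo.ne hxp hxa.symm hxb
  obtain ⟨C, hCc, hCs, hCe⟩ : ∃ C : G.Walk a a, C.IsCycle ∧ (∀ z, z ∈ C.support ↔ z ∈ p.support ∨ z = x) ∧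
      (∀ e, e ∈ C.edges ↔ e ∈ p.edges ∨ e = s(a, x) ∨ e = s(x, b)) := by
    refine ⟨_, hD.cyc, ?_, ?_⟩
    · intro z
      rw [Duo.mem_support]
      simp only [Walk.support_cons, Walk.support_nil, List.mem_cons, List.not_mem_nil, or_false]
      constructor
      · rintro (h | h | h | h)
        · exact Or.inl h
        · exact Or.inl (h ▸ p.start_mem_support)
        · exact Or.inr h
        · exact Or.inl (h ▸ p.end_mem_support)
      · rintro (h | h) <;> simp [h]
    · intro e
      rw [Duo.mem_edges]
      simp only [Walk.edges_cons, Walk.edges_nil, List.mem_cons, List.not_mem_nil, or_false]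
  have hyC : y ∉ C.support := by
    rw [hCs]; rintro (h | h)
    · exact hyp h
    · exact W.xy.ne h.symm
  have hCe1 : ∀ u v, s(u, v) ∈ C.edges → u ∈ C.support := fun u v h => C.fst_mem_support_of_mem_edges h
  have hCe2 : ∀ u v, s(u, v) ∈ C.edges → v ∈ C.support := fun u v h => C.snd_mem_support_of_mem_edges h
  have hnn : ¬ q.Nil := fun hn => h.duo.ne hn.eq
  have hsq : s(a, q.snd) ∈ q.edges := (fl_snd h.duo.qp h.duo.ne).2
  have hsm : q.snd ∈ q.support := q.snd_mem_support_of_mem_edges hsq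
  have hay : a ≠ y := by rintro rfl; exact hyp p.start_mem_support
  have hq_out : ∀ v w, G.Adj v w → v ∉ C.support → v ≠ y → v ∈ Int' q := by
    intro v w hvw hv hvy
    rw [hCs] at hv
    push Not at hv
    have hvc : v ∈ c.support := by
      rcases W.only v w hvw with h' | h' | h'
      · exact h'
      · exact absurd h' hv.2
      · exact absurd h' hvy
    have hvq := ((h.sup v).1 hvc).resolve_left hv.1
    refine ⟨hvq, ?_, ?_⟩
    · rintro rfl; exact hv.1 p.start_mem_support
    · rintro rfl; exact hv.1 p.end_mem_support
  have hqint : ∀ v ∈ Int' q, v ∉ C.support := by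
    rintro v ⟨hv, hva, hvb⟩
    rw [hCs]
    rintro (h' | h')
    · exact (h.duo.dis v h' hv).elim hva hvb
    · exact hxq (h' ▸ hv)
  refine hG.two_br hCc (B := fun u v => u = y ∨ v = y) (fun u v h => h.symm) W.xy (Or.inr rfl)
    (fun h => hyC (hCe2 _ _ h)) (q.adj_of_mem_edges hsq) ?_ ?_ ?_ ?_ ?_
  · rintro (h' | h')
    · exact hay h'
    · exact hyq (h' ▸ hsm)
  · rw [hCe]
    rintro (h' | h' | h')
    · exact h.duo.edges h' hsq
    · rcases Sym2.eq_iff.1 h' with ⟨_, h3⟩ | ⟨h3, _⟩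
      · exact hxq (h3 ▸ hsm)
      · exact hxa.ne h3.symm
    · rcases Sym2.eq_iff.1 h' with ⟨h3, _⟩ | ⟨h3, _⟩
      · exact hxa.ne h3.symm
      · exact h.duo.ne h3
  · rintro v s t hv hs ht (h' | h')
    · exact Or.inl h'
    · subst h'
      by_contra hvy
      push Not at hvy
      have h3 := hq_out v s hs hv hvy.1
      have h4 := h2 v ((h.sup v).2 (Or.inr h3.1)) hs.symm
      exact (h.duo.dis v h4 h3.1).elim h3.2.1 h3.2.2
  · intro s v s' v' hs hs' hsv hsv' hB hB' _ _
    have e1 : v = y := hB.resolve_left (fun h' => hyC (h' ▸ hs))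
    have e2 : v' = y := hB'.resolve_left (fun h' => hyC (h' ▸ hs'))
    subst e1
    rw [e2]
    exact Or.inr (Or.inr ⟨hyC, hyC, Link.refl _ _⟩)
  · have key : ∀ s v, s ∈ C.support → G.Adj s v → ¬ (s = y ∨ v = y) → s(s, v) ∉ C.edges →
        v ∈ Int' q ∨ (((s = a ∧ v = b) ∨ (s = b ∧ v = a)) ∧ s(a, b) ∈ q.edges) := by
      intro s v hs hsv hB hne
      push Not at hB
      by_cases hv : v ∈ C.support
      · right
        have hxx : ∀ z, z ∈ p.support → G.Adj x z → s(x, z) ∈ C.edges := by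
          intro z hz hxz
          rw [hCe]
          rcases h1 z hz hxz with h' | h'
          · right; left; rw [h']; exact Sym2.eq_swap
          · right; right; rw [h']
        rcases (hCs s).1 hs with hsp | hsx
        · rcases (hCs v).1 hv with hvp | hvx
          · have hch := hG.chordless W.cyc W.xy W.hx W.hy ((h.sup s).2 (Or.inl hsp))
              ((h.sup v).2 (Or.inl hvp)) hsv
            rcases (h.edg _).1 hch with h3 | h3
            · exact absurd ((hCe _).2 (Or.inl h3)) hne
            · have e1 := h.duo.dis s hsp (q.fst_mem_support_of_mem_edges h3)
              have e2 := h.duo.dis v hvp (q.snd_mem_support_of_mem_edges h3)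
              rcases e1 with e1 | e1 <;> rcases e2 with e2 | e2
              · exact absurd (e1.trans e2.symm) hsv.ne
              · exact ⟨Or.inl ⟨e1, e2⟩, by rw [e1, e2] at h3; exact h3⟩
              · exact ⟨Or.inr ⟨e1, e2⟩, by rw [e1, e2, Sym2.eq_swap] at h3; exact h3⟩
              · exact absurd (e1.trans e2.symm) hsv.ne
          · subst hvx
            exact absurd (Sym2.eq_swap ▸ hxx s hsp hsv.symm) hne
        · subst hsx
          rcases (hCs v).1 hv with hvp | hvx
          · exact absurd (hxx v hvp hsv) hne
          · exact absurd hvx hsv.ne'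
      · exact Or.inl (hq_out v s hsv.symm hv hB.2)
    intro s v s' v' hs hs' hsv hsv' hB hB' hn hn'
    have hno : s(a, b) ∈ q.edges → ∀ z, z ∉ Int' q := fun h3 z hz =>
      (path_edge_int h.duo.qp h.duo.ne h3 z hz.1).elim hz.2.1 hz.2.2
    rcases key s v hs hsv hB hn with h3 | ⟨h3, h4⟩ <;> rcases key s' v' hs' hsv' hB' hn' with h5 | ⟨h5, h6⟩
    · refine Or.inr (Or.inr ⟨hqint _ h3, hqint _ h5, ?_⟩)
      have hr := int_conn h.duo.qp v h3 v' h5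
      have hl : Link (RB G (Int' q)) v v' := Link.of_rtg (fun a b h => RB.symm h) hr
      refine hl.mono ?_
      rintro u w ⟨h6, h7, h8⟩
      refine ⟨⟨h6, ?_⟩, hqint _ h7, hqint _ h8⟩
      rintro (h9 | h9)
      · exact hyq (h9 ▸ h7.1)
      · exact hyq (h9 ▸ h8.1)
    · exact absurd h3 (hno h6 v)
    · exact absurd h5 (hno h4 v')
    · rcases h3 with ⟨rfl, rfl⟩ | ⟨rfl, rfl⟩ <;> rcases h5 with ⟨rfl, rfl⟩ | ⟨rfl, rfl⟩ <;> simp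

end
end FN

namespace FN
open Classical
set_option linter.unusedSectionVars false
set_option linter.unusedSimpArgs false
set_option linter.unusedVariables false
universe u
section
variable {V : Type u} [Fintype V] {G : SimpleGraph V}

theorem Wh.contra {o : V} {c : G.Walk o o} {x y : V} (W : Wh c x y) (hG : Ce G) : False := by
  have hsx : ∀ {a b : V} {p q : G.Walk a b}, Spl c p q → x ∉ p.support ∧ x ∉ q.support := fun h =>
    ⟨fun h' => W.hx ((h.sup x).2 (Or.inl h')), fun h' => W.hx ((h.sup x).2 (Or.inr h'))⟩
  have hsy : ∀ {a b : V} {p q : G.Walk a b}, Spl c p q → y ∉ p.support ∧ y ∉ q.support := fun h =>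
    ⟨fun h' => W.hy ((h.sup y).2 (Or.inl h')), fun h' => W.hy ((h.sup y).2 (Or.inr h'))⟩
  by_cases hA : ∃ y0 ∈ c.support, G.Adj y y0 ∧ ¬ G.Adj x y0
  · obtain ⟨y0, hy0, hyy0, hxy0⟩ := hA
    have key : ∀ n : ℕ, ∀ (a b : V) (p q : G.Walk a b), p.length ≤ n → Spl c p q → G.Adj x a → G.Adj x b →
        y0 ∈ p.support → False := by
      intro n
      induction n with
      | zero =>
        intro a b p q hl h
        have := len_pos p h.duo.ne
        omega
      | succ n ih =>
        intro a b p q hl h hxa hxb hyp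
        by_cases hd : ∃ d ∈ p.support, G.Adj x d ∧ d ≠ a ∧ d ≠ b
        · obtain ⟨d, hd, hxd, hda, hdb⟩ := hd
          have e0 := len_take_drop hd
          have e1 := len_pos (p.takeUntil d hd) hda.symm
          have e2 := len_pos (p.dropUntil d hd) hdb
          rcases (mem_take_drop hd y0).1 hyp with h1 | h1
          · exact ih _ _ _ _ (by omega) (h.comp1 hd hda hdb) hxa hxd h1
          · exact ih _ _ _ _ (by omega) (h.comp2 hd hda hdb) hxd hxb h1
        · push Not at hd
          refine W.fin hG h hxa hxb ?_ ?_
          · intro z hz hxz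
            by_cases hza : z = a
            · exact Or.inl hza
            · exact Or.inr (hd z hz hxz hza)
          · intro z hz hyz
            by_contra hzp
            have hzq := ((h.sup z).1 hz).resolve_left hzp
            refine k33' hG.pl h.duo (hsx h).1 (hsx h).2 (hsy h).1 (hsy h).2 W.xy hxa hxb (y0 := y0) (y1 := z)
              ⟨hyp, ?_, ?_⟩ hyy0 ⟨hzq, ?_, ?_⟩ hyz
            · rintro rfl; exact hxy0 hxa
            · rintro rfl; exact hxy0 hxb
            · rintro rfl; exact hzp p.start_mem_support
            · rintro rfl; exact hzp p.end_mem_support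
    obtain ⟨a, ha, b, hb, hab, hxa, hxb⟩ := W.x2
    obtain ⟨p, q, hD, hs, he, _⟩ := cycle_split W.cyc ha hb hab
    have hS : Spl c p q := ⟨hD, hs, he⟩
    rcases (hs y0).1 hy0 with h | h
    · exact key _ a b p q le_rfl hS hxa hxb h
    · exact key _ a b q p le_rfl hS.symm hxa hxb h
  · push Not at hA
    have hall : ∀ z ∈ c.support, G.Adj x z := by
      intro z hz
      obtain ⟨k, hk, hzk⟩ := hG.att W.cyc W.xy W.hx W.hy hz
      rcases W.only k z hzk.symm with h | h | h
      · exact absurd h hk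
      · exact h ▸ hzk.symm
      · exact hA z hz (h ▸ hzk.symm)
    obtain ⟨a, ha, b, hb, hab, hya, hyb⟩ := W.y2
    obtain ⟨p, q, hD, hs, he, _⟩ := cycle_split W.cyc ha hb hab
    have hS : Spl c p q := ⟨hD, hs, he⟩
    have hxa := hall a ha
    have hxb := hall b hb
    have hN : ∀ z ∈ c.support, G.Adj y z → z = a ∨ z = b := by
      intro z hz hyz
      by_contra hn
      push Not at hn
      rcases (hs z).1 hz with h | h
      · exact k5' hG.pl hD.symm (hsx hS).2 (hsx hS).1 (hsy hS).2 (hsy hS).1 W.xy hxa hxb hya hyb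
          ⟨h, hn.1, hn.2⟩ (hall z hz) hyz
      · exact k5' hG.pl hD (hsx hS).1 (hsx hS).2 (hsy hS).1 (hsy hS).2 W.xy hxa hxb hya hyb
          ⟨h, hn.1, hn.2⟩ (hall z hz) hyz
    have fin : ∀ p q : G.Walk a b, Spl c p q → (∀ z, z ∉ Int' p) → False := by
      intro p q hS hI
      refine W.fin hG hS hxa hxb ?_ ?_
      · intro z hz _
        by_contra hn
        push Not at hn
        exact hI z ⟨hz, hn.1, hn.2⟩
      · intro z hz hyz
        rcases hN z hz hyz with h | h
        · exact h ▸ p.start_mem_support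
        · exact h ▸ p.end_mem_support
    by_cases hp : ∃ z, z ∈ Int' p
    · by_cases hq : ∃ z, z ∈ Int' q
      · obtain ⟨z, hz⟩ := hp
        obtain ⟨w, hw⟩ := hq
        exact k33' hG.pl hD (hsy hS).1 (hsy hS).2 (hsx hS).1 (hsx hS).2 W.xy.symm hya hyb hz
          (hall z ((hs z).2 (Or.inl hz.1))) hw (hall w ((hs w).2 (Or.inr hw.1)))
      · push Not at hq
        exact fin q p hS.symm hq
    · push Not at hp
      exact fin p q hS hp

theorem Ce.false (hG : Ce G) : False := by
  apply hG.caseII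
  intro o c hc x y hxy hx hy k s t hk hs ht hst hks hkt
  rcases hG.two hc hxy hx hy hk hs ht hst hks hkt with rfl | rfl
  · exact (hG.mkWh hc hxy hx hy hs ht hst hks hkt).contra hG
  · exact (hG.mkWh hc hxy.symm hy hx hs ht hst hks hkt).contra hG

/-- Every planar graph has an algebraic dual (MacLane/Whitney direction of Wagner's theorem). -/
theorem planar_good : ∀ (n : ℕ) (G : SimpleGraph V), ec G ≤ n → IsPlanarGraph G → Good G := by
  intro n
  induction n with
  | zero =>
    intro G hn hp
    by_contra hb
    exact Ce.false (G := G) ⟨hp, hb, fun H _ h => by omega⟩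
  | succ n ih =>
    intro G hn hp
    by_contra hb
    exact Ce.false (G := G) ⟨hp, hb, fun H hH h => ih H (by omega) hH⟩

theorem IsPlanarGraph.good (h : IsPlanarGraph G) : Good G := planar_good _ G le_rfl h

end
end FN

namespace FN
open Classical
set_option linter.unusedSectionVars false
set_option linter.unusedSimpArgs false
set_option linter.unusedVariables false
universe u
section
variable {X : Type} [Fintype X] {A : Type u} [Fintype A] (hd tl : A → X)

/-- dicut shores -/
structure Dc (U : Finset X) : Prop where
  cl : ∀ a, tl a ∈ U → hd a ∈ U
  ne : U.Nonempty
  nu : U ≠ Finset.univ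

def Ent (a : A) (U : Finset X) : Prop := hd a ∈ U ∧ tl a ∉ U

def Pack (w : A → ℕ) (n : ℕ) : Prop :=
  ∃ F : Fin n → Finset X, (∀ i, Dc hd tl (F i)) ∧
    ∀ a, (Finset.univ.filter (fun i => Ent hd tl a (F i))).card ≤ w a

variable {hd tl}

theorem pack_of {ι : Type} [Fintype ι] {w : A → ℕ} (I : Finset ι) (F : ι → Finset X)
    (hF : ∀ i ∈ I, Dc hd tl (F i)) (hw : ∀ a, (I.filter (fun i => Ent hd tl a (F i))).card ≤ w a) :
    Pack hd tl w I.card := by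
  refine ⟨fun k => F (I.equivFin.symm k), fun k => hF _ (I.equivFin.symm k).2, fun a => le_trans ?_ (hw a)⟩
  refine Finset.card_le_card_of_injOn (fun k => ((I.equivFin.symm k : I) : ι)) ?_ ?_
  · intro k hk
    simp only [Finset.coe_filter, Finset.mem_univ, true_and, Set.mem_ofPred_eq] at hk ⊢
    exact ⟨(I.equivFin.symm k).2, hk⟩
  · intro k _ k' _ h
    exact I.equivFin.symm.injective (Subtype.ext h)

theorem Pack.mono {w w' : A → ℕ} {n m : ℕ} (h : Pack hd tl w n) (hw : ∀ a, w a ≤ w' a) (hm : m ≤ n) :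
    Pack hd tl w' m := by
  obtain ⟨F, hF, hc⟩ := h
  refine ⟨fun i => F (Fin.castLE hm i), fun i => hF _, fun a => le_trans ?_ ((hc a).trans (hw a))⟩
  refine Finset.card_le_card_of_injOn (fun k => Fin.castLE hm k) ?_ ?_
  · intro k hk
    simpa using hk
  · intro k _ k' _ h
    exact Fin.castLE_injective hm h

theorem Pack.add {w w' : A → ℕ} {n m : ℕ} (h : Pack hd tl w n) (h' : Pack hd tl w' m) :
    Pack hd tl (fun a => w a + w' a) (n + m) := by
  obtain ⟨F, hF, hc⟩ := h
  obtain ⟨F', hF', hc'⟩ := h'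
  have := pack_of (hd := hd) (tl := tl) (w := fun a => w a + w' a) (ι := Fin n ⊕ Fin m) Finset.univ (Sum.elim F F')
    (by rintro (i | i) _ <;> simp [hF, hF']) (by
      intro a
      have e : (Finset.univ.filter (fun i => Ent hd tl a (Sum.elim F F' i))) =
          (Finset.univ.filter (fun i => Ent hd tl a (F i))).disjSum
            (Finset.univ.filter (fun i => Ent hd tl a (F' i))) := by
        ext (i | i) <;> simp
      rw [e, Finset.card_disjSum]
      exact Nat.add_le_add (hc a) (hc' a))
  simpa using this

theorem Pack.zero (w : A → ℕ) : Pack hd tl w 0 :=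
  ⟨fun i => i.elim0, fun i => i.elim0, fun a => by simp⟩

theorem Pack.bound (hcon : ∀ U, Dc hd tl U → ∃ a, Ent hd tl a U) {w : A → ℕ} {n : ℕ}
    (h : Pack hd tl w n) : n ≤ ∑ a, w a := by
  obtain ⟨F, hF, hc⟩ := h
  choose f hf using fun i => hcon (F i) (hF i)
  calc n = (Finset.univ : Finset (Fin n)).card := by simp
    _ = ∑ a, (Finset.univ.filter (fun i => f i = a)).card :=
        Finset.card_eq_sum_card_fiberwise (fun i _ => Finset.mem_univ _)
    _ ≤ ∑ a, w a := by
        refine Finset.sum_le_sum fun a _ => le_trans (Finset.card_le_card ?_) (hc a)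
        intro i hi
        simp only [Finset.mem_filter, Finset.mem_univ, true_and] at hi ⊢
        rw [← hi]; exact hf i

theorem Pack.exists_max (hcon : ∀ U, Dc hd tl U → ∃ a, Ent hd tl a U) (w : A → ℕ) :
    ∃ n, Pack hd tl w n ∧ ¬ Pack hd tl w (n + 1) := by
  by_contra hn
  push Not at hn
  have : ∀ n, Pack hd tl w n := by
    intro n
    induction n with
    | zero => exact Pack.zero w
    | succ n ih => exact hn n ih
  have := (this (∑ a, w a + 1)).bound hcon
  omega

theorem sum_swap {n : ℕ} (F : Fin n → Finset X) {i j : Fin n} (hij : i ≠ j) (P Q : Finset X)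
    (g : Finset X → ℤ) :
    ∑ k, g (if k = i then P else if k = j then Q else F k) = ∑ k, g (F k) + (g P + g Q - g (F i) - g (F j)) := by
  have : ∀ k, g (if k = i then P else if k = j then Q else F k) =
      g (F k) + ((if k = i then g P - g (F i) else 0) + (if k = j then g Q - g (F j) else 0)) := by
    intro k
    by_cases h1 : k = i
    · subst h1; simp [hij]
    · by_cases h2 : k = j
      · subst h2; simp [h1]
      · simp [h1, h2]
  rw [Finset.sum_congr rfl (fun k _ => this k), Finset.sum_add_distrib, Finset.sum_add_distrib]
  simp
  ring

noncomputable def bi (x : X) (U : Finset X) : ℤ := if x ∈ U then 1 else 0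

theorem bi_mod (x : X) (U W : Finset X) : bi x (U ∩ W) + bi x (U ∪ W) = bi x U + bi x W := by
  unfold bi
  by_cases h1 : x ∈ U <;> by_cases h2 : x ∈ W <;> simp [h1, h2]

theorem ent_card {n : ℕ} {F : Fin n → Finset X} (hF : ∀ i, Dc hd tl (F i)) (a : A) :
    ((Finset.univ.filter (fun i => Ent hd tl a (F i))).card : ℤ) = ∑ k, (bi (hd a) (F k) - bi (tl a) (F k)) := by
  rw [Finset.card_filter]
  push_cast
  refine Finset.sum_congr rfl fun k _ => ?_
  have := (hF k).cl a
  unfold bi Ent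
  by_cases h1 : hd a ∈ F k <;> by_cases h2 : tl a ∈ F k <;> simp_all

theorem cross_free {w : A → ℕ} {n : ℕ} (h : Pack hd tl w n) :
    ∃ F : Fin n → Finset X, (∀ i, Dc hd tl (F i)) ∧
    (∀ a, (Finset.univ.filter (fun i => Ent hd tl a (F i))).card ≤ w a) ∧
    ∀ i j, F i ⊆ F j ∨ F j ⊆ F i ∨ F i ∩ F j = ∅ ∨ F i ∪ F j = Finset.univ := by
  obtain ⟨F0, h0⟩ := h
  obtain ⟨F, hF, hmax⟩ := Finset.exists_max_image
    (Finset.univ.filter (fun F : Fin n → Finset X => (∀ i, Dc hd tl (F i)) ∧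
      ∀ a, (Finset.univ.filter (fun i => Ent hd tl a (F i))).card ≤ w a))
    (fun F => ∑ k, ((F k).card : ℤ) ^ 2) ⟨F0, by simpa using h0⟩
  simp only [Finset.mem_filter, Finset.mem_univ, true_and] at hF hmax
  refine ⟨F, hF.1, hF.2, ?_⟩
  intro i j
  by_contra hn
  push Not at hn
  obtain ⟨n1, n2, n3, n4⟩ := hn
  have hij : i ≠ j := by rintro rfl; exact n1 (Finset.Subset.refl _)
  have hD : ∀ k, Dc hd tl (if k = i then F i ∩ F j else if k = j then F i ∪ F j else F k) := by
    intro k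
    split_ifs
    · refine ⟨fun a ha => ?_, n3, fun h => ?_⟩
      · rw [Finset.mem_inter] at ha ⊢
        exact ⟨(hF.1 i).cl a ha.1, (hF.1 j).cl a ha.2⟩
      · apply (hF.1 i).nu
        rw [Finset.eq_univ_iff_forall] at h ⊢
        exact fun x => (Finset.mem_inter.1 (h x)).1
    · refine ⟨fun a ha => ?_, (hF.1 i).ne.mono Finset.subset_union_left, n4⟩
      rw [Finset.mem_union] at ha ⊢
      exact ha.imp ((hF.1 i).cl a) ((hF.1 j).cl a)
    · exact hF.1 k
  have h1 := hmax (fun k => if k = i then F i ∩ F j else if k = j then F i ∪ F j else F k) ⟨hD, by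
    intro a
    have e1 := ent_card hD a
    have e2 := ent_card hF.1 a
    rw [sum_swap F hij _ _ (fun U => bi (hd a) U - bi (tl a) U)] at e1
    have e3 := bi_mod (hd a) (F i) (F j)
    have e4 := bi_mod (tl a) (F i) (F j)
    have e5 := hF.2 a
    have : ((Finset.univ.filter (fun k => Ent hd tl a
      (if k = i then F i ∩ F j else if k = j then F i ∪ F j else F k))).card : ℤ) =
      (Finset.univ.filter (fun i => Ent hd tl a (F i))).card := by
      rw [e1, e2]; linarith
    have e6 : (Finset.univ.filter (fun k => Ent hd tl a
      (if k = i then F i ∩ F j else if k = j then F i ∪ F j else F k))).card =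
      (Finset.univ.filter (fun i => Ent hd tl a (F i))).card := by exact_mod_cast this
    rw [e6]; exact e5⟩
  rw [sum_swap F hij _ _ (fun U => ((U.card : ℤ)) ^ 2)] at h1
  have c1 : ((F i ∩ F j).card : ℤ) + (F i ∪ F j).card = (F i).card + (F j).card := by
    exact_mod_cast Finset.card_inter_add_card_union (F i) (F j)
  have c2 : ((F i ∩ F j).card : ℤ) < (F i).card := by
    have := Finset.card_lt_card (Finset.ssubset_iff_subset_ne.2 ⟨Finset.inter_subset_left (s₁ := F i) (s₂ := F j),
      fun h => n1 (Finset.inter_eq_left.1 h)⟩)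
    exact_mod_cast this
  have c3 : ((F i ∩ F j).card : ℤ) < (F j).card := by
    have := Finset.card_lt_card (Finset.ssubset_iff_subset_ne.2 ⟨Finset.inter_subset_right (s₁ := F i) (s₂ := F j),
      fun h => n2 (Finset.inter_eq_right.1 h)⟩)
    exact_mod_cast this
  have c4 : ((F i ∪ F j).card : ℤ) = (F i).card + (F j).card - (F i ∩ F j).card := by linarith
  rw [c4] at h1
  nlinarith [mul_pos (sub_pos.2 c2) (sub_pos.2 c3)]

end
end FN

namespace FN
open Classical
set_option linter.unusedSectionVars false
set_option linter.unusedSimpArgs false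
set_option linter.unusedVariables false
universe u
section
variable {X : Type} [Fintype X] {A : Type u} [Fintype A] {hd tl : A → X}

def Prec {n : ℕ} (F : Fin n → Finset X) (j i : Fin n) : Prop := F i ⊂ F j ∨ (F i = F j ∧ j < i)

theorem Prec.trans {n : ℕ} {F : Fin n → Finset X} {i j k : Fin n} (h : Prec F i j) (h' : Prec F j k) :
    Prec F i k := by
  rcases h with h | ⟨h, h1⟩ <;> rcases h' with h' | ⟨h', h1'⟩
  · exact Or.inl (h'.trans h)
  · exact Or.inl (h' ▸ h)
  · exact Or.inl (h ▸ h')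
  · exact Or.inr ⟨h'.trans h, h1.trans h1'⟩

theorem Prec.irr {n : ℕ} {F : Fin n → Finset X} {i : Fin n} : ¬ Prec F i i := by
  rintro (h | ⟨h, h1⟩)
  · exact h.2 h.1
  · exact lt_irrefl _ h1

theorem half {w : A → ℕ} {N : ℕ} (h : Pack hd tl (fun a => 2 * w a) N) :
    ∃ N', N ≤ 2 * N' ∧ Pack hd tl w N' := by
  obtain ⟨F, hF, hc, hx⟩ := cross_free h
  let l : Fin N → ℕ := fun i => (Finset.univ.filter (fun j => Prec F j i)).card +
    (Finset.univ.filter (fun j => ¬ F i ⊆ F j ∧ F i ∪ F j = Finset.univ)).card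
  let ρ : A → Fin N → ℕ := fun a i => (Finset.univ.filter (fun j => Prec F j i ∧ Ent hd tl a (F j))).card
  have hl : ∀ a i, Ent hd tl a (F i) → l i = (Finset.univ.filter (fun j => tl a ∈ F j)).card + ρ a i := by
    intro a i hi
    simp only [l, ρ, Finset.card_filter, ← Finset.sum_add_distrib]
    refine Finset.sum_congr rfl fun j _ => ?_
    by_cases ht : tl a ∈ F j
    · have hh := (hF j).cl a ht
      have hE : ¬ Ent hd tl a (F j) := fun h => h.2 ht
      have hne : F i ≠ F j := fun h => hi.2 (h ▸ ht)
      by_cases hs : F i ⊆ F j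
      · have : Prec F j i := Or.inl (Finset.ssubset_iff_subset_ne.2 ⟨hs, hne⟩)
        simp [ht, hE, this, hs]
      · have h1 : ¬ Prec F j i := by
          rintro (h | h)
          · exact hs h.1
          · exact hne h.1
        have h2 : F i ∪ F j = Finset.univ := by
          rcases hx i j with h | h | h | h
          · exact absurd h hs
          · exact absurd (h ht) hi.2
          · have : hd a ∈ F i ∩ F j := Finset.mem_inter.2 ⟨hi.1, hh⟩
            rw [h] at this; simp at this
          · exact h
        simp [ht, hE, h1, hs, h2]
    · have h2 : F i ∪ F j ≠ Finset.univ := by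
        intro h
        have : tl a ∈ F i ∪ F j := by rw [h]; simp
        rcases Finset.mem_union.1 this with h | h
        · exact hi.2 h
        · exact ht h
      by_cases hp : Prec F j i
      · have : F i ⊆ F j := by
          rcases hp with h | h
          · exact h.1
          · exact h.1.subset
        have hE : Ent hd tl a (F j) := ⟨this hi.1, ht⟩
        simp [ht, hE, hp, h2]
      · simp [ht, hp, h2]
  have hlt : ∀ a i i', Ent hd tl a (F i) → Prec F i i' → ρ a i < ρ a i' := by
    intro a i i' hi hp
    refine Finset.card_lt_card (Finset.ssubset_iff_of_subset ?_ |>.2 ⟨i, ?_, ?_⟩)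
    · intro j hj
      simp only [Finset.mem_filter, Finset.mem_univ, true_and] at hj ⊢
      exact ⟨hj.1.trans hp, hj.2⟩
    · simpa using ⟨hp, hi⟩
    · simp [Prec.irr]
  have hinj : ∀ a i i', Ent hd tl a (F i) → Ent hd tl a (F i') → ρ a i = ρ a i' → i = i' := by
    intro a i i' hi hi' he
    by_contra hne
    have : Prec F i i' ∨ Prec F i' i := by
      by_cases h0 : F i = F i'
      · rcases lt_or_gt_of_ne hne with h | h
        · exact Or.inl (Or.inr ⟨h0.symm, h⟩)
        · exact Or.inr (Or.inr ⟨h0, h⟩)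
      rcases hx i i' with h | h | h | h
      · exact Or.inr (Or.inl (Finset.ssubset_iff_subset_ne.2 ⟨h, h0⟩))
      · exact Or.inl (Or.inl (Finset.ssubset_iff_subset_ne.2 ⟨h, fun h => h0 h.symm⟩))
      · have : hd a ∈ F i ∩ F i' := Finset.mem_inter.2 ⟨hi.1, hi'.1⟩
        rw [h] at this; simp at this
      · have : tl a ∈ F i ∪ F i' := by rw [h]; simp
        rcases Finset.mem_union.1 this with h | h
        · exact absurd h hi.2
        · exact absurd h hi'.2
    rcases this with h | h
    · have := hlt a _ _ hi h; omega
    · have := hlt a _ _ hi' h; omega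
  have hb : ∀ a i, Ent hd tl a (F i) → ρ a i < 2 * w a := by
    intro a i hi
    refine lt_of_lt_of_le (Finset.card_lt_card (Finset.ssubset_iff_of_subset ?_ |>.2 ⟨i, ?_, ?_⟩)) (hc a)
    · intro j hj
      simp only [Finset.mem_filter, Finset.mem_univ, true_and] at hj ⊢
      exact hj.2
    · simpa using hi
    · simp [Prec.irr]
  have hpk : ∀ r, Pack hd tl w (Finset.univ.filter (fun i => l i % 2 = r)).card := by
    intro r
    refine pack_of _ F (fun i _ => hF i) fun a => ?_
    rw [← Finset.card_range (w a)]
    refine Finset.card_le_card_of_injOn (fun i => ρ a i / 2) ?_ ?_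
    · intro i hi
      simp only [Finset.coe_filter, Finset.mem_filter, Finset.mem_univ, true_and, Set.mem_ofPred_eq] at hi
      have := hb a i hi.2
      simp only [Finset.coe_range, Set.mem_Iio]
      omega
    · intro i hi i' hi' he
      simp only [Finset.coe_filter, Finset.mem_filter, Finset.mem_univ, true_and, Set.mem_ofPred_eq] at hi hi' he
      apply hinj a i i' hi.2 hi'.2
      have e1 := hl a i hi.2
      have e2 := hl a i' hi'.2
      omega
  have hs : N = (Finset.univ.filter (fun i => l i % 2 = 0)).card + (Finset.univ.filter (fun i => l i % 2 = 1)).card := by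
    have := Finset.card_filter_add_card_filter_not (s := (Finset.univ : Finset (Fin N))) (fun i => l i % 2 = 0)
    simp only [Finset.card_univ, Fintype.card_fin] at this
    have e : (Finset.univ.filter (fun i => ¬ l i % 2 = 0)) = (Finset.univ.filter (fun i => l i % 2 = 1)) := by
      ext i
      simp
    rw [e] at this
    exact this.symm
  by_cases h0 : N ≤ 2 * (Finset.univ.filter (fun i => l i % 2 = 0)).card
  · exact ⟨_, h0, hpk 0⟩
  · exact ⟨_, by omega, hpk 1⟩

noncomputable def ib (B : Finset A) (a : A) : ℕ := if a ∈ B then 1 else 0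

theorem ly_aux (hcon : ∀ U, Dc hd tl U → ∃ a, Ent hd tl a U) (k : ℕ) : ∀ B : Finset A, B.card = k →
    ∃ T ⊆ B, ∃ n, Pack hd tl (ib B) n ∧ T.card ≤ n ∧
      ∀ U, Dc hd tl U → (∀ a, Ent hd tl a U → a ∈ B) → ∃ a ∈ T, Ent hd tl a U := by
  induction k with
  | zero =>
    intro B hB
    refine ⟨∅, by simp, 0, Pack.zero _, by simp, fun U hU h => ?_⟩
    obtain ⟨a, ha⟩ := hcon U hU
    have := h a ha
    rw [Finset.card_eq_zero.1 hB] at this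
    simp at this
  | succ k ih =>
    intro B hB
    obtain ⟨n, hn, hn1⟩ := Pack.exists_max hcon (ib B)
    by_cases h1 : ∃ e ∈ B, ¬ Pack hd tl (ib (B.erase e)) n
    · obtain ⟨e, he, hne⟩ := h1
      obtain ⟨T, hT, m, hm, hc, hh⟩ := ih (B.erase e) (by rw [Finset.card_erase_of_mem he, hB]; rfl)
      have hmn : m < n := by
        by_contra hl
        exact hne (hm.mono (fun _ => le_rfl) (by omega))
      refine ⟨insert e T, ?_, n, hn, (Finset.card_insert_le _ _).trans (by omega), fun U hU h => ?_⟩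
      · intro x hx
        rcases Finset.mem_insert.1 hx with rfl | hx
        · exact he
        · exact Finset.mem_of_mem_erase (hT hx)
      · by_cases hE : Ent hd tl e U
        · exact ⟨e, by simp, hE⟩
        · obtain ⟨a, ha, ha'⟩ := hh U hU (fun a ha => Finset.mem_erase.2 ⟨by rintro rfl; exact hE ha, h a ha⟩)
          exact ⟨a, Finset.mem_insert_of_mem ha, ha'⟩
    push Not at h1
    by_cases h0 : n = 0
    · subst h0
      refine ⟨∅, by simp, 0, hn, by simp, fun U hU h => ?_⟩
      exfalso
      apply hn1
      refine ⟨fun _ => U, fun _ => hU, fun a => ?_⟩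
      by_cases ha : Ent hd tl a U
      · simp [ib, ha, h a ha]
      · simp [ha]
    exfalso
    obtain ⟨B2, hB2, hmax⟩ := Finset.exists_max_image
      (B.powerset.filter (fun C => ¬ Pack hd tl (fun a => ib B a + ib C a) (n + 1))) Finset.card
      ⟨∅, Finset.mem_filter.2 ⟨by simp, fun h => hn1 (h.mono (fun a => by simp [ib]) le_rfl)⟩⟩
    simp only [Finset.mem_filter, Finset.mem_powerset] at hB2 hmax
    have hne : B2 ≠ B := by
      rintro rfl
      exact hB2.2 ((hn.add hn).mono (fun _ => le_rfl) (by omega))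
    obtain ⟨e, heB, he2⟩ : ∃ e ∈ B, e ∉ B2 := by
      by_contra hh
      push Not at hh
      exact hne (Finset.Subset.antisymm hB2.1 hh)
    have hP : Pack hd tl (fun a => ib B a + ib (insert e B2) a) (n + 1) := by
      by_contra hh
      have := hmax (insert e B2) ⟨Finset.insert_subset heB hB2.1, hh⟩
      rw [Finset.card_insert_of_notMem he2] at this
      omega
    have h2 := (hP.add (h1 e heB)).mono (w' := fun a => 2 * (ib B a + ib B2 a)) (fun a => by
      simp only [ib, Finset.mem_insert, Finset.mem_erase]
      by_cases hae : a = e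
      · subst hae; simp [heB, he2]
      · have := @hB2.1 a
        by_cases ha : a ∈ B <;> by_cases ha2 : a ∈ B2 <;> simp [hae, ha, ha2] 
        ) le_rfl
    obtain ⟨N', hN, hp⟩ := half h2
    exact hB2.2 (hp.mono (fun _ => le_rfl) (by omega))

/-- Lucchesi-Younger -/
theorem ly (hcon : ∀ U, Dc hd tl U → ∃ a, Ent hd tl a U) :
    ∃ (T : Finset A) (n : ℕ), T.card ≤ n ∧ (∀ U, Dc hd tl U → ∃ a ∈ T, Ent hd tl a U) ∧
      ∃ F : Fin n → Finset X, (∀ i, Dc hd tl (F i)) ∧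
        ∀ i j, i ≠ j → ∀ a, Ent hd tl a (F i) → ¬ Ent hd tl a (F j) := by
  obtain ⟨T, -, n, ⟨F, hF, hc⟩, hn, hh⟩ := ly_aux hcon _ Finset.univ rfl
  refine ⟨T, n, hn, fun U hU => hh U hU (fun a _ => Finset.mem_univ _), F, hF, ?_⟩
  intro i j hij a hi hj
  have := hc a
  simp only [ib, Finset.mem_univ, if_true] at this
  exact hij (Finset.card_le_one.1 this i (by simpa using hi) j (by simpa using hj))

end
end FN

namespace FN
open Classical
set_option linter.unusedSectionVars false
set_option linter.unusedSimpArgs false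
set_option linter.unusedVariables false
universe u
section
variable {V : Type u} [Fintype V] {G : SimpleGraph V}

theorem mem_fst {o : V} {c : G.Walk o o} (hc : c.IsCycle) {x : V} (hx : x ∈ c.support) :
    ∃ d ∈ c.darts, d.fst = x := by
  cases c with
  | nil => simp at hc
  | @cons _ y _ h p =>
    rw [← Walk.map_fst_darts_append, List.mem_append] at hx
    rcases hx with hx | hx
    · simpa using List.mem_map.1 hx
    · rw [List.mem_singleton] at hx
      exact ⟨⟨(o, y), h⟩, by simp, hx.symm⟩

theorem mem_snd {o : V} {c : G.Walk o o} (hc : c.IsCycle) {x : V} (hx : x ∈ c.support) :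
    ∃ d ∈ c.darts, d.snd = x := by
  have h1 := mem_fst hc.reverse (x := x) (by simpa using hx)
  obtain ⟨d, hd, rfl⟩ := h1
  rw [Walk.darts_reverse] at hd
  simp only [List.mem_reverse, List.mem_map] at hd
  obtain ⟨d', hd', rfl⟩ := hd
  exact ⟨d', hd', rfl⟩

theorem dg (hG : Good G) (D : V → V → Prop) (h1 : ∀ u v, D u v → G.Adj u v)
    (h2 : ∀ u v, G.Adj u v → D u v ∨ D v u) (h3 : ∀ u v, D u v → ¬ D v u) :
    ∃ (T : Finset (V × V)) (n : ℕ), T.card ≤ n ∧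
      (∀ g, IsCirc G g → (∀ u v, D u v → 0 ≤ g u v) → (∃ u v, g u v ≠ 0) →
        ∃ u v, (u, v) ∈ T ∧ D u v ∧ 0 < g u v) ∧
      ∃ (o : Fin n → V) (c : ∀ i, G.Walk (o i) (o i)), (∀ i, (c i).IsCycle) ∧
        (∀ i, ∀ d ∈ (c i).darts, D d.fst d.snd) ∧
        ∀ i j, i ≠ j → ∀ u v, (∃ d ∈ (c i).darts, d.fst = u ∧ d.snd = v) →
          ¬ (∃ d ∈ (c j).darts, d.fst = u ∧ d.snd = v) := by
  obtain ⟨X, hX, L, hL, hC⟩ := hG.conn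
  haveI := Fintype.ofFinite X
  obtain ⟨T, n, hT, hh, F, hF, hdis⟩ := ly (X := X) (A := {p : V × V // D p.1 p.2})
    (hd := fun a => L a.1.1 a.1.2) (tl := fun a => L a.1.2 a.1.1) (by
      intro U hU
      by_contra hn
      push Not at hn
      have key : ∀ u v, D u v → (L u v ∈ U ↔ L v u ∈ U) := by
        intro u v h
        refine ⟨fun h' => ?_, fun h' => hU.cl ⟨(u, v), h⟩ h'⟩
        by_contra h''
        exact hn ⟨(u, v), h⟩ ⟨h', h''⟩
      have h := hC (fun x => if x ∈ U then 1 else 0) (by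
        intro u v
        by_cases huv : G.Adj u v
        · rcases h2 u v huv with h | h
          · simp [key u v h]
          · simp [key v u h]
        · rw [hL.na u v huv])
      obtain ⟨x, hx⟩ := hU.ne
      apply hU.nu
      rw [Finset.eq_univ_iff_forall]
      intro y
      have := h x y
      by_contra hy
      simp [hx, hy] at this)
  refine ⟨T.image Subtype.val, n, Finset.card_image_le.trans hT, ?_, ?_⟩
  · intro g hg hpos ⟨a, b, hab⟩
    obtain ⟨a, b, hab⟩ : ∃ a b, 0 < g a b := by
      rcases lt_or_gt_of_ne hab with h | h
      · exact ⟨b, a, by have := hg.anti a b; omega⟩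
      · exact ⟨a, b, h⟩
    obtain ⟨p, hp⟩ := hL.rep g hg
    obtain ⟨e, he, hE⟩ := hh (Finset.univ.filter (fun x => p (L a b) ≤ p x)) (by
      refine ⟨fun e => ?_, ⟨L a b, by simp⟩, fun h => ?_⟩
      · have := hpos _ _ e.2
        rw [hp] at this
        simp only [Finset.mem_filter, Finset.mem_univ, true_and]
        intro h; omega
      · rw [Finset.eq_univ_iff_forall] at h
        have := h (L b a)
        simp only [Finset.mem_filter, Finset.mem_univ, true_and] at this
        rw [hp] at hab
        omega)
    refine ⟨e.1.1, e.1.2, Finset.mem_image.2 ⟨e, he, rfl⟩, e.2, ?_⟩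
    obtain ⟨hE1, hE2⟩ := hE
    simp only [Finset.mem_filter, Finset.mem_univ, true_and] at hE1 hE2
    rw [hp]; omega
  · have hcy : ∀ i, ∃ (o : V) (c : G.Walk o o), c.IsCycle ∧ ∀ d ∈ c.darts,
        0 < ind (F i : Set X) (L d.fst d.snd) - ind (F i : Set X) (L d.snd d.fst) := by
      intro i
      refine pos_cycle_circ (hL.circ (ind (F i : Set X))) ?_
      by_contra hn
      push Not at hn
      have h := hC (ind (F i : Set X)) (fun u v => by have := hn u v; omega)
      obtain ⟨x, hx⟩ := (hF i).ne
      apply (hF i).nu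
      rw [Finset.eq_univ_iff_forall]
      intro y
      have := h x y
      by_contra hy
      simp [ind, hx, hy] at this
    choose o c hc hcd using hcy
    have hE : ∀ i, ∀ d ∈ (c i).darts, L d.fst d.snd ∈ F i ∧ L d.snd d.fst ∉ F i := by
      intro i d hd
      have := hcd i d hd
      unfold ind at this
      by_cases h1 : L d.fst d.snd ∈ F i <;> by_cases h2 : L d.snd d.fst ∈ F i <;> simp_all
    have hD : ∀ i, ∀ d ∈ (c i).darts, D d.fst d.snd := by
      intro i d hd
      rcases h2 _ _ d.adj with h | h
      · exact h
      · exact absurd ((hF i).cl ⟨(d.snd, d.fst), h⟩ (hE i d hd).1) (hE i d hd).2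
    refine ⟨o, c, hc, hD, ?_⟩
    rintro i j hij u v ⟨d, hd, rfl, rfl⟩ ⟨d', hd', e1, e2⟩
    have := hE j d' hd'
    rw [e1, e2] at this
    exact hdis i j hij ⟨(d.fst, d.snd), hD i d hd⟩ (hE i d hd) this

end
end FN

namespace FN
open Classical
set_option linter.unusedSectionVars false
set_option linter.unusedSimpArgs false
set_option linter.unusedVariables false
universe u
section
variable {V : Type u} [Fintype V] {G : SimpleGraph V}

theorem pm_mate {M : Set (Sym2 V)} (hM : IsPMOn G Set.univ M) (v : V) :
    ∃ a, s(v, a) ∈ M ∧ ∀ z, s(v, z) ∈ M → z = a := by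
  obtain ⟨e, he, hv⟩ := hM.2.2.2 v trivial
  obtain ⟨a, rfl⟩ := hv
  refine ⟨a, he, fun z hz => ?_⟩
  by_contra hne
  have : s(v, z) ≠ s(v, a) := by
    intro h
    rw [Sym2.congr_right] at h
    exact hne h
  exact hM.2.2.1 hz he this v (by simp) (by simp)

theorem pm_of {M : Set (Sym2 V)} (h1 : M ⊆ G.edgeSet)
    (h2 : ∀ v, ∃ a, s(v, a) ∈ M ∧ ∀ z, s(v, z) ∈ M → z = a) : IsPMOn G Set.univ M := by
  refine ⟨h1, fun _ _ _ _ => trivial, ?_, fun v _ => ?_⟩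
  · intro e he f hf hne v hv hv'
    obtain ⟨x, rfl⟩ := hv
    obtain ⟨y, rfl⟩ := hv'
    obtain ⟨a, -, ha⟩ := h2 v
    exact hne (by rw [ha x he, ha y hf])
  · obtain ⟨a, ha, -⟩ := h2 v
    exact ⟨_, ha, by simp⟩

theorem pm_sum {M : Set (Sym2 V)} (hM : IsPMOn G Set.univ M) (v : V) :
    ∑ u, (if s(v, u) ∈ M then (1 : ℤ) else 0) = 1 := by
  obtain ⟨a, ha, hu⟩ := pm_mate hM v
  have : ∀ u, (if s(v, u) ∈ M then (1 : ℤ) else 0) = if u = a then 1 else 0 := by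
    intro u
    by_cases h : s(v, u) ∈ M
    · rw [if_pos h, if_pos (hu u h)]
    · have : u ≠ a := by rintro rfl; exact h ha
      simp [h, this]
  simp [this]

theorem edge_head {u v : V} (p : G.Walk u v) {e : Sym2 V} (h : p.edges.head? = some e) : u ∈ e := by
  cases p with
  | nil => simp at h
  | cons h' p => simp at h; subst h; simp

theorem edge_last {u v : V} (p : G.Walk u v) {e : Sym2 V} (h : p.edges.getLast? = some e) : v ∈ e := by
  induction p with
  | nil => simp at h
  | cons h' p ih =>
    cases p with
    | nil => simp at h; subst h; simp
    | cons h'' q =>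
      apply ih
      rw [Walk.edges_cons, Walk.edges_cons, List.getLast?_cons_cons] at h
      rw [Walk.edges_cons]
      exact h

theorem alt_int {M : Set (Sym2 V)} {u v : V} (p : G.Walk u v)
    (hp : p.edges.IsChain (fun e f => e ∈ M ↔ f ∉ M)) {x : V} (hx : x ∈ p.support) (hu : x ≠ u) (hv : x ≠ v) :
    ∃ e ∈ p.edges, x ∈ e ∧ e ∈ M := by
  induction p with
  | nil => simp at hx; exact absurd hx hu
  | @cons a b c h' p ih =>
    rw [Walk.support_cons, List.mem_cons] at hx
    rcases hx with hx | hx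
    · exact absurd hx hu
    rw [Walk.edges_cons, List.isChain_cons] at hp
    by_cases hb : x = b
    · subst hb
      cases p with
      | nil => exact absurd rfl hv
      | @cons _ d _ h'' q =>
        have := hp.1 s(x, d) (by simp)
        by_cases hm : s(x, d) ∈ M
        · exact ⟨s(x, d), by simp, by simp, hm⟩
        · exact ⟨s(a, x), by simp, by simp, this.2 hm⟩
    · obtain ⟨e, he, h⟩ := ih hp.2 hx hb hv
      exact ⟨e, by rw [Walk.edges_cons]; exact List.mem_cons_of_mem _ he, h⟩

theorem alt_at {M : Set (Sym2 V)} {o : V} {c : G.Walk o o} (hc : IsAltCycle G M c) {x : V}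
    (hx : x ∈ c.support) : ∃ e ∈ c.edges, x ∈ e ∧ e ∈ M := by
  obtain ⟨h1, h2, h3⟩ := hc
  by_cases hxo : x = o
  · subst hxo
    cases hh : c.edges with
    | nil =>
      cases c with
      | nil => simp at h1
      | cons _ _ => simp at hh
    | cons e l =>
      have e1 : c.edges.head? = some e := by rw [hh]; rfl
      obtain ⟨f, hf⟩ : ∃ f, c.edges.getLast? = some f := by
        rw [hh, List.getLast?_cons]; exact ⟨_, rfl⟩
      have := h3 e f e1 hf
      rw [← hh]
      by_cases he : e ∈ M
      · exact ⟨e, List.mem_of_head? e1, edge_head c e1, he⟩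
      · exact ⟨f, List.mem_of_getLast? hf, edge_last c hf, this.2 he⟩
  · exact alt_int c h2 hx hxo hxo

theorem forcing_hits {M S : Set (Sym2 V)} (hM : IsPMOn G Set.univ M) (hS : IsForcingOn G Set.univ M S)
    {o : V} {c : G.Walk o o} (hc : IsAltCycle G M c) : ∃ e ∈ S, e ∈ c.edges := by
  by_contra hn
  push Not at hn
  have hM' := hS.2 {e | (e ∈ M ∧ e ∉ c.edges) ∨ (e ∉ M ∧ e ∈ c.edges)} (by
    apply pm_of
    · rintro e (h | h)
      · exact hM.1 h.1
      · exact c.edges_subset_edgeSet h.2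
    · intro v
      obtain ⟨m, hm, hmu⟩ := pm_mate hM v
      by_cases hv : v ∈ c.support
      · obtain ⟨a, b, hab, ha, hb, hu⟩ := cyc_nbrs hc.1 hv
        obtain ⟨e, he, hve, heM⟩ := alt_at hc hv
        obtain ⟨z, rfl⟩ := hve
        have hz := hmu z heM
        subst hz
        have key : ∀ a b, a ≠ b → s(v, b) ∈ c.edges → (∀ z, s(v, z) ∈ c.edges → z = a ∨ z = b) →
            z = a → ∃ a, s(v, a) ∈ {e | (e ∈ M ∧ e ∉ c.edges) ∨ (e ∉ M ∧ e ∈ c.edges)} ∧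
            ∀ z, s(v, z) ∈ {e | (e ∈ M ∧ e ∉ c.edges) ∨ (e ∉ M ∧ e ∈ c.edges)} → z = a := by
          rintro a b hab hb hu rfl
          refine ⟨b, Or.inr ⟨fun h => hab (hmu b h).symm, hb⟩, ?_⟩
          rintro y (h | h)
          · have := hmu y h.1
            subst this
            exact absurd he h.2
          · rcases hu y h.2 with rfl | rfl
            · exact absurd hm h.1
            · rfl
        rcases hu z he with h | h
        · exact key a b hab hb hu h
        · exact key b a hab.symm ha (fun z h => (hu z h).symm) h
      · have hno : ∀ z, s(v, z) ∉ c.edges := fun z h => hv (c.fst_mem_support_of_mem_edges h)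
        refine ⟨m, Or.inl ⟨hm, hno m⟩, ?_⟩
        rintro z (h | h)
        · exact hmu z h.1
        · exact absurd h.2 (hno z))
    (fun e he => Or.inl ⟨hS.1 he, hn e he⟩)
  obtain ⟨e, he, -, heM⟩ := alt_at hc c.start_mem_support
  have : e ∈ {e | (e ∈ M ∧ e ∉ c.edges) ∨ (e ∉ M ∧ e ∈ c.edges)} := by rw [hM']; exact heM
  rcases this with h | h
  · exact h.2 he
  · exact h.1 heM

theorem le_forcing {M S : Set (Sym2 V)} (hM : IsPMOn G Set.univ M) (hS : IsForcingOn G Set.univ M S)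
    {n : ℕ} {v : Fin n → V} {c : ∀ i, G.Walk (v i) (v i)} (hc : ∀ i, IsAltCycle G M (c i))
    (hd : ∀ i j, i ≠ j → ∀ x, x ∈ (c i).support → x ∉ (c j).support) : n ≤ S.ncard := by
  choose f hf hf' using fun i => forcing_hits hM hS (hc i)
  have hinj : Function.Injective f := by
    intro i j h
    by_contra hne
    have h1 := hf' i
    have h2 := hf' j
    rw [← h] at h2
    revert h1 h2
    refine Sym2.ind (fun a b => ?_) (f i)
    intro h1 h2
    exact hd i j hne a ((c i).fst_mem_support_of_mem_edges h1) ((c j).fst_mem_support_of_mem_edges h2)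
  calc n = (Set.range f).ncard := by
        rw [← Set.image_univ, Set.ncard_image_of_injective _ hinj, Set.ncard_univ, Nat.card_fin]
    _ ≤ S.ncard := Set.ncard_le_ncard (by rintro _ ⟨i, rfl⟩; exact hf i) (Set.toFinite S)

/-- colour classes alternate along directed walks -/
theorem dir_head {M : Set (Sym2 V)} {bl : V → Prop} {u v : V} (p : G.Walk u v)
    (hp : ∀ d ∈ p.darts, s(d.fst, d.snd) ∈ M ↔ bl d.fst) {e : Sym2 V} (h : p.edges.head? = some e) :
    e ∈ M ↔ bl u := by
  cases p with
  | nil => simp at h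
  | @cons _ y _ h' p =>
    simp at h; subst h
    exact hp ⟨(u, y), h'⟩ (by simp)

theorem dir_chain {M : Set (Sym2 V)} {bl : V → Prop} (hb : ∀ u v, G.Adj u v → (bl u ↔ ¬ bl v)) {u v : V}
    (p : G.Walk u v) (hp : ∀ d ∈ p.darts, s(d.fst, d.snd) ∈ M ↔ bl d.fst) :
    p.edges.IsChain (fun e f => e ∈ M ↔ f ∉ M) := by
  induction p with
  | nil => simp
  | @cons a b c h' p ih =>
    rw [Walk.edges_cons, List.isChain_cons]
    have hp' : ∀ d ∈ p.darts, s(d.fst, d.snd) ∈ M ↔ bl d.fst := fun d hd => hp d (by simp [hd])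
    refine ⟨fun f hf => ?_, ih hp'⟩
    rw [dir_head p hp' hf, ← hb a b h']
    exact hp ⟨(a, b), h'⟩ (by simp)

theorem dir_last {M : Set (Sym2 V)} {bl : V → Prop} (hb : ∀ u v, G.Adj u v → (bl u ↔ ¬ bl v)) {u v : V}
    (p : G.Walk u v) (hp : ∀ d ∈ p.darts, s(d.fst, d.snd) ∈ M ↔ bl d.fst) {e : Sym2 V}
    (h : p.edges.getLast? = some e) : e ∈ M ↔ ¬ bl v := by
  induction p with
  | nil => simp at h
  | @cons a b c h' p ih =>
    cases p with
    | nil =>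
      simp at h; subst h
      rw [← hb a b h']
      exact hp ⟨(a, b), h'⟩ (by simp)
    | cons h'' q =>
      apply ih
      · intro d hd
        exact hp d (by rw [Walk.darts_cons]; exact List.mem_cons_of_mem _ hd)
      · rw [Walk.edges_cons, Walk.edges_cons, List.getLast?_cons_cons] at h
        rw [Walk.edges_cons]
        exact h

theorem aux1 (b p q : Prop) (h : (if b then (1 : ℤ) else -1) *
    ((if p then 1 else 0) - (if q then 1 else 0)) = 0) : q ↔ p := by
  by_cases hb : b <;> by_cases hp : p <;> by_cases hq : q <;> simp_all

theorem aux2 (b p q r : Prop) (h0 : p ↔ b) (h : 0 < (if b then (1 : ℤ) else -1) *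
    ((if p then 1 else 0) - (if q then 1 else 0))) (h1 : p → r) (h2 : q → r) (h3 : r → p ∧ q) : False := by
  by_cases hb : b <;> by_cases hp : p <;> by_cases hq : q <;> by_cases hr : r <;> simp_all

theorem upper (hG : Good G) (hbip : G.Colorable 2) {M : Set (Sym2 V)} (hM : IsPMOn G Set.univ M) :
    ∃ S n, IsForcingOn G Set.univ M S ∧ S.ncard ≤ n ∧ ∃ v : Fin n → V, ∃ c : ∀ i, G.Walk (v i) (v i),
        (∀ i, IsAltCycle G M (c i)) ∧
          ∀ i j, i ≠ j → ∀ x, x ∈ (c i).support → x ∉ (c j).support := by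
  obtain ⟨bl, hb⟩ : ∃ bl : V → Prop, ∀ u v, G.Adj u v → (bl u ↔ ¬ bl v) := by
    obtain ⟨col⟩ := hbip
    refine ⟨fun v => col v = 0, fun u v h => ?_⟩
    have := col.valid h
    omega
  choose m hm hmu using pm_mate hM
  obtain ⟨T, n, hT, hhit, o, c, hc, hD, hdis⟩ := dg hG (fun u v => G.Adj u v ∧ (s(u, v) ∈ M ↔ bl u))
    (fun u v h => h.1)
    (fun u v h => by
      by_cases h' : s(u, v) ∈ M ↔ bl u
      · exact Or.inl ⟨h, h'⟩
      · refine Or.inr ⟨h.symm, ?_⟩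
        rw [Sym2.eq_swap]
        have := hb u v h
        tauto)
    (fun u v h h' => by
      have h2 := h'.2
      rw [Sym2.eq_swap] at h2
      have := hb u v h.1
      have := h.2
      tauto)
  refine ⟨((T.image (fun p => s(p.2, m p.2)) : Finset (Sym2 V)) : Set (Sym2 V)), n, ⟨?_, ?_⟩, ?_, o, c, ?_, ?_⟩
  · intro e he
    simp only [Finset.coe_image, Set.mem_image] at he
    obtain ⟨p, -, rfl⟩ := he
    exact hm _
  · intro M' hM' hS
    by_contra hne
    have hz : ∀ u v, ¬ G.Adj u v → s(u, v) ∉ M ∧ s(u, v) ∉ M' :=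
      fun u v h => ⟨fun h' => h (hM.1 h'), fun h' => h (hM'.1 h')⟩
    obtain ⟨u, v, huv, hDuv, hpos⟩ := hhit (fun u v => (if bl u then 1 else -1) *
      ((if s(u, v) ∈ M then 1 else 0) - (if s(u, v) ∈ M' then 1 else 0))) ⟨by
        intro u v
        rw [Sym2.eq_swap (a := v) (b := u)]
        by_cases h : G.Adj u v
        · have := hb u v h
          by_cases hv : bl v <;> simp [this, hv]
        · simp [hz u v h], by
        intro u v h
        by_contra hn
        exact h (by simp [hz u v hn]), by
        intro v
        rw [← Finset.mul_sum, Finset.sum_sub_distrib, pm_sum hM, pm_sum hM']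
        simp⟩ (by
        intro u v h
        have h2 := h.2
        by_cases hu : bl u <;> by_cases h' : s(u, v) ∈ M' <;> simp [h2, hu, h']) (by
        by_contra hn
        push Not at hn
        apply hne
        ext e
        refine Sym2.ind (fun u v => ?_) e
        exact aux1 _ _ _ (hn u v))
    have hmM' : s(v, m v) ∈ M' := hS (by
      rw [Finset.mem_coe]
      exact Finset.mem_image.2 ⟨(u, v), huv, rfl⟩)
    obtain ⟨a, ha, hau⟩ := pm_mate hM' v
    have e1 := hau _ hmM'
    have e2 : s(v, u) ∈ M → u = m v := hmu v u
    have e3 : s(v, u) ∈ M' → u = m v := fun h => (hau u h).trans e1.symm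
    rw [Sym2.eq_swap] at e2 e3
    have e4 : u = m v → s(u, v) ∈ M ∧ s(u, v) ∈ M' := by
      intro h
      rw [Sym2.eq_swap, h]
      exact ⟨hm v, hmM'⟩
    exact aux2 _ _ _ _ hDuv.2 hpos e2 e3 e4
  · rw [Set.ncard_coe_finset]
    exact Finset.card_image_le.trans hT
  · intro i
    have hp : ∀ d ∈ (c i).darts, s(d.fst, d.snd) ∈ M ↔ bl d.fst := fun d hd => (hD i d hd).2
    refine ⟨hc i, dir_chain hb _ hp, ?_⟩
    intro e f he hf
    rw [dir_last hb _ hp hf, dir_head _ hp he]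
  · intro i j hij x hx hx'
    by_cases hbx : bl x
    · have key : ∀ k, x ∈ (c k).support → ∃ d ∈ (c k).darts, d.fst = x ∧ d.snd = m x := by
        intro k hk
        obtain ⟨d, hd, rfl⟩ := mem_fst (hc k) hk
        exact ⟨d, hd, rfl, hmu _ _ ((hD k d hd).2.2 hbx)⟩
      exact hdis i j hij _ _ (key i hx) (key j hx')
    · have key : ∀ k, x ∈ (c k).support → ∃ d ∈ (c k).darts, d.fst = m x ∧ d.snd = x := by
        intro k hk
        obtain ⟨d, hd, rfl⟩ := mem_snd (hc k) hk
        have h1 := (hD k d hd).2.2 ((hb _ _ (hD k d hd).1).2 hbx)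
        rw [Sym2.eq_swap] at h1
        exact ⟨d, hd, hmu _ _ h1, rfl⟩
      exact hdis i j hij _ _ (key i hx) (key j hx')

end
end FN

/-- For a planar bipartite graph, the forcing number of any perfect matching `M`
equals the maximum number of pairwise vertex-disjoint `M`-alternating cycles. -/
theorem forcingNum_eq_max_disjoint_alt_cycles {V : Type*} [Fintype V]
    (G : SimpleGraph V) (hpl : IsPlanarGraph G) (hbip : G.Colorable 2)
    (M : Set (Sym2 V)) (hM : IsPMOn G Set.univ M) :
    forcingNumOn G Set.univ M =
      sSup {n : ℕ | ∃ v : Fin n → V, ∃ c : ∀ i, G.Walk (v i) (v i),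
        (∀ i, IsAltCycle G M (c i)) ∧
          ∀ i j, i ≠ j → ∀ x, x ∈ (c i).support → x ∉ (c j).support} := by
  obtain ⟨S, n, hS, hSn, hn⟩ := FN.upper (FN.IsPlanarGraph.good hpl) hbip hM
  have hle : ∀ m ∈ {n : ℕ | ∃ v : Fin n → V, ∃ c : ∀ i, G.Walk (v i) (v i),
        (∀ i, IsAltCycle G M (c i)) ∧
          ∀ i j, i ≠ j → ∀ x, x ∈ (c i).support → x ∉ (c j).support}, m ≤ forcingNumOn G Set.univ M := by
    rintro m ⟨v, c, hc, hd⟩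
    unfold forcingNumOn
    refine le_csInf ⟨_, S, hS, rfl⟩ ?_
    rintro k ⟨S', hS', rfl⟩
    exact FN.le_forcing hM hS' hc hd
  apply le_antisymm
  · have h1 : forcingNumOn G Set.univ M ≤ S.ncard := Nat.sInf_le ⟨S, hS, rfl⟩
    exact (h1.trans hSn).trans (le_csSup ⟨_, hle⟩ hn)
  · exact csSup_le ⟨n, hn⟩ hle
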